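/- Under the standing assumptions, the map λ ↦ ∫_Ω u_λ² dx is continuous on the interval (−λ₁(Ω), +∞). -/

import Mathlib

open MeasureTheory Set Filter Topology

noncomputable section

/-- `N`-dimensional Euclidean space. -/
abbrev Euc (N : ℕ) := EuclideanSpace ℝ (Fin N)

/-- The Laplacian of a real-valued function on Euclidean space, defined as the
sum of the pure second partial derivatives in the coordinate directions. -/
def lap {N : ℕ} (u : Euc N → ℝ) (x : Euc N) : ℝ :=
  ∑ i : Fin N,
    fderiv ℝ (fun y => fderiv ℝ u y (EuclideanSpace.single i 1)) x (EuclideanSpace.single i 1)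

/-- The first Dirichlet eigenvalue of `-Δ` on `Ω`, defined as the infimum of
Rayleigh quotients of nonzero smooth functions with compact support contained in `Ω`. -/
def firstEig {N : ℕ} (Ω : Set (Euc N)) : ℝ :=
  sInf { r : ℝ | ∃ φ : Euc N → ℝ, ContDiff ℝ (⊤ : ℕ∞) φ ∧ HasCompactSupport φ ∧
    tsupport φ ⊆ Ω ∧ φ ≠ 0 ∧
    r = (∫ x, ‖fderiv ℝ φ x‖ ^ 2) / (∫ x, (φ x) ^ 2) }

/-- `u` is a (classical) positive solution of `-Δ u + lam • u = f(x, u)` in `Ω`,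
vanishing on the boundary: `u ∈ C²(Ω) ∩ C(closure Ω)`, `u > 0` in `Ω`, `u = 0` on `∂Ω`. -/
def IsPosSolution {N : ℕ} (Ω : Set (Euc N)) (f : Euc N → ℝ → ℝ) (lam : ℝ)
    (u : Euc N → ℝ) : Prop :=
  ContDiffOn ℝ 2 u Ω ∧ ContinuousOn u (closure Ω) ∧ (∀ x ∈ Ω, 0 < u x) ∧
    (∀ x ∈ frontier Ω, u x = 0) ∧ ∀ x ∈ Ω, - lap u x + lam * u x = f x (u x)

/-- The standing assumptions of the paper: `Ω ⊆ ℝ^N` is a bounded domain with `C¹`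
boundary, convex in every coordinate direction and invariant under a blockwise
orthogonal group `G = O(m₁) × ⋯ × O(m_ℓ)` with every `m_i ≥ 2`; the nonlinearity
`f` satisfies (f1), (f2), (f3) with splitting `f(x,t) = d(x)|t|^{p-2} t + g(x,t)`;
and for every `λ > -λ₁(Ω)` the problem has exactly one positive solution `u λ`. -/
structure Standing (N : ℕ) (Ω : Set (Euc N)) (f : Euc N → ℝ → ℝ)
    (d : Euc N → ℝ) (g : Euc N → ℝ → ℝ) (p : ℝ) (u : ℝ → Euc N → ℝ) : Prop where
  dim : 2 ≤ N
  isOpen : IsOpen Ω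
  conn : IsConnected Ω
  bdd : Bornology.IsBounded Ω
  c1bdry : ∀ x ∈ frontier Ω, ∃ U : Set (Euc N), IsOpen U ∧ x ∈ U ∧
      ∃ F : Euc N → ℝ, ContDiff ℝ 1 F ∧ (∀ y ∈ U, fderiv ℝ F y ≠ 0) ∧
        Ω ∩ U = {y ∈ U | F y < 0}
  conv : ∀ i : Fin N, ∀ x ∈ Ω, ∀ y ∈ Ω, (∀ j, j ≠ i → x j = y j) → segment ℝ x y ⊆ Ω
  symm : ∃ ℓ : ℕ, 1 ≤ ℓ ∧ ∃ β : Fin N → Fin ℓ, Monotone β ∧ Function.Surjective β ∧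
      (∀ j, 2 ≤ (Finset.univ.filter (fun i => β i = j)).card) ∧
      ∀ e : Euc N ≃ₗᵢ[ℝ] Euc N,
        (∀ j : Fin ℓ, ∀ x : Euc N, (∀ i, β i ≠ j → x i = 0) → ∀ i, β i ≠ j → e x i = 0) →
          e '' Ω = Ω ∧ (∀ x t, f (e x) t = f x t) ∧ ∀ x, d (e x) = d x
  f_c1 : ContDiffOn ℝ 1 (Function.uncurry f) (Ω ×ˢ (univ : Set ℝ))
  f_zero : ∀ x ∈ Ω, f x 0 = 0 ∧ deriv (f x) 0 = 0
  f_ar : ∃ a b : ℝ, 2 < a ∧ a ≤ b ∧ (3 ≤ N → b < 2 * N / ((N : ℝ) - 2)) ∧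
      ∀ᵐ x ∂(volume : Measure (Euc N)).restrict Ω, ∀ t : ℝ, t ≠ 0 →
        0 < (a - 1) * f x t * t ∧ (a - 1) * f x t * t ≤ deriv (f x) t * t ^ 2 ∧
          deriv (f x) t * t ^ 2 ≤ (b - 1) * f x t * t
  f_bdd : ∃ M : ℝ, 0 < M ∧ ∀ x ∈ Ω, |f x 1| < M ∧ |f x (-1)| < M
  hp : 2 < p ∧ (3 ≤ N → p < 2 * N / ((N : ℝ) - 2))
  f_split : ∀ x t, f x t = d x * |t| ^ (p - 2) * t + g x t
  d_c1 : ContDiffOn ℝ 1 d (closure Ω)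
  d_bdd : ∃ C : ℝ, ∀ x ∈ Ω, |d x| ≤ C
  d_nonneg : ∀ x ∈ closure Ω, 0 ≤ d x
  d_zero : d 0 = 1
  g_top : ∀ x ∈ Ω, Tendsto (fun t : ℝ => g x t / t ^ (p - 1)) atTop (𝓝 0)
  g_zero : ∀ x ∈ Ω, Tendsto (fun t : ℝ => g x t / t) (𝓝[≠] (0 : ℝ)) (𝓝 0)
  mono : ∀ i : Fin N, ∀ x ∈ Ω, ∀ y ∈ Ω, (∀ j, j ≠ i → x j = y j) → |x i| ≤ |y i| →
      (∀ t, f y t ≤ f x t) ∧ d y ≤ d x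
  sol : ∀ lam : ℝ, - firstEig Ω < lam →
      IsPosSolution Ω f lam (u lam) ∧
        ∀ v, IsPosSolution Ω f lam v → EqOn v (u lam) (closure Ω)

open scoped ContDiff ENNReal Convolution

/-- A pair of radial mollification kernels with `∇ζ(y) = -η(y) y` and `∫ η = 1`. -/
structure IsKer {N : ℕ} (ζ η : Euc N → ℝ) : Prop where
  zs : ContDiff ℝ ∞ ζ
  es : ContDiff ℝ ∞ η
  z0 : ∀ y, 0 ≤ ζ y
  e0 : ∀ y, 0 ≤ η y
  zsupp : ∀ y, 1 ≤ ‖y‖ → ζ y = 0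
  esupp : ∀ y, 1 ≤ ‖y‖ → η y = 0
  epos : ∀ y, ‖y‖ < 1 → 0 < η y
  zle : ∀ y, ζ y ≤ η y
  zeven : ∀ y, ζ (-y) = ζ y
  eeven : ∀ y, η (-y) = η y
  eint : ∫ y, η y = 1
  grad : ∀ y v, fderiv ℝ ζ y v = - (η y * inner ℝ y v)

theorem hasCompactSupport_of_zero_off_ball {N : ℕ} {F : Type*} [Zero F] {g : Euc N → F} {R : ℝ}
    (h : ∀ y, R ≤ ‖y‖ → g y = 0) : HasCompactSupport g := by
  refine HasCompactSupport.of_support_subset_isCompact (isCompact_closedBall (0 : Euc N) R) ?_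
  intro y hy
  rw [mem_closedBall_zero_iff]
  by_contra hc
  exact hy (h y (not_le.mp hc).le)

theorem exists_isKer (N : ℕ) : ∃ ζ η : Euc N → ℝ, IsKer ζ η := by
  set ρ : ℝ → ℝ := fun t => (t⁻¹) ^ 2 * expNegInvGlue t with hρ
  have hρs : ContDiff ℝ ∞ ρ := by
    have := expNegInvGlue.contDiff_polynomial_eval_inv_mul (n := ⊤) (Polynomial.X ^ 2)
    simpa [hρ] using this
  have hρd : ∀ t, HasDerivAt expNegInvGlue (ρ t) t := by
    intro t
    have := expNegInvGlue.hasDerivAt_polynomial_eval_inv_mul 1 t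
    simpa [hρ] using this
  have hρ0 : ∀ t, 0 ≤ ρ t := fun t => mul_nonneg (sq_nonneg _) (expNegInvGlue.nonneg t)
  have hρp : ∀ t, 0 < t → 0 < ρ t := fun t ht =>
    mul_pos (pow_pos (inv_pos.2 ht) 2) (expNegInvGlue.pos_of_pos ht)
  have hρn : ∀ t, t ≤ 0 → ρ t = 0 := fun t ht => by
    simp [hρ, expNegInvGlue.zero_of_nonpos ht]
  set e : Euc N → ℝ := fun y => 2 * ρ (1 - ‖y‖ ^ 2) with he
  have hq : ContDiff ℝ ∞ (fun y : Euc N => 1 - ‖y‖ ^ 2) := contDiff_const.sub (contDiff_norm_sq ℝ)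
  have hes : ContDiff ℝ ∞ e := contDiff_const.mul (hρs.comp hq)
  have he0 : ∀ y, 0 ≤ e y := fun y => mul_nonneg zero_le_two (hρ0 _)
  have hesupp : ∀ y, 1 ≤ ‖y‖ → e y = 0 := fun y hy => by
    simp only [he]; rw [hρn _ (by nlinarith)]; simp
  have hepos : ∀ y, ‖y‖ < 1 → 0 < e y := fun y hy => by
    have : 0 < ρ (1 - ‖y‖ ^ 2) := hρp _ (by nlinarith [norm_nonneg y])
    simp only [he]; linarith
  have hI : 0 < ∫ y, e y := by
    have hcs : HasCompactSupport e := hasCompactSupport_of_zero_off_ball hesupp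
    refine (hes.continuous.integral_pos_of_hasCompactSupport_nonneg_nonzero hcs he0
      (x := 0) ?_)
    exact (hepos 0 (by simp)).ne'
  set c : ℝ := ∫ y, e y with hc
  refine ⟨fun y => c⁻¹ * expNegInvGlue (1 - ‖y‖ ^ 2), fun y => c⁻¹ * e y, ?_⟩
  have hci : 0 < c⁻¹ := inv_pos.2 hI
  refine ⟨contDiff_const.mul (expNegInvGlue.contDiff.comp hq), contDiff_const.mul hes,
    fun y => mul_nonneg hci.le (expNegInvGlue.nonneg _), fun y => mul_nonneg hci.le (he0 y),
    fun y hy => ?_, fun y hy => by simp [hesupp y hy], fun y hy => mul_pos hci (hepos y hy),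
    fun y => ?_, fun y => by simp, fun y => by simp [he], ?_, fun y v => ?_⟩
  · rw [expNegInvGlue.zero_of_nonpos (by nlinarith)]; simp
  · refine mul_le_mul_of_nonneg_left ?_ hci.le
    simp only [he, hρ]
    rcases le_or_gt (1 - ‖y‖ ^ 2) 0 with h | h
    · simp [expNegInvGlue.zero_of_nonpos h]
    · have h1 : 1 ≤ (1 - ‖y‖ ^ 2)⁻¹ := (one_le_inv₀ h).2 (by nlinarith [norm_nonneg y])
      have h2 : 1 ≤ ((1 - ‖y‖ ^ 2)⁻¹) ^ 2 := one_le_pow₀ h1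
      nlinarith [expNegInvGlue.nonneg (1 - ‖y‖ ^ 2)]
  · rw [integral_const_mul, inv_mul_cancel₀ hI.ne']
  · have h1 : HasFDerivAt (fun y : Euc N => 1 - ‖y‖ ^ 2) (-(2 • innerSL ℝ y)) y := by
      simpa using (hasStrictFDerivAt_norm_sq y).hasFDerivAt.const_sub 1
    have h2 := ((hρd (1 - ‖y‖ ^ 2)).comp_hasFDerivAt y h1).const_mul c⁻¹
    have h3 := h2.fderiv
    simp only [Function.comp_def] at h3
    rw [h3]
    simp [he]
    ring

/-- The partial derivative in the `i`-th coordinate direction. -/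
def pd {N : ℕ} (i : Fin N) (u : Euc N → ℝ) (x : Euc N) : ℝ :=
  fderiv ℝ u x (EuclideanSpace.single i 1)

theorem lap_eq_sum_pd {N : ℕ} (u : Euc N → ℝ) (x : Euc N) :
    lap u x = ∑ i, pd i (pd i u) x := rfl

theorem ContDiff.pd_top {N : ℕ} {u : Euc N → ℝ} (hu : ContDiff ℝ ∞ u) (i : Fin N) :
    ContDiff ℝ ∞ (pd i u) :=
  (hu.fderiv_right (m := ∞) (by simp)).clm_apply contDiff_const

theorem HasCompactSupport.pd {N : ℕ} {u : Euc N → ℝ} (hu : HasCompactSupport u) (i : Fin N) :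
    HasCompactSupport (pd i u) :=
  (hu.fderiv (𝕜 := ℝ)).mono (fun x hx => by
    simp only [Function.mem_support, _root_.pd] at hx ⊢
    intro h; rw [h] at hx; simp at hx)

theorem ContDiff.lap_top {N : ℕ} {u : Euc N → ℝ} (hu : ContDiff ℝ ∞ u) :
    ContDiff ℝ ∞ (lap u) := by
  have : lap u = fun x => ∑ i, pd i (pd i u) x := rfl
  rw [this]
  exact ContDiff.sum fun i _ => (hu.pd_top i).pd_top i

theorem tsupport_pd_subset {N : ℕ} (u : Euc N → ℝ) (i : Fin N) :
    tsupport (pd i u) ⊆ tsupport u := by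
  refine (closure_mono ?_).trans (tsupport_fderiv_subset ℝ (f := u))
  intro x hx
  simp only [Function.mem_support, _root_.pd] at hx ⊢
  intro h; rw [h] at hx; simp at hx

theorem tsupport_lap_subset {N : ℕ} (u : Euc N → ℝ) : tsupport (lap u) ⊆ tsupport u := by
  refine closure_minimal ?_ (isClosed_tsupport u)
  intro x hx
  by_contra hc
  refine hx ?_
  rw [lap_eq_sum_pd]
  refine Finset.sum_eq_zero fun i _ => ?_
  exact image_eq_zero_of_notMem_tsupport fun h =>
    hc (tsupport_pd_subset u i (tsupport_pd_subset _ i h))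

theorem HasCompactSupport.lap {N : ℕ} {u : Euc N → ℝ} (hu : HasCompactSupport u) :
    HasCompactSupport (lap u) :=
  hu.of_isClosed_subset (isClosed_tsupport _) (tsupport_lap_subset u)

theorem fderiv_eq_sum_pd {N : ℕ} (u : Euc N → ℝ) (x v : Euc N) :
    fderiv ℝ u x v = ∑ i, v i * pd i u x := by
  have : v = ∑ i, v i • EuclideanSpace.single i (1 : ℝ) := by
    ext j
    simp [Pi.single_apply]
  conv_lhs => rw [this]
  simp [pd]

theorem exists_bound_of_hasCompactSupport {N : ℕ} {u : Euc N → ℝ} (hu : Continuous u)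
    (hc : HasCompactSupport u) : ∃ C, 0 ≤ C ∧ ∀ x, |u x| ≤ C := by
  obtain ⟨C, hC⟩ := hc.exists_bound_of_continuous hu
  exact ⟨C, (norm_nonneg _).trans (hC 0), hC⟩

theorem hasDerivAt_average {N : ℕ} {ζ η ψ : Euc N → ℝ} (hk : IsKer ζ η)
    (hψ : ContDiff ℝ ∞ ψ) (hc : HasCompactSupport ψ) (x : Euc N) (s : ℝ) :
    HasDerivAt (fun s => ∫ y, η y * ψ (x - s • y)) (s * ∫ y, ζ y * lap ψ (x - s • y)) s := by
  have hηc : HasCompactSupport η := hasCompactSupport_of_zero_off_ball hk.esupp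
  have hζc : HasCompactSupport ζ := hasCompactSupport_of_zero_off_ball hk.zsupp
  have hfc : Continuous (fderiv ℝ ψ) := hψ.continuous_fderiv (by simp)
  obtain ⟨C, hC⟩ := (hc.fderiv (𝕜 := ℝ)).exists_bound_of_continuous hfc
  have hC0 : 0 ≤ C := (norm_nonneg _).trans (hC 0)
  have hηi : Integrable (fun y => |η y|) :=
    hk.es.continuous.abs.integrable_of_hasCompactSupport hηc.abs
  have key := hasDerivAt_integral_of_dominated_loc_of_deriv_le (μ := (volume : Measure (Euc N)))
    (s := univ) (x₀ := s) (F := fun s y => η y * ψ (x - s • y))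
    (F' := fun s y => η y * -(fderiv ℝ ψ (x - s • y) y)) (bound := fun y => |η y| * C)
    univ_mem ?_ ?_ ?_ ?_ ?_ ?_
  · refine key.2.congr_deriv (Eq.symm ?_)
    have h1 : ∀ y, η y * -(fderiv ℝ ψ (x - s • y) y)
        = ∑ i, pd i ζ y * pd i ψ (x - s • y) := by
      intro y
      rw [fderiv_eq_sum_pd, ← Finset.sum_neg_distrib, Finset.mul_sum]
      refine Finset.sum_congr rfl fun i _ => ?_
      have : pd i ζ y = - (η y * y i) := by
        rw [pd, hk.grad, EuclideanSpace.inner_single_right]; simp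
      rw [this]; ring
    have hsub : ContDiff ℝ ∞ (fun y : Euc N => x - s • y) := by fun_prop
    have hintg : ∀ (a : Euc N → ℝ) (b : Euc N → ℝ), ContDiff ℝ ∞ a → HasCompactSupport a →
        ContDiff ℝ ∞ b → Integrable (fun y => a y * b (x - s • y)) := fun a b ha hac hb =>
      (ha.continuous.mul (hb.comp hsub).continuous).integrable_of_hasCompactSupport hac.mul_right
    refine Eq.trans ?_ (integral_congr_ae (Eventually.of_forall h1)).symm
    rw [integral_finsetSum _ fun i _ => hintg _ _ (hk.zs.pd_top i) (hζc.pd i) (hψ.pd_top i)]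
    have h2 : ∀ i, ∫ y, pd i ζ y * pd i ψ (x - s • y)
        = s * ∫ y, ζ y * pd i (pd i ψ) (x - s • y) := by
      intro i
      have hder : ∀ y, fderiv ℝ (fun y => pd i ψ (x - s • y)) y (EuclideanSpace.single i 1)
          = - s * pd i (pd i ψ) (x - s • y) := by
        intro y
        have h3 : HasFDerivAt (fun y : Euc N => x - s • y)
            (-(s • ContinuousLinearMap.id ℝ (Euc N))) y :=
          ((hasFDerivAt_id y).const_smul s).const_sub x
        have h4 := (((hψ.pd_top i).differentiable (by simp)) (x - s • y)).hasFDerivAt.comp y h3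
        have h5 : fderiv ℝ (fun y => pd i ψ (x - s • y)) y = _ := h4.fderiv
        rw [h5]
        simp [pd]
      have h6 := integral_mul_fderiv_eq_neg_fderiv_mul_of_integrable (𝕜 := ℝ)
        (μ := (volume : Measure (Euc N))) (f := ζ) (g := fun y => pd i ψ (x - s • y))
        (v := EuclideanSpace.single i 1) (hintg _ _ (hk.zs.pd_top i) (hζc.pd i) (hψ.pd_top i))
        (by
          simp_rw [hder]
          have := (hintg _ _ hk.zs hζc ((hψ.pd_top i).pd_top i)).const_mul (-s)
          refine this.congr (Eventually.of_forall fun y => ?_)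
          simp only; ring)
        (hintg _ _ hk.zs hζc (hψ.pd_top i))
        (fun y _ => (hk.zs.differentiable (by simp)) y)
        (fun y _ => ((hψ.pd_top i).comp hsub).differentiable (by simp) y)
      simp_rw [hder] at h6
      have h7 : ∫ y, pd i ζ y * pd i ψ (x - s • y)
          = - ∫ y, ζ y * (-s * pd i (pd i ψ) (x - s • y)) := by
        rw [h6, neg_neg]; rfl
      rw [h7, ← integral_neg, ← integral_const_mul]
      congr 1; ext y; ring
    simp_rw [h2]
    rw [← Finset.mul_sum, ← integral_finsetSum _ fun i _ =>
      hintg _ _ hk.zs hζc ((hψ.pd_top i).pd_top i)]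
    congr 2; ext y
    rw [lap_eq_sum_pd, Finset.mul_sum]
  · refine Eventually.of_forall fun s => Continuous.aestronglyMeasurable ?_
    have := hk.es.continuous; have := hψ.continuous
    fun_prop
  · have h8 : Continuous (fun y => η y * ψ (x - s • y)) := by
      have := hk.es.continuous; have := hψ.continuous
      fun_prop
    exact h8.integrable_of_hasCompactSupport hηc.mul_right
  · refine Continuous.aestronglyMeasurable ?_
    have := hk.es.continuous
    fun_prop
  · refine Eventually.of_forall fun y s _ => ?_
    rw [norm_mul, norm_neg, Real.norm_eq_abs]
    by_cases hy : 1 ≤ ‖y‖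
    · simp [hk.esupp y hy]
    · refine mul_le_mul_of_nonneg_left ?_ (abs_nonneg _)
      refine (ContinuousLinearMap.le_opNorm _ _).trans ?_
      calc _ ≤ C * 1 := mul_le_mul (hC _) (not_le.1 hy).le (norm_nonneg _) hC0
        _ = C := mul_one C
  · exact hηi.mul_const C
  · refine Eventually.of_forall fun y s _ => ?_
    have h3 : HasDerivAt (fun s : ℝ => x - s • y) (-y) s := by
      simpa using ((hasDerivAt_id s).smul_const y).const_sub x
    have h4 := ((hψ.differentiable (by simp)) (x - s • y)).hasFDerivAt.comp_hasDerivAt s h3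
    simpa using h4.const_mul (η y)

theorem average_sub_eq {N : ℕ} {ζ η ψ : Euc N → ℝ} (hk : IsKer ζ η)
    (hψ : ContDiff ℝ ∞ ψ) (hc : HasCompactSupport ψ) (x : Euc N) {ε : ℝ} (hε : 0 ≤ ε) :
    (∫ y, η y * ψ (x - ε • y)) - ψ x
      = ∫ s in Ioc 0 ε, s * ∫ y, ζ y * lap ψ (x - s • y) := by
  have hζc : HasCompactSupport ζ := hasCompactSupport_of_zero_off_ball hk.zsupp
  have hcont : Continuous (fun s : ℝ => s * ∫ y, ζ y * lap ψ (x - s • y)) := by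
    refine continuous_id.mul ?_
    obtain ⟨C, hC0, hC⟩ := exists_bound_of_hasCompactSupport hψ.lap_top.continuous hc.lap
    have h1 := hk.zs.continuous
    have h2 := hψ.lap_top.continuous
    refine continuous_of_dominated (bound := fun y => |ζ y| * C) (fun s => ?_) (fun s => ?_) ?_ ?_
    · exact Continuous.aestronglyMeasurable (by fun_prop)
    · refine Eventually.of_forall fun y => ?_
      rw [norm_mul]
      exact mul_le_mul_of_nonneg_left (hC _) (norm_nonneg _)
    · exact (h1.abs.integrable_of_hasCompactSupport hζc.abs).mul_const C
    · exact Eventually.of_forall fun y => by fun_prop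
  have := intervalIntegral.integral_eq_sub_of_hasDerivAt
    (fun s _ => hasDerivAt_average hk hψ hc x s) (hcont.intervalIntegrable 0 ε)
  rw [intervalIntegral.integral_of_le hε] at this
  rw [this]
  simp [integral_mul_const, hk.eint]

/-- Averaging of a function against a measure of translations. -/
def mc {N : ℕ} (μ : Measure (Euc N)) (h : Euc N → ℝ) (x : Euc N) : ℝ := ∫ z, h (x - z) ∂μ

/-- A finite even absolutely continuous measure supported in the ball of radius `R`. -/
structure IsAvg {N : ℕ} (μ : Measure (Euc N)) (R : ℝ) : Prop where
  fin : IsFiniteMeasure μ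
  inv : μ.IsNegInvariant
  ac : μ ≪ volume
  supp : ∀ᵐ z ∂μ, ‖z‖ ≤ R

section mc

variable {N : ℕ} {μ : Measure (Euc N)} {R : ℝ}

theorem mc_eq_convolution (ψ : Euc N → ℝ) :
    mc μ ψ = (fun _ : Euc N => (1 : ℝ)) ⋆[ContinuousLinearMap.lsmul ℝ ℝ, μ] ψ := by
  ext x
  simp [mc, convolution]

theorem contDiff_mc [IsFiniteMeasure μ] {ψ : Euc N → ℝ} (hψ : ContDiff ℝ ∞ ψ)
    (hc : HasCompactSupport ψ) : ContDiff ℝ ∞ (mc μ ψ) := by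
  rw [mc_eq_convolution]
  exact hc.contDiff_convolution_right _ (locallyIntegrable_const _) hψ

theorem hasFDerivAt_mc [IsFiniteMeasure μ] {ψ : Euc N → ℝ} (hψ : ContDiff ℝ 1 ψ)
    (hc : HasCompactSupport ψ) (x : Euc N) :
    HasFDerivAt (mc μ ψ) (∫ z, fderiv ℝ ψ (x - z) ∂μ) x := by
  obtain ⟨C, hC⟩ := (hc.fderiv (𝕜 := ℝ)).exists_bound_of_continuous
    (hψ.continuous_fderiv one_ne_zero)
  have h1 := hψ.continuous_fderiv one_ne_zero
  have h2 := hψ.continuous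
  obtain ⟨D, _, hD⟩ := exists_bound_of_hasCompactSupport h2 hc
  refine hasFDerivAt_integral_of_dominated_of_fderiv_le (μ := μ) (s := univ) (bound := fun _ => C)
    (F := fun x z => ψ (x - z)) (F' := fun x z => fderiv ℝ ψ (x - z)) univ_mem
    (Eventually.of_forall fun x => Continuous.aestronglyMeasurable (by fun_prop))
    (Integrable.of_bound (C := D) (Continuous.aestronglyMeasurable (by fun_prop))
      (Eventually.of_forall fun z => hD _))
    (Continuous.aestronglyMeasurable (by fun_prop))
    (Eventually.of_forall fun z x _ => hC _) (integrable_const _)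
    (Eventually.of_forall fun z x _ => ?_)
  have h3 : HasFDerivAt (fun x : Euc N => x - z) (ContinuousLinearMap.id ℝ (Euc N)) x :=
    (hasFDerivAt_id x).sub_const z
  exact ((hψ.differentiable one_ne_zero) (x - z)).hasFDerivAt.comp x h3

theorem pd_mc [IsFiniteMeasure μ] {ψ : Euc N → ℝ} (hψ : ContDiff ℝ 1 ψ)
    (hc : HasCompactSupport ψ) (i : Fin N) : pd i (mc μ ψ) = mc μ (pd i ψ) := by
  ext x
  rw [pd, (hasFDerivAt_mc hψ hc x).fderiv, ContinuousLinearMap.integral_apply]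
  · rfl
  · obtain ⟨C, hC⟩ := (hc.fderiv (𝕜 := ℝ)).exists_bound_of_continuous
      (hψ.continuous_fderiv one_ne_zero)
    refine Integrable.of_bound (C := C) ?_ (Eventually.of_forall fun z => hC _)
    have := hψ.continuous_fderiv one_ne_zero
    exact Continuous.aestronglyMeasurable (by fun_prop)

theorem integrable_shift [IsFiniteMeasure μ] {h : Euc N → ℝ} (hm : Measurable h) {C : ℝ}
    (hC : ∀ x, |h x| ≤ C) (x : Euc N) : Integrable (fun z => h (x - z)) μ :=
  Integrable.of_bound (C := C) (hm.comp (measurable_const.sub measurable_id)).aestronglyMeasurable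
    (Eventually.of_forall fun _ => hC _)

theorem integrable_shift_of_test [IsFiniteMeasure μ] {ψ : Euc N → ℝ} (hψ : Continuous ψ)
    (hc : HasCompactSupport ψ) (x : Euc N) : Integrable (fun z => ψ (x - z)) μ := by
  obtain ⟨C, _, hC⟩ := exists_bound_of_hasCompactSupport hψ hc
  exact integrable_shift hψ.measurable hC x

theorem lap_mc [IsFiniteMeasure μ] {ψ : Euc N → ℝ} (hψ : ContDiff ℝ ∞ ψ)
    (hc : HasCompactSupport ψ) : lap (mc μ ψ) = mc μ (lap ψ) := by
  ext x
  rw [lap_eq_sum_pd]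
  have h1 : ∀ i, pd i (pd i (mc μ ψ)) = mc μ (pd i (pd i ψ)) := fun i => by
    rw [pd_mc (hψ.of_le (by simp)) hc, pd_mc ((hψ.pd_top i).of_le (by simp)) (hc.pd i)]
  simp_rw [h1, mc, lap_eq_sum_pd]
  rw [integral_finsetSum]
  exact fun i _ => integrable_shift_of_test ((hψ.pd_top i).pd_top i).continuous ((hc.pd i).pd i) x

theorem IsAvg.mc_eq_zero (hμ : IsAvg μ R) {ψ : Euc N → ℝ} {x : Euc N}
    (h : ∀ z, ‖z‖ ≤ R → ψ (x - z) = 0) : mc μ ψ x = 0 := by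
  refine integral_eq_zero_of_ae ?_
  filter_upwards [hμ.supp] with z hz using h z hz

theorem IsAvg.support_mc_subset (hμ : IsAvg μ R) (ψ : Euc N → ℝ) :
    Function.support (mc μ ψ) ⊆ Metric.cthickening R (tsupport ψ) := by
  intro x hx
  by_contra hc
  refine hx (hμ.mc_eq_zero fun z hz => ?_)
  refine image_eq_zero_of_notMem_tsupport fun hz' => hc ?_
  exact Metric.mem_cthickening_of_dist_le x (x - z) R _ hz' (by simpa [dist_eq_norm] using hz)

theorem IsAvg.tsupport_mc_subset (hμ : IsAvg μ R) (ψ : Euc N → ℝ) :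
    tsupport (mc μ ψ) ⊆ Metric.cthickening R (tsupport ψ) :=
  closure_minimal (hμ.support_mc_subset ψ) Metric.isClosed_cthickening

theorem IsAvg.hasCompactSupport_mc (hμ : IsAvg μ R) {ψ : Euc N → ℝ}
    (hc : HasCompactSupport ψ) : HasCompactSupport (mc μ ψ) :=
  (hc.cthickening (r := R)).of_isClosed_subset (isClosed_tsupport _) (hμ.tsupport_mc_subset ψ)

theorem mc_nonneg {h : Euc N → ℝ} (h0 : ∀ x, 0 ≤ h x) (x : Euc N) : 0 ≤ mc μ h x :=
  integral_nonneg fun _ => h0 _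

theorem integrable_prod_shift [IsFiniteMeasure μ] {g : Euc N → ℝ} (hg : Integrable g) :
    Integrable (fun q : Euc N × Euc N => g (q.1 - q.2)) ((volume : Measure (Euc N)).prod μ) := by
  have := Integrable.convolution_integrand (ContinuousLinearMap.lsmul ℝ ℝ)
    (ν := μ) (f := fun _ : Euc N => (1 : ℝ)) (integrable_const _) hg
  simpa using this

theorem integrable_mc [IsFiniteMeasure μ] {g : Euc N → ℝ} (hg : Integrable g) :
    Integrable (mc μ g) := (integrable_prod_shift hg).integral_prod_left

theorem IsAvg.integral_mc_mul (hμ : IsAvg μ R) {g ψ : Euc N → ℝ} (hg : Integrable g)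
    (hψ : Continuous ψ) (hc : HasCompactSupport ψ) :
    ∫ x, mc μ g x * ψ x = ∫ x, g x * mc μ ψ x := by
  have := hμ.fin
  have := hμ.inv
  obtain ⟨C, hC0, hC⟩ := exists_bound_of_hasCompactSupport hψ hc
  have h1 : Integrable (fun q : Euc N × Euc N => g (q.1 - q.2) * ψ q.1)
      ((volume : Measure (Euc N)).prod μ) := by
    refine (integrable_prod_shift hg).mul_bdd (c := C) ?_ (Eventually.of_forall fun q => hC _)
    exact Continuous.aestronglyMeasurable (by fun_prop)
  have h2 : Integrable (fun q : Euc N × Euc N => g q.1 * ψ (q.1 - q.2))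
      ((volume : Measure (Euc N)).prod μ) := by
    have : Integrable (fun q : Euc N × Euc N => g q.1) ((volume : Measure (Euc N)).prod μ) :=
      hg.comp_fst μ
    refine this.mul_bdd (c := C) ?_ (Eventually.of_forall fun q => hC _)
    exact Continuous.aestronglyMeasurable (by fun_prop)
  calc ∫ x, mc μ g x * ψ x = ∫ x, ∫ z, g (x - z) * ψ x ∂μ := by
        simp_rw [mc, integral_mul_const]
    _ = ∫ z, (∫ x, g (x - z) * ψ x) ∂μ := integral_integral_swap h1
    _ = ∫ z, (∫ x, g x * ψ (x + z)) ∂μ := by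
        congr 1; ext z
        rw [← integral_add_right_eq_self (fun x => g (x - z) * ψ x) z]
        simp
    _ = ∫ z, (∫ x, g x * ψ (x - z)) ∂μ := by
        rw [← integral_neg_eq_self]
        simp [sub_eq_add_neg]
    _ = ∫ x, ∫ z, g x * ψ (x - z) ∂μ := (integral_integral_swap h2).symm
    _ = _ := by simp_rw [mc, integral_const_mul]

theorem lintegral_shift_mul [IsFiniteMeasure μ] [μ.IsNegInvariant] {g w : Euc N → ℝ≥0∞}
    (hg : Measurable g) (hw : Measurable w) :
    ∫⁻ x, (∫⁻ z, g (x - z) ∂μ) * w x = ∫⁻ x, g x * ∫⁻ z, w (x - z) ∂μ := by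
  calc ∫⁻ x, (∫⁻ z, g (x - z) ∂μ) * w x = ∫⁻ x, ∫⁻ z, g (x - z) * w x ∂μ := by
        congr 1; ext x
        rw [lintegral_mul_const]
        exact hg.comp (measurable_const.sub measurable_id)
    _ = ∫⁻ z, (∫⁻ x, g (x - z) * w x) ∂μ := lintegral_lintegral_swap (by
        exact ((hg.comp (measurable_fst.sub measurable_snd)).mul
          (hw.comp measurable_fst)).aemeasurable)
    _ = ∫⁻ z, (∫⁻ x, g x * w (x + z)) ∂μ := by
        congr 1; ext z
        rw [← lintegral_add_right_eq_self (fun x => g (x - z) * w x) z]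
        simp
    _ = ∫⁻ z, (∫⁻ x, g x * w (x - z)) ∂μ := by
        rw [← lintegral_neg_eq_self]
        simp [sub_eq_add_neg]
    _ = ∫⁻ x, ∫⁻ z, g x * w (x - z) ∂μ := (lintegral_lintegral_swap (by
        exact ((hg.comp measurable_fst).mul
          (hw.comp (measurable_fst.sub measurable_snd))).aemeasurable)).symm
    _ = _ := by
        congr 1; ext x
        rw [lintegral_const_mul]
        exact hw.comp (measurable_const.sub measurable_id)

end mc

/-- The measure `η_ε dz`, the law of `ε y` for `y` with density `η`. -/
def mol {N : ℕ} (η : Euc N → ℝ) (ε : ℝ) : Measure (Euc N) :=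
  (volume.withDensity fun y => ENNReal.ofReal (η y)).map fun y => ε • y

/-- The truncated potential kernel `∫₀^ε s ζ_s ds`. -/
def kap {N : ℕ} (ζ : Euc N → ℝ) (ε : ℝ) : Measure (Euc N) :=
  (((volume.restrict (Ioc 0 ε)).withDensity fun s => ENNReal.ofReal s).prod
    (volume.withDensity fun y => ENNReal.ofReal (ζ y))).map fun q : ℝ × Euc N => q.1 • q.2

section kernels

variable {N : ℕ} {ζ η : Euc N → ℝ}

theorem IsKer.zmeas (hk : IsKer ζ η) : Measurable fun y => ENNReal.ofReal (ζ y) :=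
  hk.zs.continuous.measurable.ennreal_ofReal

theorem IsKer.emeas (hk : IsKer ζ η) : Measurable fun y => ENNReal.ofReal (η y) :=
  hk.es.continuous.measurable.ennreal_ofReal

theorem IsKer.eintegrable (hk : IsKer ζ η) : Integrable η :=
  hk.es.continuous.integrable_of_hasCompactSupport (hasCompactSupport_of_zero_off_ball hk.esupp)

theorem IsKer.zintegrable (hk : IsKer ζ η) : Integrable ζ :=
  hk.zs.continuous.integrable_of_hasCompactSupport (hasCompactSupport_of_zero_off_ball hk.zsupp)

theorem lintegral_mol (hk : IsKer ζ η) (ε : ℝ) {g : Euc N → ℝ≥0∞} (hg : Measurable g) :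
    ∫⁻ z, g z ∂(mol η ε) = ∫⁻ y, ENNReal.ofReal (η y) * g (ε • y) := by
  rw [mol, lintegral_map hg (by fun_prop), lintegral_withDensity_eq_lintegral_mul _ hk.emeas]
  · rfl
  · exact hg.comp (by fun_prop)

theorem lintegral_kap (hk : IsKer ζ η) (ε : ℝ) {g : Euc N → ℝ≥0∞} (hg : Measurable g) :
    ∫⁻ z, g z ∂(kap ζ ε)
      = ∫⁻ s in Ioc 0 ε, ENNReal.ofReal s * ∫⁻ y, ENNReal.ofReal (ζ y) * g (s • y) := by
  have hgm : Measurable fun q : ℝ × Euc N => g (q.1 • q.2) := hg.comp (by fun_prop)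
  rw [kap, lintegral_map hg (by fun_prop), lintegral_prod _ hgm.aemeasurable,
    lintegral_withDensity_eq_lintegral_mul _ (by fun_prop) hgm.lintegral_prod_right']
  refine lintegral_congr fun s => ?_
  simp only [Pi.mul_apply]
  congr 1
  have hgs : Measurable fun y : Euc N => g (s • y) := hg.comp (by fun_prop)
  rw [lintegral_withDensity_eq_lintegral_mul _ hk.zmeas hgs]
  rfl

theorem lintegral_ofReal_eta (hk : IsKer ζ η) : ∫⁻ y, ENNReal.ofReal (η y) = 1 := by
  rw [← ofReal_integral_eq_lintegral_ofReal hk.eintegrable (Eventually.of_forall hk.e0), hk.eint]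
  simp

theorem lintegral_ofReal_zeta_le (hk : IsKer ζ η) : ∫⁻ y, ENNReal.ofReal (ζ y) ≤ 1 :=
  (lintegral_mono fun y => ENNReal.ofReal_le_ofReal (hk.zle y)).trans (lintegral_ofReal_eta hk).le

theorem isAvg_of_lintegral {μ : Measure (Euc N)} {R : ℝ} (h1 : μ univ < ⊤)
    (h2 : ∀ g : Euc N → ℝ≥0∞, Measurable g → ∫⁻ z, g (-z) ∂μ = ∫⁻ z, g z ∂μ)
    (h3 : ∀ A : Set (Euc N), MeasurableSet A → volume A = 0 → μ A = 0)
    (h4 : ∫⁻ z, (Metric.closedBall (0 : Euc N) R)ᶜ.indicator 1 z ∂μ = 0) : IsAvg μ R := by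
  refine ⟨⟨h1⟩, ⟨?_⟩, Measure.AbsolutelyContinuous.mk h3, ?_⟩
  · refine Measure.ext_of_lintegral _ fun g hg => ?_
    rw [Measure.neg, lintegral_map hg measurable_neg, h2 g hg]
  · rw [lintegral_indicator_one Metric.isClosed_closedBall.measurableSet.compl] at h4
    rw [ae_iff]
    convert h4 using 2
    ext z; simp

theorem isAvg_mol (hk : IsKer ζ η) {ε : ℝ} (hε : 0 < ε) : IsAvg (mol η ε) ε := by
  refine isAvg_of_lintegral ?_ (fun g hg => ?_) (fun A hA h0 => ?_) ?_
  · rw [← lintegral_one, lintegral_mol hk ε measurable_const]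
    simp [lintegral_ofReal_eta hk]
  · have hgn : Measurable fun z => g (-z) := hg.comp measurable_neg
    rw [lintegral_mol hk ε hg, lintegral_mol hk ε hgn, ← lintegral_neg_eq_self]
    simp [hk.eeven]
  · rw [← lintegral_indicator_one hA, lintegral_mol hk ε (measurable_one.indicator hA)]
    have : ∀ᵐ y : Euc N, ε • y ∉ A := by
      have : volume ((fun y : Euc N => ε • y) ⁻¹' A) = 0 := by
        rw [Measure.addHaar_preimage_smul _ hε.ne', h0, mul_zero]
      rw [ae_iff]; simp only [not_not]; exact this
    refine lintegral_eq_zero_of_ae_eq_zero ?_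
    filter_upwards [this] with y hy
    simp [hy]
  · rw [lintegral_mol hk ε (measurable_one.indicator Metric.isClosed_closedBall.measurableSet.compl)]
    refine lintegral_eq_zero_of_ae_eq_zero (Eventually.of_forall fun y => ?_)
    simp only [Pi.zero_apply, mul_eq_zero]
    rcases le_or_gt 1 ‖y‖ with hy | hy
    · left; simp [hk.esupp y hy]
    · right
      refine indicator_of_notMem (notMem_compl_iff.2 ?_) _
      rw [mem_closedBall_zero_iff, norm_smul, Real.norm_of_nonneg hε.le]
      nlinarith

theorem isAvg_kap (hk : IsKer ζ η) {ε : ℝ} : IsAvg (kap ζ ε) ε := by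
  refine isAvg_of_lintegral ?_ (fun g hg => ?_) (fun A hA h0 => ?_) ?_
  · rw [← lintegral_one, lintegral_kap hk ε measurable_const]
    calc _ ≤ ∫⁻ s in Ioc 0 ε, ENNReal.ofReal ε * 1 := by
          refine setLIntegral_mono measurable_const fun s hs => ?_
          refine mul_le_mul' (ENNReal.ofReal_le_ofReal hs.2) ?_
          simpa using lintegral_ofReal_zeta_le hk
      _ < ⊤ := by
          simp [ENNReal.mul_lt_top_iff]
  · have hgn : Measurable fun z => g (-z) := hg.comp measurable_neg
    rw [lintegral_kap hk ε hg, lintegral_kap hk ε hgn]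
    refine lintegral_congr fun s => ?_
    congr 1
    rw [← lintegral_neg_eq_self]
    simp [hk.zeven]
  · rw [← lintegral_indicator_one hA, lintegral_kap hk ε (measurable_one.indicator hA)]
    refine setLIntegral_eq_zero measurableSet_Ioc fun s hs => ?_
    have : ∀ᵐ y : Euc N, s • y ∉ A := by
      have : volume ((fun y : Euc N => s • y) ⁻¹' A) = 0 := by
        rw [Measure.addHaar_preimage_smul _ hs.1.ne', h0, mul_zero]
      rw [ae_iff]; simp only [not_not]; exact this
    rw [lintegral_eq_zero_of_ae_eq_zero, mul_zero]; · rfl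
    filter_upwards [this] with y hy
    simp [hy]
  · rw [lintegral_kap hk ε (measurable_one.indicator Metric.isClosed_closedBall.measurableSet.compl)]
    refine setLIntegral_eq_zero measurableSet_Ioc fun s hs => ?_
    rw [lintegral_eq_zero_of_ae_eq_zero, mul_zero]; · rfl
    refine Eventually.of_forall fun y => ?_
    simp only [Pi.zero_apply, mul_eq_zero]
    rcases le_or_gt 1 ‖y‖ with hy | hy
    · left; simp [hk.zsupp y hy]
    · right
      refine indicator_of_notMem (notMem_compl_iff.2 ?_) _
      rw [mem_closedBall_zero_iff, norm_smul, Real.norm_of_nonneg hs.1.le]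
      nlinarith [hs.1, hs.2]

theorem mc_mol (hk : IsKer ζ η) (ε : ℝ) {h : Euc N → ℝ} (hm : Measurable h) (x : Euc N) :
    mc (mol η ε) h x = ∫ y, η y * h (x - ε • y) := by
  have hx : Measurable fun z => h (x - z) := hm.comp (measurable_const.sub measurable_id)
  rw [mc, mol, integral_map (by fun_prop)
    hx.aestronglyMeasurable,
    integral_withDensity_eq_integral_toReal_smul hk.emeas (by simp)]
  refine integral_congr_ae (Eventually.of_forall fun y => ?_)
  simp [ENNReal.toReal_ofReal (hk.e0 y)]

theorem mc_kap (hk : IsKer ζ η) (ε : ℝ) {h : Euc N → ℝ} (hm : Measurable h) {C : ℝ}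
    (hC : ∀ x, |h x| ≤ C) (x : Euc N) :
    mc (kap ζ ε) h x = ∫ s in Ioc 0 ε, s * ∫ y, ζ y * h (x - s • y) := by
  have := (isAvg_kap hk (ε := ε)).fin
  have hi : Integrable (fun z => h (x - z)) (kap ζ ε) := integrable_shift hm hC x
  have hx : Measurable fun z => h (x - z) := hm.comp (measurable_const.sub measurable_id)
  rw [kap, integrable_map_measure
    hx.aestronglyMeasurable (by fun_prop)] at hi
  rw [mc, kap, integral_map (by fun_prop)
    hx.aestronglyMeasurable]
  simp only [Function.comp_def] at hi
  rw [integral_prod _ hi, integral_withDensity_eq_integral_toReal_smul (by fun_prop) (by simp)]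
  refine setIntegral_congr_fun measurableSet_Ioc fun s hs => ?_
  simp only [ENNReal.toReal_ofReal hs.1.le, smul_eq_mul]
  congr 1
  rw [integral_withDensity_eq_integral_toReal_smul hk.zmeas (by simp)]
  refine integral_congr_ae (Eventually.of_forall fun y => ?_)
  simp [ENNReal.toReal_ofReal (hk.z0 y)]

theorem mc_mol_sub_mc_kap_lap (hk : IsKer ζ η) {ε : ℝ} (hε : 0 < ε) {ψ : Euc N → ℝ}
    (hψ : ContDiff ℝ ∞ ψ) (hc : HasCompactSupport ψ) (x : Euc N) :
    mc (mol η ε) ψ x - mc (kap ζ ε) (lap ψ) x = ψ x := by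
  obtain ⟨C, _, hC⟩ := exists_bound_of_hasCompactSupport hψ.lap_top.continuous hc.lap
  rw [mc_mol hk ε hψ.continuous.measurable, mc_kap hk ε hψ.lap_top.continuous.measurable hC]
  linarith [average_sub_eq hk hψ hc x hε.le]

end kernels

section tests

variable {N : ℕ} {ζ η : Euc N → ℝ}

theorem ae_nonneg_of_test {g : Euc N → ℝ} (hg : Integrable g)
    (h : ∀ ψ : Euc N → ℝ, ContDiff ℝ ∞ ψ → HasCompactSupport ψ → (∀ x, 0 ≤ ψ x) →
      0 ≤ ∫ x, g x * ψ x) : ∀ᵐ x, 0 ≤ g x := by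
  let φ : ℕ → ContDiffBump (0 : Euc N) := fun n =>
    ⟨1 / ((n : ℝ) + 1), 2 * (1 / ((n : ℝ) + 1)), by positivity, by
      have : 0 < 1 / ((n : ℝ) + 1) := by positivity
      linarith⟩
  have h1 : Tendsto (fun n => (φ n).rOut) atTop (𝓝 0) := by
    have := tendsto_one_div_add_atTop_nhds_zero_nat.const_mul (2 : ℝ)
    rw [mul_zero] at this
    exact this
  filter_upwards [ContDiffBump.ae_convolution_tendsto_right_of_locallyIntegrable
    (μ := (volume : Measure (Euc N))) (K := 2) h1 (Eventually.of_forall fun n => le_rfl)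
    hg.locallyIntegrable] with x hx
  refine ge_of_tendsto' hx fun n => ?_
  rw [convolution_eq_swap]
  have h2 : ∀ t, ContinuousLinearMap.lsmul ℝ ℝ ((φ n).normed volume (x - t)) (g t)
      = g t * (φ n).normed volume (x - t) := fun t => by simp [mul_comm]
  simp_rw [h2]
  refine h _ ?_ ?_ fun y => (φ n).nonneg_normed _
  · exact (φ n).contDiff_normed.comp (contDiff_const.sub contDiff_id)
  · exact ((φ n).hasCompactSupport_normed).comp_homeomorph (Homeomorph.subLeft x)

theorem integrable_mul_test {g ψ : Euc N → ℝ} (hg : Integrable g) (hψ : Continuous ψ)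
    (hc : HasCompactSupport ψ) : Integrable fun x => g x * ψ x := by
  obtain ⟨C, _, hC⟩ := exists_bound_of_hasCompactSupport hψ hc
  exact hg.mul_bdd hψ.aestronglyMeasurable (Eventually.of_forall hC)

theorem integral_test_identity (hk : IsKer ζ η) {ε : ℝ} (hε : 0 < ε) {v h : Euc N → ℝ}
    (hv : Integrable v) (hh : Integrable h) {ψ : Euc N → ℝ}
    (hψ : ContDiff ℝ ∞ ψ) (hc : HasCompactSupport ψ) :
    ∫ x, (mc (mol η ε) v x + mc (kap ζ ε) h x - v x) * ψ x
      = (∫ x, h x * mc (kap ζ ε) ψ x) - (-∫ x, v x * lap (mc (kap ζ ε) ψ) x) := by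
  have hm := isAvg_mol hk hε
  have hK := isAvg_kap hk (ε := ε)
  have := hm.fin
  have := hK.fin
  have e1 : ∀ x, v x * lap (mc (kap ζ ε) ψ) x = v x * mc (mol η ε) ψ x - v x * ψ x := by
    intro x
    rw [lap_mc hψ hc, ← mul_sub]
    congr 1
    linarith [mc_mol_sub_mc_kap_lap hk hε hψ hc x]
  simp_rw [e1]
  have i1 : Integrable fun x => v x * mc (mol η ε) ψ x :=
    integrable_mul_test hv (contDiff_mc hψ hc).continuous (hm.hasCompactSupport_mc hc)
  have i2 : Integrable fun x => v x * ψ x := integrable_mul_test hv hψ.continuous hc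
  have i3 : Integrable fun x => mc (mol η ε) v x * ψ x :=
    integrable_mul_test (integrable_mc hv) hψ.continuous hc
  have i4 : Integrable fun x => mc (kap ζ ε) h x * ψ x :=
    integrable_mul_test (integrable_mc hh) hψ.continuous hc
  rw [integral_sub i1 i2, ← hm.integral_mc_mul hv hψ.continuous hc,
    ← hK.integral_mc_mul hh hψ.continuous hc]
  have e2 : ∀ x, (mc (mol η ε) v x + mc (kap ζ ε) h x - v x) * ψ x
      = mc (mol η ε) v x * ψ x + mc (kap ζ ε) h x * ψ x - v x * ψ x := fun x => by ring
  have i34 : Integrable fun x => mc (mol η ε) v x * ψ x + mc (kap ζ ε) h x * ψ x := i3.add i4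
  simp_rw [e2]
  rw [integral_sub i34 i2, integral_add i3 i4]
  ring

theorem le_mc_of_weak_subsolution (hk : IsKer ζ η) {ε : ℝ} (hε : 0 < ε) {v h : Euc N → ℝ}
    (hv : Integrable v) (hh : Integrable h)
    (hw : ∀ ψ : Euc N → ℝ, ContDiff ℝ ∞ ψ → HasCompactSupport ψ → (∀ x, 0 ≤ ψ x) →
      -∫ x, v x * lap ψ x ≤ ∫ x, h x * ψ x) :
    ∀ᵐ x, v x ≤ mc (mol η ε) v x + mc (kap ζ ε) h x := by
  have hm := isAvg_mol hk hε
  have hK := isAvg_kap hk (ε := ε)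
  have := hm.fin
  have := hK.fin
  have key := ae_nonneg_of_test (g := fun x => mc (mol η ε) v x + mc (kap ζ ε) h x - v x)
    (((integrable_mc hv).add (integrable_mc hh)).sub hv) fun ψ hψ hc h0 => by
      rw [integral_test_identity hk hε hv hh hψ hc]
      linarith [hw _ (contDiff_mc (μ := kap ζ ε) hψ hc) (hK.hasCompactSupport_mc hc)
        (mc_nonneg h0)]
  filter_upwards [key] with x hx
  linarith

theorem eq_mc_of_weak_solution (hk : IsKer ζ η) {ε : ℝ} (hε : 0 < ε) {v h : Euc N → ℝ}
    (hv : Integrable v) (hh : Integrable h) {Ω U : Set (Euc N)} (hU : IsOpen U)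
    (hUΩ : ∀ x ∈ U, Metric.closedBall x ε ⊆ Ω)
    (hw : ∀ ψ : Euc N → ℝ, ContDiff ℝ ∞ ψ → HasCompactSupport ψ → tsupport ψ ⊆ Ω →
      -∫ x, v x * lap ψ x = ∫ x, h x * ψ x) :
    ∀ᵐ x, x ∈ U → v x = mc (mol η ε) v x + mc (kap ζ ε) h x := by
  have hm := isAvg_mol hk hε
  have hK := isAvg_kap hk (ε := ε)
  have := hm.fin
  have := hK.fin
  have hi : Integrable fun x => mc (mol η ε) v x + mc (kap ζ ε) h x - v x :=
    ((integrable_mc hv).add (integrable_mc hh)).sub hv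
  have key := hU.ae_eq_zero_of_integral_contDiff_smul_eq_zero (μ := volume)
    (hi.locallyIntegrable.locallyIntegrableOn U) fun ψ hψ hc hs => by
      have e : ∀ x, ψ x • (mc (mol η ε) v x + mc (kap ζ ε) h x - v x)
        = (mc (mol η ε) v x + mc (kap ζ ε) h x - v x) * ψ x := fun x => mul_comm _ _
      simp_rw [e]
      rw [integral_test_identity hk hε hv hh hψ hc]
      rw [hw _ (contDiff_mc (μ := kap ζ ε) hψ hc) (hK.hasCompactSupport_mc hc), sub_self]
      refine (hK.tsupport_mc_subset ψ).trans ?_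
      rw [IsCompact.cthickening_eq_biUnion_closedBall hc hε.le]
      exact iUnion₂_subset fun x hx => hUΩ x (hs hx)
  filter_upwards [key] with x hx hxU
  linarith [hx hxU]

end tests

section bounded

variable {N : ℕ} {ζ η : Euc N → ℝ}

theorem lintegral_rpow_Ioc {r ε : ℝ} (hr : -1 < r) (hε : 0 ≤ ε) :
    ∫⁻ s in Ioc 0 ε, ENNReal.ofReal (s ^ r) = ENNReal.ofReal (ε ^ (r + 1) / (r + 1)) := by
  have h1 := (intervalIntegral.intervalIntegrable_rpow' (a := 0) (b := ε) hr).1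
  rw [← ofReal_integral_eq_lintegral_ofReal h1, ← intervalIntegral.integral_of_le hε,
    integral_rpow (Or.inl hr), Real.zero_rpow (by linarith), sub_zero]
  exact (ae_restrict_iff' measurableSet_Ioc).2
    (Eventually.of_forall fun s hs => Real.rpow_nonneg hs.1.le r)

theorem lintegral_shift_smul {V : Euc N → ℝ≥0∞} (hV : Measurable V) (x : Euc N) {s : ℝ}
    (hs : 0 < s) :
    ∫⁻ y, V (x - s • y) = ENNReal.ofReal ((s ^ N)⁻¹) * ∫⁻ y, V y := by
  have h1 : Measurable fun y => V (x - y) := hV.comp (measurable_const.sub measurable_id)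
  have h2 : ∫⁻ y, V (x - s • y) = ∫⁻ z, V (x - z) ∂(volume.map fun y : Euc N => s • y) := by
    rw [lintegral_map h1 (by fun_prop)]
  rw [h2, Measure.map_addHaar_smul _ hs.ne', lintegral_smul_measure, lintegral_sub_left_eq_self]
  simp [abs_of_pos hs]

theorem exists_kap_lintegral_le (hk : IsKer ζ η) {V : Euc N → ℝ≥0∞} (hV : Measurable V)
    {q : ℝ} (hq1 : 1 < q) (hq : (N : ℝ) < 2 * q) (hVq : ∫⁻ y, V y ^ q ≠ ⊤) :
    ∃ ε : ℝ, 0 < ε ∧ ∀ x, ∫⁻ z, V (x - z) ∂(kap ζ ε) ≤ 2⁻¹ := by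
  have hq0 : 0 < q := by linarith
  set p := q.conjExponent with hp
  have hpq : p.HolderConjugate q := (Real.HolderConjugate.conjExponent hq1).symm
  set Z : ℝ≥0∞ := (∫⁻ y, ENNReal.ofReal (ζ y) ^ p) ^ (1 / p) with hZ
  set W : ℝ≥0∞ := (∫⁻ y, V y ^ q) ^ (1 / q) with hW
  have hZt : Z ≠ ⊤ := by
    refine ENNReal.rpow_ne_top_of_nonneg (by have := hpq.pos; positivity) ?_
    have : ∀ y, ENNReal.ofReal (ζ y) ^ p = ENNReal.ofReal (ζ y ^ p) := fun y =>
      ENNReal.ofReal_rpow_of_nonneg (hk.z0 y) hpq.nonneg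
    simp_rw [this]
    have hc : Continuous fun y => ζ y ^ p :=
      hk.zs.continuous.rpow_const fun y => Or.inr hpq.nonneg
    have hi : Integrable fun y => ζ y ^ p :=
      hc.integrable_of_hasCompactSupport (hasCompactSupport_of_zero_off_ball (R := 1) fun y hy => by
        rw [hk.zsupp y hy, Real.zero_rpow hpq.ne_zero])
    exact hi.lintegral_lt_top.ne
  have hWt : W ≠ ⊤ := ENNReal.rpow_ne_top_of_nonneg (by positivity) hVq
  set r : ℝ := 1 - N / q with hr
  have hr1 : -1 < r := by
    have : (N : ℝ) / q < 2 := by rw [div_lt_iff₀ hq0]; exact hq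
    rw [hr]; linarith
  have hbound : ∀ ε : ℝ, 0 < ε → ∀ x, ∫⁻ z, V (x - z) ∂(kap ζ ε)
      ≤ Z * W * ENNReal.ofReal (ε ^ (r + 1) / (r + 1)) := by
    intro ε hε x
    have hVx : Measurable fun z => V (x - z) := hV.comp (measurable_const.sub measurable_id)
    rw [lintegral_kap hk ε hVx, ← lintegral_rpow_Ioc hr1 hε.le, ← lintegral_const_mul _
      (by fun_prop)]
    refine setLIntegral_mono (by fun_prop) fun s hs => ?_
    have hs0 : 0 < s := hs.1
    have hVs : Measurable fun y => V (x - s • y) := hV.comp (by fun_prop)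
    have h1 := ENNReal.lintegral_mul_le_Lp_mul_Lq volume hpq hk.zmeas.aemeasurable
      hVs.aemeasurable
    have h2 : ∫⁻ y, V (x - s • y) ^ q = ENNReal.ofReal ((s ^ N)⁻¹) * ∫⁻ y, V y ^ q :=
      lintegral_shift_smul (V := fun y => V y ^ q) (hV.pow_const q) x hs0
    rw [h2, ENNReal.mul_rpow_of_nonneg _ _ (by positivity)] at h1
    have h3 : ENNReal.ofReal s * ENNReal.ofReal ((s ^ N)⁻¹) ^ (1 / q)
        = ENNReal.ofReal (s ^ r) := by
      rw [ENNReal.ofReal_rpow_of_nonneg (by positivity) (by positivity),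
        ← ENNReal.ofReal_mul hs0.le]
      congr 1
      rw [Real.inv_rpow (by positivity), ← Real.rpow_natCast, ← Real.rpow_mul hs0.le,
        ← Real.rpow_neg hs0.le, hr]
      nth_rewrite 1 [← Real.rpow_one s]
      rw [← Real.rpow_add hs0]
      congr 1; ring
    calc _ ≤ ENNReal.ofReal s * (Z * (ENNReal.ofReal ((s ^ N)⁻¹) ^ (1 / q) * W)) :=
          mul_le_mul_right h1 _
      _ = Z * W * (ENNReal.ofReal s * ENNReal.ofReal ((s ^ N)⁻¹) ^ (1 / q)) := by ring
      _ = _ := by rw [h3]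
  have hlim : Tendsto (fun ε : ℝ => Z * W * ENNReal.ofReal (ε ^ (r + 1) / (r + 1)))
      (𝓝[>] 0) (𝓝 0) := by
    have h1 : Tendsto (fun ε : ℝ => ε ^ (r + 1) / (r + 1)) (𝓝[>] 0) (𝓝 0) := by
      have : Continuous fun ε : ℝ => ε ^ (r + 1) / (r + 1) :=
        (Real.continuous_rpow_const (by linarith)).div_const _
      have h := (this.tendsto 0).mono_left (nhdsWithin_le_nhds (s := Ioi 0))
      simpa [Real.zero_rpow (by linarith : r + 1 ≠ 0)] using h
    have h2 := ENNReal.Tendsto.const_mul (ENNReal.tendsto_ofReal h1)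
      (Or.inr (ENNReal.mul_ne_top hZt hWt))
    simpa using h2
  have h2 : ∀ᶠ ε in 𝓝[>] (0 : ℝ), Z * W * ENNReal.ofReal (ε ^ (r + 1) / (r + 1)) < 2⁻¹ :=
    hlim.eventually (gt_mem_nhds (by simp))
  obtain ⟨ε, hε, hlt⟩ := (h2.and self_mem_nhdsWithin).exists
  exact ⟨ε, hlt, fun x => (hbound ε hlt x).trans hε.le⟩

theorem ofReal_integral_le_lintegral {α : Type*} [MeasurableSpace α] {μ : Measure α}
    (f : α → ℝ) : ENNReal.ofReal (∫ a, f a ∂μ) ≤ ∫⁻ a, ENNReal.ofReal (f a) ∂μ := by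
  by_cases hf : Integrable f μ
  · rw [integral_eq_lintegral_pos_part_sub_lintegral_neg_part hf]
    refine (ENNReal.ofReal_le_ofReal (sub_le_self _ ENNReal.toReal_nonneg)).trans ?_
    exact ENNReal.ofReal_toReal_le
  · rw [integral_undef hf]; simp

theorem exists_mc_mol_le (hk : IsKer ζ η) {ε : ℝ} (hε : 0 < ε) {v : Euc N → ℝ}
    (hm : Measurable v) (hv : Integrable v) (h0 : ∀ x, 0 ≤ v x) :
    ∃ A : ℝ, 0 ≤ A ∧ ∀ x, mc (mol η ε) v x ≤ A := by
  obtain ⟨C, hC0, hC⟩ := exists_bound_of_hasCompactSupport hk.es.continuous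
    (hasCompactSupport_of_zero_off_ball hk.esupp)
  refine ⟨C * (|(ε ^ N)⁻¹| * ∫ y, v y),
    mul_nonneg hC0 (mul_nonneg (abs_nonneg _) (integral_nonneg h0)), fun x => ?_⟩
  rw [mc_mol hk ε hm]
  have h1 : ∫ y, v (x - ε • y) = |(ε ^ N)⁻¹| * ∫ y, v y := by
    have := Measure.integral_comp_smul (volume : Measure (Euc N)) (fun y => v (x - y)) ε
    rw [this, integral_sub_left_eq_self]
    simp
  have hi : Integrable fun y => v (x - ε • y) := by
    have h2 : Integrable fun y => v (x - y) := hv.comp_sub_left x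
    exact (integrable_comp_smul_iff volume (fun y => v (x - y)) hε.ne').2 h2
  rw [← h1, ← integral_const_mul]
  refine integral_mono_of_nonneg (Eventually.of_forall fun y => mul_nonneg (hk.e0 y) (h0 _))
    (hi.const_mul C) (Eventually.of_forall fun y => ?_)
  exact mul_le_mul_of_nonneg_right ((le_abs_self _).trans (hC y)) (h0 _)

theorem exists_ae_bound_of_subsolution (hk : IsKer ζ η) {v h : Euc N → ℝ}
    (hm : Measurable v) (hv : Integrable v) (h0 : ∀ x, 0 ≤ v x)
    {V : Euc N → ℝ≥0∞} (hV : Measurable V) {q : ℝ} (hq1 : 1 < q) (hq : (N : ℝ) < 2 * q)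
    (hVq : ∫⁻ y, V y ^ q ≠ ⊤) (hle : ∀ x, ENNReal.ofReal (h x) ≤ V x * ENNReal.ofReal (v x))
    (hfin : ∫⁻ x, V x * ENNReal.ofReal (v x) ≠ ⊤)
    (hsub : ∀ ε : ℝ, 0 < ε → ∀ᵐ x, v x ≤ mc (mol η ε) v x + mc (kap ζ ε) h x) :
    ∃ A : ℝ, ∀ᵐ x, v x ≤ A := by
  obtain ⟨ε, hε, hK⟩ := exists_kap_lintegral_le hk hV hq1 hq hVq
  obtain ⟨A, hA0, hA⟩ := exists_mc_mol_le hk hε hm hv h0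
  have hkap := isAvg_kap hk (ε := ε)
  have := hkap.fin
  have := hkap.inv
  set a : Euc N → ℝ≥0∞ := fun x => ENNReal.ofReal (v x) with ha
  have ham : Measurable a := hm.ennreal_ofReal
  set B : ℝ≥0∞ := ENNReal.ofReal A with hB
  set w : Euc N → ℝ≥0∞ := fun x => a x - 2 * B with hw
  have hwm : Measurable w := ham.sub measurable_const
  have hVw : Measurable fun x => V x * w x := hV.mul hwm
  set T : Euc N → ℝ≥0∞ := fun x => ∫⁻ z, V (x - z) * w (x - z) ∂(kap ζ ε) with hT
  have hwT : ∀ᵐ x, w x ≤ T x := by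
    filter_upwards [hsub ε hε] with x hx
    have hVx : Measurable fun z => V (x - z) := hV.comp (measurable_const.sub measurable_id)
    have hVwx : Measurable fun z => V (x - z) * w (x - z) :=
      hVw.comp (measurable_const.sub measurable_id)
    have h1 : a x ≤ B + ∫⁻ z, ENNReal.ofReal (h (x - z)) ∂(kap ζ ε) := by
      calc a x ≤ ENNReal.ofReal (A + mc (kap ζ ε) h x) :=
            ENNReal.ofReal_le_ofReal (hx.trans (by linarith [hA x]))
        _ ≤ B + ENNReal.ofReal (mc (kap ζ ε) h x) := ENNReal.ofReal_add_le
        _ ≤ _ := by gcongr; exact ofReal_integral_le_lintegral _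
    have h2 : ∫⁻ z, ENNReal.ofReal (h (x - z)) ∂(kap ζ ε) ≤ T x + 2⁻¹ * (2 * B) := by
      calc _ ≤ ∫⁻ z, V (x - z) * w (x - z) + V (x - z) * (2 * B) ∂(kap ζ ε) := by
            refine lintegral_mono fun z => (hle _).trans ?_
            rw [← mul_add]
            exact mul_le_mul_right le_tsub_add _
        _ = T x + (∫⁻ z, V (x - z) ∂(kap ζ ε)) * (2 * B) := by
            rw [lintegral_add_left hVwx, lintegral_mul_const _ hVx]
        _ ≤ _ := by gcongr; exact hK x
    have h3 : (2⁻¹ : ℝ≥0∞) * (2 * B) = B := by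
      rw [← mul_assoc, ENNReal.inv_mul_cancel (by simp) (by simp), one_mul]
    rw [h3] at h2
    rw [hw]
    refine tsub_le_iff_left.2 ((h1.trans (add_le_add_right h2 B)).trans_eq ?_)
    ring
  have hI : ∫⁻ x, V x * w x = 0 := by
    have hlt : ∫⁻ x, V x * w x ≠ ⊤ := ne_top_of_le_ne_top hfin
      (lintegral_mono fun x => mul_le_mul_right tsub_le_self _)
    have h1 : ∫⁻ x, V x * w x ≤ 2⁻¹ * ∫⁻ x, V x * w x := by
      calc ∫⁻ x, V x * w x ≤ ∫⁻ x, T x * V x := by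
            refine lintegral_mono_ae ?_
            filter_upwards [hwT] with x hx
            rw [mul_comm (T x)]
            exact mul_le_mul_right hx _
        _ = ∫⁻ x, (V x * w x) * ∫⁻ z, V (x - z) ∂(kap ζ ε) := lintegral_shift_mul hVw hV
        _ ≤ ∫⁻ x, (V x * w x) * 2⁻¹ := lintegral_mono fun x => mul_le_mul_right (hK x) _
        _ = _ := by rw [lintegral_mul_const _ hVw, mul_comm]
    by_contra hne
    have h2 : 2⁻¹ * ∫⁻ x, V x * w x < 1 * ∫⁻ x, V x * w x :=
      ENNReal.mul_lt_mul_left hne hlt (by simp)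
    rw [one_mul] at h2
    exact absurd h1 (not_le.2 h2)
  have hz : (fun x => V x * w x) =ᵐ[volume] 0 := (lintegral_eq_zero_iff hVw).1 hI
  have hT0 : ∀ x, T x = 0 := by
    intro x
    refine lintegral_eq_zero_of_ae_eq_zero (hkap.ac.ae_le ?_)
    exact (Measure.measurePreserving_sub_left volume x).quasiMeasurePreserving.ae_eq_comp hz
  refine ⟨2 * A, ?_⟩
  filter_upwards [hwT] with x hx
  rw [hT0 x, nonpos_iff_eq_zero, tsub_eq_zero_iff_le] at hx
  have h2 : a x ≤ ENNReal.ofReal (2 * A) := by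
    rw [ENNReal.ofReal_mul zero_le_two]; simpa using hx
  exact (ENNReal.ofReal_le_ofReal_iff (by positivity)).1 h2

end bounded

section regularity

variable {N : ℕ} {ζ η : Euc N → ℝ}

theorem integral_mul_shift_eq_convolution (ζ h : Euc N → ℝ) {s : ℝ} (hs : s ≠ 0) (x : Euc N) :
    ∫ y, ζ y * h (x - s • y)
      = (ζ ⋆[ContinuousLinearMap.mul ℝ ℝ, volume] fun z => h (s • z)) (s⁻¹ • x) := by
  rw [convolution]
  refine integral_congr_ae (Eventually.of_forall fun y => ?_)
  simp [smul_sub, smul_smul, hs]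

theorem locallyIntegrable_of_bounded {h : Euc N → ℝ} (hm : Measurable h) {C : ℝ}
    (hC : ∀ x, |h x| ≤ C) : LocallyIntegrable h := by
  refine LocallyIntegrable.mono (locallyIntegrable_const C) hm.aestronglyMeasurable
    (Eventually.of_forall fun x => ?_)
  rw [Real.norm_eq_abs]
  exact (hC x).trans (le_abs_self C)

theorem contDiff_integral_mul_shift {ζ : Euc N → ℝ} (hz : ContDiff ℝ ∞ ζ)
    (hc : HasCompactSupport ζ) {h : Euc N → ℝ} (hm : Measurable h) {C : ℝ}
    (hC : ∀ x, |h x| ≤ C) {s : ℝ} (hs : s ≠ 0) :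
    ContDiff ℝ ∞ fun x => ∫ y, ζ y * h (x - s • y) := by
  simp_rw [integral_mul_shift_eq_convolution ζ h hs]
  have h1 := hc.contDiff_convolution_left (ContinuousLinearMap.mul ℝ ℝ) (μ := volume) hz
    (locallyIntegrable_of_bounded (h := fun z => h (s • z)) (hm.comp (measurable_const_smul s))
      fun x => hC _)
  exact h1.comp (by fun_prop)

theorem hasFDerivAt_integral_mul_shift {ζ : Euc N → ℝ} (hz : ContDiff ℝ ∞ ζ)
    (hc : HasCompactSupport ζ) {h : Euc N → ℝ} (hm : Measurable h) {C : ℝ}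
    (hC : ∀ x, |h x| ≤ C) {s : ℝ} (hs : s ≠ 0) (x : Euc N) :
    HasFDerivAt (fun x => ∫ y, ζ y * h (x - s • y))
      (s⁻¹ • ∫ y, h (x - s • y) • fderiv ℝ ζ y) x := by
  simp_rw [integral_mul_shift_eq_convolution ζ h hs]
  have h1 := hc.hasFDerivAt_convolution_left (ContinuousLinearMap.mul ℝ ℝ) (μ := volume)
    (hz.of_le (by simp))
    (locallyIntegrable_of_bounded (h := fun z => h (s • z)) (hm.comp (measurable_const_smul s))
      fun x => hC _) (s⁻¹ • x)
  have h2 : HasFDerivAt (fun x : Euc N => s⁻¹ • x) (s⁻¹ • ContinuousLinearMap.id ℝ (Euc N)) x :=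
    (hasFDerivAt_id x).const_smul s⁻¹
  refine (h1.comp x h2).congr_fderiv ?_
  rw [ContinuousLinearMap.comp_smul, ContinuousLinearMap.comp_id, convolution]
  congr 1
  refine integral_congr_ae (Eventually.of_forall fun y => ?_)
  ext v
  simp [smul_sub, smul_smul, hs, mul_comm]

theorem contDiff_mc_mol (hk : IsKer ζ η) {ε : ℝ} (hε : 0 < ε) {h : Euc N → ℝ} (hm : Measurable h)
    {C : ℝ} (hC : ∀ x, |h x| ≤ C) : ContDiff ℝ ∞ (mc (mol η ε) h) := by
  have : mc (mol η ε) h = fun x => ∫ y, η y * h (x - ε • y) := funext fun x => mc_mol hk ε hm x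
  rw [this]
  exact contDiff_integral_mul_shift hk.es (hasCompactSupport_of_zero_off_ball hk.esupp) hm hC hε.ne'

theorem contDiff_mc_kap (hk : IsKer ζ η) {ε : ℝ} {h : Euc N → ℝ} (hm : Measurable h)
    {C : ℝ} (hC : ∀ x, |h x| ≤ C) : ContDiff ℝ 1 (mc (kap ζ ε) h) := by
  have hzc : HasCompactSupport ζ := hasCompactSupport_of_zero_off_ball hk.zsupp
  have h1 : mc (kap ζ ε) h = fun x => ∫ s in Ioc 0 ε, s * ∫ y, ζ y * h (x - s • y) :=
    funext fun x => mc_kap hk ε hm hC x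
  rw [h1]
  set G : Euc N → ℝ → (Euc N →L[ℝ] ℝ) := fun x s => ∫ y, h (x - s • y) • fderiv ℝ ζ y with hG
  set K := C * ∫ y, ‖fderiv ℝ ζ y‖ with hK
  have hdi : Integrable fun y => fderiv ℝ ζ y :=
    (hk.zs.continuous_fderiv (by simp)).integrable_of_hasCompactSupport (hzc.fderiv (𝕜 := ℝ))
  have hGb : ∀ x s, ‖G x s‖ ≤ K := by
    intro x s
    rw [hK, ← integral_const_mul]
    refine norm_integral_le_of_norm_le (hdi.norm.const_mul C) (Eventually.of_forall fun y => ?_)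
    rw [norm_smul]
    exact mul_le_mul_of_nonneg_right (hC _) (norm_nonneg _)
  have hGm : ∀ x, StronglyMeasurable (G x) := by
    intro x
    have : StronglyMeasurable fun q : ℝ × Euc N => h (x - q.1 • q.2) • fderiv ℝ ζ q.2 := by
      have h2 : Measurable fun q : ℝ × Euc N => h (x - q.1 • q.2) := hm.comp (by fun_prop)
      have h3 : StronglyMeasurable fun q : ℝ × Euc N => fderiv ℝ ζ q.2 :=
        ((hk.zs.continuous_fderiv (by simp)).comp continuous_snd).stronglyMeasurable
      exact h2.stronglyMeasurable.smul h3
    exact this.integral_prod_right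
  have hFm : ∀ x, StronglyMeasurable fun s : ℝ => s * ∫ y, ζ y * h (x - s • y) := by
    intro x
    refine stronglyMeasurable_id.mul ?_
    have : StronglyMeasurable fun q : ℝ × Euc N => ζ q.2 * h (x - q.1 • q.2) := by
      have h2 : Measurable fun q : ℝ × Euc N => h (x - q.1 • q.2) := hm.comp (by fun_prop)
      have h3 := hk.zs.continuous.measurable
      exact ((h3.comp measurable_snd).mul h2).stronglyMeasurable
    exact this.integral_prod_right
  have hC0 : 0 ≤ C := (abs_nonneg _).trans (hC 0)
  have hder : ∀ x, HasFDerivAt (fun x => ∫ s in Ioc 0 ε, s * ∫ y, ζ y * h (x - s • y))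
      (∫ s in Ioc 0 ε, G x s) x := by
    intro x
    refine hasFDerivAt_integral_of_dominated_of_fderiv_le (𝕜 := ℝ) (F' := G)
      (bound := fun _ => K) (s := univ) univ_mem
      (Eventually.of_forall fun x => (hFm x).aestronglyMeasurable) ?_
      (hGm x).aestronglyMeasurable (Eventually.of_forall fun s x _ => hGb x s) (by simp) ?_
    · refine Measure.integrableOn_of_bounded (M := ε * (C * ∫ y, ζ y)) (by simp)
        (hFm x).aestronglyMeasurable ?_
      refine (ae_restrict_iff' measurableSet_Ioc).2 (Eventually.of_forall fun s hs => ?_)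
      rw [norm_mul, Real.norm_of_nonneg hs.1.le]
      refine mul_le_mul hs.2 ?_ (norm_nonneg _) (hs.1.le.trans hs.2)
      rw [← integral_const_mul]
      refine norm_integral_le_of_norm_le (hk.zintegrable.const_mul C)
        (Eventually.of_forall fun y => ?_)
      rw [norm_mul, Real.norm_of_nonneg (hk.z0 y), mul_comm]
      exact mul_le_mul_of_nonneg_right (hC _) (hk.z0 y)
    · refine (ae_restrict_iff' measurableSet_Ioc).2 (Eventually.of_forall fun s hs x _ => ?_)
      refine ((hasFDerivAt_integral_mul_shift hk.zs hzc hm hC hs.1.ne' x).const_mul s).congr_fderiv ?_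
      rw [smul_smul, mul_inv_cancel₀ hs.1.ne', one_smul]
  refine contDiff_one_iff_fderiv.2 ⟨fun x => (hder x).differentiableAt, ?_⟩
  have : fderiv ℝ (fun x => ∫ s in Ioc 0 ε, s * ∫ y, ζ y * h (x - s • y))
      = fun x => ∫ s in Ioc 0 ε, G x s := funext fun x => (hder x).fderiv
  rw [this]
  refine continuous_of_dominated (bound := fun _ => K) (fun x => (hGm x).aestronglyMeasurable)
    (fun x => Eventually.of_forall fun s => hGb x s) (by simp) ?_
  refine (ae_restrict_iff' measurableSet_Ioc).2 (Eventually.of_forall fun s hs => ?_)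
  have h4 : (fun x => G x s) = fun x => s • fderiv ℝ (fun x => ∫ y, ζ y * h (x - s • y)) x := by
    ext1 x
    rw [(hasFDerivAt_integral_mul_shift hk.zs hzc hm hC hs.1.ne' x).fderiv, smul_smul,
      mul_inv_cancel₀ hs.1.ne', one_smul]
  rw [h4]
  exact ((contDiff_integral_mul_shift hk.zs hzc hm hC hs.1.ne').continuous_fderiv
    (by simp)).const_smul s

theorem contDiff_two_of_pd {w : Euc N → ℝ} (hw : ContDiff ℝ 1 w) (h : ∀ i, ContDiff ℝ 1 (pd i w)) :
    ContDiff ℝ 2 w := by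
  have e : fderiv ℝ w = fun x => ∑ i, pd i w x • (EuclideanSpace.proj i : Euc N →L[ℝ] ℝ) := by
    ext x v
    rw [fderiv_eq_sum_pd]
    simp [mul_comm]
  have : ContDiff ℝ (1 + 1) w := contDiff_succ_iff_fderiv.2
    ⟨hw.differentiable (by simp), by simp, by rw [e]; fun_prop⟩
  exact this

theorem contDiff_two_mc_kap (hk : IsKer ζ η) {ε : ℝ} {h : Euc N → ℝ} (hh : ContDiff ℝ 1 h)
    (hc : HasCompactSupport h) : ContDiff ℝ 2 (mc (kap ζ ε) h) := by
  have := (isAvg_kap hk (ε := ε)).fin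
  obtain ⟨C, _, hC⟩ := exists_bound_of_hasCompactSupport hh.continuous hc
  refine contDiff_two_of_pd (contDiff_mc_kap hk hh.continuous.measurable hC) fun i => ?_
  rw [pd_mc hh hc]
  have hp : Continuous (pd i h) := (hh.continuous_fderiv (by simp)).clm_apply continuous_const
  obtain ⟨C', _, hC'⟩ := exists_bound_of_hasCompactSupport hp (hc.pd i)
  exact contDiff_mc_kap hk hp.measurable hC'

end regularity

section interior

variable {N : ℕ} {ζ η : Euc N → ℝ}

theorem ContDiff.continuous_pd {w : Euc N → ℝ} (hw : ContDiff ℝ 1 w) (i : Fin N) :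
    Continuous (pd i w) := (hw.continuous_fderiv (by simp)).clm_apply continuous_const

theorem ContDiff.pd_one {w : Euc N → ℝ} (hw : ContDiff ℝ 2 w) (i : Fin N) :
    ContDiff ℝ 1 (pd i w) :=
  (hw.fderiv_right (m := 1) (by norm_num)).clm_apply contDiff_const

theorem ContDiff.continuous_lap {w : Euc N → ℝ} (hw : ContDiff ℝ 2 w) : Continuous (lap w) := by
  have : lap w = fun x => ∑ i, pd i (pd i w) x := rfl
  rw [this]
  exact continuous_finsetSum _ fun i _ => (hw.pd_one i).continuous_pd i

theorem integral_mul_pd {w ψ : Euc N → ℝ} (hw : ContDiff ℝ 1 w) (hψ : ContDiff ℝ 1 ψ)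
    (hc : HasCompactSupport ψ) (i : Fin N) :
    ∫ x, w x * pd i ψ x = - ∫ x, pd i w x * ψ x := by
  refine integral_mul_fderiv_eq_neg_fderiv_mul_of_integrable (𝕜 := ℝ) ?_ ?_ ?_
    (fun x _ => hw.differentiable (by simp) x) (fun x _ => hψ.differentiable (by simp) x)
  · exact ((hw.continuous_pd i).mul hψ.continuous).integrable_of_hasCompactSupport hc.mul_left
  · exact (hw.continuous.mul (hψ.continuous_pd i)).integrable_of_hasCompactSupport (hc.pd i).mul_left
  · exact (hw.continuous.mul hψ.continuous).integrable_of_hasCompactSupport hc.mul_left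

theorem integral_mul_lap {w ψ : Euc N → ℝ} (hw : ContDiff ℝ 2 w) (hψ : ContDiff ℝ ∞ ψ)
    (hc : HasCompactSupport ψ) :
    ∫ x, w x * lap ψ x = ∫ x, lap w x * ψ x := by
  have h1 : ∀ x, w x * lap ψ x = ∑ i, w x * pd i (pd i ψ) x := fun x => by
    rw [lap_eq_sum_pd, Finset.mul_sum]
  have h2 : ∀ x, lap w x * ψ x = ∑ i, pd i (pd i w) x * ψ x := fun x => by
    rw [lap_eq_sum_pd, Finset.sum_mul]
  simp_rw [h1, h2]
  rw [integral_finsetSum, integral_finsetSum]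
  · refine Finset.sum_congr rfl fun i _ => ?_
    rw [integral_mul_pd (hw.of_le (by norm_num)) ((hψ.pd_top i).of_le (by simp)) (hc.pd i) i]
    have := integral_mul_pd (hw.pd_one i) (hψ.of_le (by simp)) hc i
    rw [this, neg_neg]
  · intro i _
    exact (((hw.pd_one i).continuous_pd i).mul hψ.continuous).integrable_of_hasCompactSupport
      hc.mul_left
  · intro i _
    exact (hw.continuous.mul ((hψ.pd_top i).pd_top i).continuous).integrable_of_hasCompactSupport
      ((hc.pd i).pd i).mul_left

theorem IsAvg.mc_congr_of_ball {μ : Measure (Euc N)} {R : ℝ} (hμ : IsAvg μ R) {g h : Euc N → ℝ}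
    {x : Euc N} {U : Set (Euc N)} (hU : ∀ z, ‖z‖ ≤ R → x - z ∈ U)
    (hgh : ∀ᵐ y, y ∈ U → g y = h y) : mc μ g x = mc μ h x := by
  refine integral_congr_ae ?_
  have h1 := hμ.ac.ae_le
    ((Measure.measurePreserving_sub_left volume x).quasiMeasurePreserving.ae hgh)
  filter_upwards [h1, hμ.supp] with z hz1 hz2 using hz1 (hU z hz2)

theorem exists_local_solution (hk : IsKer ζ η) {Ω : Set (Euc N)} (hΩ : IsOpen Ω)
    {v h : Euc N → ℝ} (hv : Integrable v) (hvm : Measurable v) {C : ℝ} (hvC : ∀ x, |v x| ≤ C)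
    (hh : Integrable h) (hhm : Measurable h) {C' : ℝ} (hhC : ∀ x, |h x| ≤ C')
    {Φ : Euc N → ℝ → ℝ} (hΦ : ContDiffOn ℝ 1 (Function.uncurry Φ) (Ω ×ˢ (univ : Set ℝ)))
    (hhΦ : ∀ᵐ x, x ∈ Ω → h x = Φ x (v x))
    (hw : ∀ ψ : Euc N → ℝ, ContDiff ℝ ∞ ψ → HasCompactSupport ψ → tsupport ψ ⊆ Ω →
      -∫ x, v x * lap ψ x = ∫ x, h x * ψ x) {x₀ : Euc N} (hx₀ : x₀ ∈ Ω) :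
    ∃ ρ > 0, Metric.ball x₀ ρ ⊆ Ω ∧ ∃ w : Euc N → ℝ, ContDiff ℝ 2 w ∧
      (∀ᵐ x, x ∈ Metric.ball x₀ ρ → v x = w x) ∧
      ∀ x ∈ Metric.ball x₀ ρ, - lap w x = Φ x (w x) := by
  obtain ⟨R, hR, hRΩ⟩ := Metric.nhds_basis_closedBall.mem_iff.1 (hΩ.mem_nhds hx₀)
  obtain ⟨ρ, rfl⟩ : ∃ ρ, R = 4 * ρ := ⟨R / 4, by ring⟩
  have hρ : 0 < ρ := by linarith
  have hρΩ : Metric.ball x₀ ρ ⊆ Ω :=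
    (Metric.ball_subset_closedBall.trans (Metric.closedBall_subset_closedBall (by linarith))).trans
      hRΩ
  refine ⟨ρ, hρ, hρΩ, ?_⟩
  have hK := isAvg_kap hk (ε := ρ)
  have hv1 := eq_mc_of_weak_solution hk hρ hv hh (U := Metric.ball x₀ (3 * ρ)) (Ω := Ω)
    Metric.isOpen_ball (by
      intro x hx y hy
      refine hRΩ ?_
      rw [Metric.mem_closedBall] at hy ⊢
      rw [Metric.mem_ball] at hx
      linarith [dist_triangle y x x₀]) hw
  set w₁ : Euc N → ℝ := fun x => mc (mol η ρ) v x + mc (kap ζ ρ) h x with hw₁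
  have hw₁c : ContDiff ℝ 1 w₁ :=
    ((contDiff_mc_mol hk hρ hvm hvC).of_le (by simp)).add (contDiff_mc_kap hk hhm hhC)
  let χ : ContDiffBump x₀ := ⟨2 * ρ, 3 * ρ, by linarith, by linarith⟩
  have hχs : tsupport χ ⊆ Ω := by
    rw [χ.tsupport_eq]
    exact (Metric.closedBall_subset_closedBall (by change 3 * ρ ≤ _; linarith)).trans hRΩ
  set k : Euc N → ℝ := fun x => χ x * Φ x (w₁ x) with hkdef
  have hkc : HasCompactSupport k := χ.hasCompactSupport.mul_right
  have hk1 : ContDiff ℝ 1 k := by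
    refine contDiff_iff_contDiffAt.2 fun x => ?_
    by_cases hx : x ∈ tsupport k
    swap
    · exact contDiffAt_const.congr_of_eventuallyEq (notMem_tsupport_iff_eventuallyEq.1 hx)
    have hx : x ∈ Ω := hχs ((closure_mono (Function.support_mul_subset_left _ _)) hx)
    refine χ.contDiff.contDiffAt.mul ?_
    have h1 : ContDiffAt ℝ 1 (Function.uncurry Φ) (x, w₁ x) :=
      hΦ.contDiffAt ((hΩ.prod isOpen_univ).mem_nhds ⟨hx, mem_univ _⟩)
    exact ContDiffAt.comp x h1 (contDiffAt_id.prodMk hw₁c.contDiffAt)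
  have hhk : ∀ᵐ x, x ∈ Metric.ball x₀ (2 * ρ) → h x = k x := by
    filter_upwards [hv1, hhΦ] with x h1 h2 hx
    have hx3 : x ∈ Metric.ball x₀ (3 * ρ) := Metric.ball_subset_ball (by linarith) hx
    have hx4 : x ∈ Ω := hRΩ (Metric.ball_subset_closedBall
      (Metric.ball_subset_ball (by linarith) hx3))
    rw [h2 hx4, h1 hx3, hkdef]
    simp only
    rw [χ.one_of_mem_closedBall (Metric.ball_subset_closedBall hx), one_mul]
  set w : Euc N → ℝ := fun x => mc (mol η ρ) v x + mc (kap ζ ρ) k x with hwdef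
  have hwc : ContDiff ℝ 2 w :=
    (contDiff_infty.1 (contDiff_mc_mol hk hρ hvm hvC) 2).add
      (contDiff_two_mc_kap hk hk1 hkc)
  have hww : ∀ x ∈ Metric.ball x₀ ρ, w x = w₁ x := by
    intro x hx
    simp only [hwdef, hw₁]
    rw [hK.mc_congr_of_ball (U := Metric.ball x₀ (2 * ρ)) _ hhk]
    intro z hz
    rw [Metric.mem_ball] at hx ⊢
    have : dist (x - z) x ≤ ρ := by simpa [dist_eq_norm] using hz
    linarith [dist_triangle (x - z) x x₀]
  have hvw : ∀ᵐ x, x ∈ Metric.ball x₀ ρ → v x = w x := by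
    filter_upwards [hv1] with x h1 hx
    rw [hww x hx, h1 (Metric.ball_subset_ball (by linarith) hx)]
  refine ⟨w, hwc, hvw, ?_⟩
  have hcont : Continuous fun x => lap w x + k x := hwc.continuous_lap.add hk1.continuous
  have key := Metric.isOpen_ball.ae_eq_zero_of_integral_contDiff_smul_eq_zero (μ := volume)
    (U := Metric.ball x₀ ρ) (f := fun x => lap w x + k x)
    (hcont.locallyIntegrable.locallyIntegrableOn _) fun ψ hψ hc hs => by
      have e1 : ∀ x, ψ x • (lap w x + k x) = lap w x * ψ x + k x * ψ x := fun x => by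
        rw [smul_eq_mul]; ring
      simp_rw [e1]
      have i1 : Integrable fun x => lap w x * ψ x :=
        (hwc.continuous_lap.mul hψ.continuous).integrable_of_hasCompactSupport hc.mul_left
      have i2 : Integrable fun x => k x * ψ x :=
        (hk1.continuous.mul hψ.continuous).integrable_of_hasCompactSupport hc.mul_left
      rw [integral_add i1 i2, ← integral_mul_lap hwc hψ hc]
      have e2 := hw ψ hψ hc (hs.trans hρΩ)
      have e3 : ∫ x, w x * lap ψ x = ∫ x, v x * lap ψ x := by
        refine integral_congr_ae ?_
        filter_upwards [hvw] with x hx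
        by_cases hxs : x ∈ tsupport (lap ψ)
        · rw [hx (hs (tsupport_lap_subset ψ hxs))]
        · rw [image_eq_zero_of_notMem_tsupport hxs, mul_zero, mul_zero]
      have e4 : ∫ x, k x * ψ x = ∫ x, h x * ψ x := by
        refine integral_congr_ae ?_
        filter_upwards [hhk] with x hx
        by_cases hxs : x ∈ tsupport ψ
        · rw [hx (Metric.ball_subset_ball (by linarith) (hs hxs))]
        · rw [image_eq_zero_of_notMem_tsupport hxs, mul_zero, mul_zero]
      rw [e3, e4]
      linarith
  have key2 : EqOn (fun x => lap w x + k x) 0 (Metric.ball x₀ ρ) := by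
    refine Measure.eqOn_open_of_ae_eq (μ := volume) ?_ Metric.isOpen_ball hcont.continuousOn
      continuousOn_const
    exact (ae_restrict_iff' Metric.isOpen_ball.measurableSet).2 key
  intro x hx
  have h5 : lap w x + k x = 0 := key2 hx
  have h6 : k x = Φ x (w x) := by
    rw [hww x hx, hkdef]
    simp only
    rw [χ.one_of_mem_closedBall (Metric.ball_subset_closedBall
      (Metric.ball_subset_ball (by change ρ ≤ 2 * ρ; linarith) hx)), one_mul]
  linarith

theorem exists_solution_on (hk : IsKer ζ η) {Ω : Set (Euc N)} (hΩ : IsOpen Ω)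
    {v h : Euc N → ℝ} (hv : Integrable v) (hvm : Measurable v) {C : ℝ} (hvC : ∀ x, |v x| ≤ C)
    (hh : Integrable h) (hhm : Measurable h) {C' : ℝ} (hhC : ∀ x, |h x| ≤ C')
    {Φ : Euc N → ℝ → ℝ} (hΦ : ContDiffOn ℝ 1 (Function.uncurry Φ) (Ω ×ˢ (univ : Set ℝ)))
    (hhΦ : ∀ᵐ x, x ∈ Ω → h x = Φ x (v x))
    (hw : ∀ ψ : Euc N → ℝ, ContDiff ℝ ∞ ψ → HasCompactSupport ψ → tsupport ψ ⊆ Ω →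
      -∫ x, v x * lap ψ x = ∫ x, h x * ψ x) :
    ∃ w : Euc N → ℝ, ContDiffOn ℝ 2 w Ω ∧ (∀ᵐ x, x ∈ Ω → v x = w x) ∧
      ∀ x ∈ Ω, - lap w x = Φ x (w x) := by
  classical
  have H := fun x₀ (hx₀ : x₀ ∈ Ω) =>
    exists_local_solution hk hΩ hv hvm hvC hh hhm hhC hΦ hhΦ hw hx₀
  choose ρ hρ hρΩ W hWc hWv hWl using H
  set w : Euc N → ℝ := fun x => if hx : x ∈ Ω then W x hx x else 0 with hwdef
  have hwW : ∀ x₀ (hx₀ : x₀ ∈ Ω), EqOn w (W x₀ hx₀) (Metric.ball x₀ (ρ x₀ hx₀)) := by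
    intro x₀ hx₀ x hx
    have hxΩ : x ∈ Ω := hρΩ x₀ hx₀ hx
    simp only [hwdef, dif_pos hxΩ]
    have : EqOn (W x hxΩ) (W x₀ hx₀)
        (Metric.ball x₀ (ρ x₀ hx₀) ∩ Metric.ball x (ρ x hxΩ)) := by
      have ho := (Metric.isOpen_ball (x := x₀) (ε := ρ x₀ hx₀)).inter
        (Metric.isOpen_ball (x := x) (ε := ρ x hxΩ))
      refine Measure.eqOn_open_of_ae_eq (μ := volume) ?_ ho (hWc x hxΩ).continuous.continuousOn
        (hWc x₀ hx₀).continuous.continuousOn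
      refine (ae_restrict_iff' ho.measurableSet).2 ?_
      filter_upwards [hWv x hxΩ, hWv x₀ hx₀] with y h1 h2 hy
      rw [← h1 hy.2, ← h2 hy.1]
    exact this ⟨hx, Metric.mem_ball_self (hρ x hxΩ)⟩
  have hev : ∀ x (hx : x ∈ Ω), w =ᶠ[𝓝 x] W x hx := fun x hx => by
    filter_upwards [Metric.ball_mem_nhds x (hρ x hx)] with y hy using hwW x hx hy
  refine ⟨w, fun x hx => ?_, ?_, fun x hx => ?_⟩
  · exact ((hWc x hx).contDiffAt.congr_of_eventuallyEq (hev x hx)).contDiffWithinAt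
  · have : volume {x | ¬ (x ∈ Ω → v x = w x)} = 0 := by
      refine measure_null_of_locally_null _ fun x hx => ?_
      have hxΩ : x ∈ Ω := by
        by_contra hc
        exact hx fun h => absurd h hc
      refine ⟨Metric.ball x (ρ x hxΩ) ∩ {x | ¬ (x ∈ Ω → v x = w x)}, ?_, ?_⟩
      · exact inter_mem (mem_nhdsWithin_of_mem_nhds (Metric.ball_mem_nhds x (hρ x hxΩ)))
          self_mem_nhdsWithin
      · refine measure_mono_null ?_ (hWv x hxΩ)
        rintro y ⟨hy1, hy2⟩ hy3
        refine hy2 fun _ => ?_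
        rw [hy3 hy1, hwW x hxΩ hy1]
    exact this
  · have e : lap w x = lap (W x hx) x := by
      rw [lap_eq_sum_pd, lap_eq_sum_pd]
      refine Finset.sum_congr rfl fun i _ => ?_
      have : pd i w =ᶠ[𝓝 x] pd i (W x hx) := by
        filter_upwards [(hev x hx).fderiv (𝕜 := ℝ)] with y hy
        simp only [pd, hy]
      simp only [_root_.pd] at this ⊢
      rw [this.fderiv_eq]
    have h3 := hWl x hx x (Metric.mem_ball_self (hρ x hx))
    rw [e, h3, hwW x hx (Metric.mem_ball_self (hρ x hx))]

end interior

section boundary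

variable {N : ℕ} {ζ η : Euc N → ℝ}

theorem le_of_ae_le_of_continuousOn {U : Set (Euc N)} (hU : IsOpen U) {f g : Euc N → ℝ}
    (hf : ContinuousOn f U) (hg : ContinuousOn g U) (h : ∀ᵐ x, x ∈ U → f x ≤ g x) :
    ∀ x ∈ U, f x ≤ g x := by
  have key : EqOn (fun x => max (f x) (g x)) g U := by
    refine Measure.eqOn_open_of_ae_eq (μ := volume) ?_ hU (hf.sup hg) hg
    refine (ae_restrict_iff' hU.measurableSet).2 ?_
    filter_upwards [h] with x hx hxU using max_eq_right (hx hxU)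
  exact fun x hx => (le_max_left _ _).trans_eq (key hx)

theorem integrable_eta_mul (hk : IsKer ζ η) {v : Euc N → ℝ} (hvm : Measurable v) {A : ℝ}
    (hvA : ∀ x, |v x| ≤ A) (x : Euc N) (s : ℝ) : Integrable fun y => η y * v (x - s • y) := by
  have : Measurable fun y : Euc N => v (x - s • y) := hvm.comp (by fun_prop)
  exact hk.eintegrable.mul_bdd this.aestronglyMeasurable (Eventually.of_forall fun y => hvA _)

theorem exists_exterior_balls {Ω : Set (Euc N)} (hΩ : IsOpen Ω) {ξ : Euc N}
    (hξ : ξ ∈ frontier Ω)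
    (hc1 : ∃ U : Set (Euc N), IsOpen U ∧ ξ ∈ U ∧
      ∃ F : Euc N → ℝ, ContDiff ℝ 1 F ∧ (∀ y ∈ U, fderiv ℝ F y ≠ 0) ∧
        Ω ∩ U = {y ∈ U | F y < 0}) :
    ∃ n : Euc N, ‖n‖ ≤ 1 ∧ ∃ r₀ : ℝ, 0 < r₀ ∧ ∀ r : ℝ, 0 < r → r < r₀ → ∀ e : Euc N, ‖e‖ ≤ 1 / 4 →
      ξ + r • (n + e) ∉ Ω := by
  obtain ⟨U, hU, hξU, F, hF, hF', hFΩ⟩ := hc1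
  have hξΩ : ξ ∉ Ω := by
    rw [hΩ.frontier_eq] at hξ
    exact hξ.2
  have hF0 : 0 ≤ F ξ := by
    by_contra hc
    have : ξ ∈ Ω ∩ U := hFΩ ▸ (⟨hξU, not_le.1 hc⟩ : ξ ∈ {y ∈ U | F y < 0})
    exact hξΩ this.1
  set D := gradient F ξ with hD
  have hDn : 0 < ‖D‖ := by
    rw [norm_pos_iff]
    intro h
    refine hF' ξ hξU ?_
    have : (InnerProductSpace.toDual ℝ (Euc N)) D = fderiv ℝ F ξ := by simp [hD, gradient]
    rw [← this, h, map_zero]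
  have hDf : ∀ y, fderiv ℝ F ξ y = inner ℝ D y := fun y => by
    simp [hD, gradient]
  set n := ‖D‖⁻¹ • D with hn
  have hnn : ‖n‖ = 1 := by rw [hn, norm_smul, norm_inv, norm_norm, inv_mul_cancel₀ hDn.ne']
  have hDnn : inner ℝ D n = ‖D‖ := by
    rw [hn, real_inner_smul_right, real_inner_self_eq_norm_sq]
    field_simp
  have hder := (hF.differentiable (by simp) ξ).hasFDerivAt.isLittleO
  have hev : ∀ᶠ x in 𝓝 ξ, ‖F x - F ξ - fderiv ℝ F ξ (x - ξ)‖ ≤ ‖D‖ / 4 * ‖x - ξ‖ :=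
    hder.def (by positivity)
  obtain ⟨δ, hδ, hball⟩ := Metric.mem_nhds_iff.1 (inter_mem hev (hU.mem_nhds hξU))
  refine ⟨n, hnn.le, δ / 2, by positivity, fun r hr hrδ e he hmem => ?_⟩
  have hne : ‖n + e‖ ≤ 5 / 4 := (norm_add_le _ _).trans (by linarith)
  have hnorm : ‖r • (n + e)‖ ≤ r * (5 / 4) := by
    rw [norm_smul, Real.norm_of_nonneg hr.le]
    exact mul_le_mul_of_nonneg_left hne hr.le
  have hx := @hball (ξ + r • (n + e)) (by
    rw [Metric.mem_ball, dist_eq_norm, add_sub_cancel_left]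
    linarith)
  have h1 : ‖F (ξ + r • (n + e)) - F ξ - fderiv ℝ F ξ (ξ + r • (n + e) - ξ)‖
      ≤ ‖D‖ / 4 * ‖ξ + r • (n + e) - ξ‖ := hx.1
  have h2 : ξ + r • (n + e) ∈ {y ∈ U | F y < 0} := hFΩ ▸ ⟨hmem, hx.2⟩
  have h3 := h2.2
  rw [add_sub_cancel_left, hDf, inner_smul_right, inner_add_right, hDnn, Real.norm_eq_abs] at h1
  have h4 : -(‖D‖ / 4) ≤ inner ℝ D e := by
    have := abs_real_inner_le_norm D e
    have h5 := (abs_le.1 this).1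
    nlinarith
  have h6 := (abs_le.1 h1).1
  have h7 : ‖D‖ / 4 * ‖r • (n + e)‖ ≤ ‖D‖ / 4 * (r * (5 / 4)) :=
    mul_le_mul_of_nonneg_left hnorm (by positivity)
  have h8 : r * (‖D‖ - ‖D‖ / 4) ≤ r * (‖D‖ + inner ℝ D e) :=
    mul_le_mul_of_nonneg_left (by linarith) hr.le
  nlinarith [mul_pos hr hDn]

theorem exists_eta_ball_mass (hk : IsKer ζ η) :
    ∃ θ : ℝ, 0 < θ ∧ ∀ c : Euc N, ‖c‖ ≤ 1 / 2 → θ ≤ ∫ y in Metric.ball c (1 / 16), η y := by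
  obtain ⟨y₀, hy₀, hmin⟩ := (isCompact_closedBall (0 : Euc N) (9 / 16)).exists_isMinOn
    ⟨0, Metric.mem_closedBall_self (by norm_num)⟩ hk.es.continuous.continuousOn
  have hy₀' : ‖y₀‖ < 1 := by
    have := mem_closedBall_zero_iff.1 hy₀
    linarith
  have hpos := hk.epos y₀ hy₀'
  refine ⟨η y₀ * volume.real (Metric.ball (0 : Euc N) (1 / 16)), mul_pos hpos ?_, fun c hc => ?_⟩
  · exact ENNReal.toReal_pos (Metric.measure_ball_pos volume _ (by norm_num)).ne'
      measure_ball_lt_top.ne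
  · have h1 : ∫ y in Metric.ball c (1 / 16), η y₀ = η y₀ * volume.real (Metric.ball (0 : Euc N) (1 / 16)) := by
      rw [setIntegral_const, smul_eq_mul, mul_comm, measureReal_def, measureReal_def,
        Measure.addHaar_ball_center]
    rw [← h1]
    refine setIntegral_mono_on (integrableOn_const measure_ball_lt_top.ne) hk.eintegrable.integrableOn measurableSet_ball
      fun y hy => hmin ?_
    rw [mem_closedBall_zero_iff]
    rw [Metric.mem_ball, dist_eq_norm] at hy
    have := norm_le_norm_sub_add y c
    linarith

theorem mc_kap_le_sq (hk : IsKer ζ η) {h : Euc N → ℝ} (hhm : Measurable h) {B : ℝ}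
    (hhB : ∀ x, |h x| ≤ B) {ε : ℝ} (hε : 0 < ε) (x : Euc N) :
    mc (kap ζ ε) h x ≤ B * (∫ y, ζ y) * ε ^ 2 := by
  have hB : 0 ≤ B := (abs_nonneg _).trans (hhB 0)
  have hz : 0 ≤ ∫ y, ζ y := integral_nonneg hk.z0
  rw [mc_kap hk ε hhm hhB]
  refine (Real.le_norm_self _).trans ?_
  have : ∀ s ∈ Ioc 0 ε, ‖s * ∫ y, ζ y * h (x - s • y)‖ ≤ ε * (B * ∫ y, ζ y) := by
    intro s hs
    rw [norm_mul, Real.norm_of_nonneg hs.1.le]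
    refine mul_le_mul hs.2 ?_ (norm_nonneg _) hε.le
    rw [← integral_const_mul]
    refine norm_integral_le_of_norm_le (hk.zintegrable.const_mul B)
      (Eventually.of_forall fun y => ?_)
    rw [norm_mul, Real.norm_of_nonneg (hk.z0 y), mul_comm]
    exact mul_le_mul_of_nonneg_right (hhB _) (hk.z0 y)
  have h2 := norm_setIntegral_le_of_norm_le_const (μ := volume) (s := Ioc 0 ε)
    (by simp) this
  refine h2.trans (le_of_eq ?_)
  simp [measureReal_def, hε.le]
  ring

theorem tendsto_zero_at_boundary (hk : IsKer ζ η) (hintg : ∫ y, η y = 1) {Ω : Set (Euc N)}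
    (hΩ : IsOpen Ω)
    {v h w : Euc N → ℝ} (hvm : Measurable v) {A : ℝ} (hv0 : ∀ x, 0 ≤ v x) (hvA : ∀ x, v x ≤ A)
    (hvΩ : ∀ x, x ∉ Ω → v x = 0) (hhm : Measurable h) {B : ℝ} (hhB : ∀ x, |h x| ≤ B)
    (hsub : ∀ ε : ℝ, 0 < ε → ∀ᵐ x, v x ≤ mc (mol η ε) v x + mc (kap ζ ε) h x)
    (hwc : ContinuousOn w Ω) (hvw : ∀ᵐ x, x ∈ Ω → v x = w x) {ξ : Euc N}
    (hξ : ξ ∈ frontier Ω)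
    (hc1 : ∃ U : Set (Euc N), IsOpen U ∧ ξ ∈ U ∧
      ∃ F : Euc N → ℝ, ContDiff ℝ 1 F ∧ (∀ y ∈ U, fderiv ℝ F y ≠ 0) ∧
        Ω ∩ U = {y ∈ U | F y < 0}) {t₀ : ℝ} (ht₀ : 0 < t₀) :
    ∃ r > 0, ∀ x ∈ Ω ∩ Metric.ball ξ r, w x ≤ t₀ := by
  obtain ⟨n, hn, r₀, hr₀, hext⟩ := exists_exterior_balls hΩ hξ hc1
  obtain ⟨θ, hθ, hmass⟩ := exists_eta_ball_mass hk
  have hvA' : ∀ x, |v x| ≤ A := fun x => by rw [abs_of_nonneg (hv0 x)]; exact hvA x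
  have hA0 : 0 ≤ A := (hv0 0).trans (hvA 0)
  set K := B * ∫ y, ζ y with hK
  have hK0 : 0 ≤ K := mul_nonneg ((abs_nonneg _).trans (hhB 0)) (integral_nonneg hk.z0)
  have hwsub : ∀ ε : ℝ, 0 < ε → ∀ x ∈ Ω, w x ≤ (∫ y, η y * v (x - ε • y)) + K * ε ^ 2 := by
    intro ε hε x hx
    have h1 := le_of_ae_le_of_continuousOn (f := w)
      (g := fun x => mc (mol η ε) v x + mc (kap ζ ε) h x) hΩ hwc
      (((contDiff_mc_mol hk hε hvm hvA').continuous.add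
        (contDiff_mc_kap hk hhm hhB).continuous).continuousOn) (by
        filter_upwards [hvw, hsub ε hε] with x h1 h2 hx
        rw [← h1 hx]
        exact h2) x hx
    rw [mc_mol hk ε hvm] at h1
    linarith [mc_kap_le_sq hk hhm hhB hε x]
  set S : Set ℝ := {t | 0 ≤ t ∧ ∃ r > 0, ∀ x ∈ Ω ∩ Metric.ball ξ r, w x ≤ t} with hS
  have hstep : ∀ t ∈ S, ∀ δ > 0, (1 - θ) * t + δ ∈ S := by
    rintro t ⟨ht, R, hR, htR⟩ δ hδ
    have hθ1 : θ ≤ 1 := by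
      rw [← hintg]
      exact (hmass 0 (by simp)).trans (setIntegral_le_integral hk.eintegrable
        (Eventually.of_forall fun y => (hk.z0 y).trans (hk.zle y)))
    refine ⟨by nlinarith, ?_⟩
    obtain ⟨r, hr, hr1, hr2, hr3⟩ : ∃ r : ℝ, 0 < r ∧ r < r₀ ∧ 5 * r ≤ R ∧
        K * (4 * r) ^ 2 ≤ δ := by
      have : Tendsto (fun r : ℝ => K * (4 * r) ^ 2) (𝓝[>] 0) (𝓝 0) := by
        have h1 : Continuous fun r : ℝ => K * (4 * r) ^ 2 := by fun_prop
        have h2 := h1.tendsto 0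
        rw [show K * (4 * (0 : ℝ)) ^ 2 = 0 by ring] at h2
        exact h2.mono_left nhdsWithin_le_nhds
      have h3 := this.eventually (ge_mem_nhds hδ)
      have h4 : ∀ᶠ r : ℝ in 𝓝[>] 0, r < min r₀ (R / 5) :=
        mem_nhdsWithin_of_mem_nhds (Iio_mem_nhds (by positivity))
      obtain ⟨r, h5, h6, h7⟩ := (h3.and (h4.and self_mem_nhdsWithin)).exists
      refine ⟨r, h7, h6.trans_le (min_le_left _ _), ?_, h5⟩
      have := h6.trans_le (min_le_right _ _)
      linarith
    refine ⟨r, hr, fun x hx => ?_⟩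
    refine (hwsub (4 * r) (by positivity) x hx.1).trans ?_
    have hvt : ∀ᵐ y, η y * v (x - (4 * r) • y) ≤ η y * t := by
      have h5 : ∀ᵐ y : Euc N, x - (4 * r) • y ∈ Ω → v (x - (4 * r) • y) = w (x - (4 * r) • y) := by
        have q1 : Measure.QuasiMeasurePreserving (fun y : Euc N => x - (4 * r) • y) volume volume :=
          ((Measure.measurePreserving_sub_left volume x).quasiMeasurePreserving).comp
            (Measure.quasiMeasurePreserving_smul volume (by positivity))
        exact q1.ae hvw
      filter_upwards [h5] with y hy
      by_cases h1 : 1 ≤ ‖y‖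
      · simp [hk.esupp y h1]
      refine mul_le_mul_of_nonneg_left ?_ ((hk.z0 y).trans (hk.zle y))
      by_cases hyΩ : x - (4 * r) • y ∈ Ω
      · rw [hy hyΩ]
        refine htR _ ⟨hyΩ, ?_⟩
        have h2 : dist (x - (4 * r) • y) x ≤ 4 * r := by
          rw [dist_eq_norm, sub_sub_cancel_left, norm_neg, norm_smul, Real.norm_of_nonneg
            (by positivity)]
          nlinarith
        have h3 := hx.2
        rw [Metric.mem_ball] at h3 ⊢
        linarith [dist_triangle (x - (4 * r) • y) x ξ]
      · rw [hvΩ _ hyΩ]; exact ht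
    set c : Euc N := (4 * r)⁻¹ • (x - ξ - r • n) with hc
    have hcn : ‖c‖ ≤ 1 / 2 := by
      rw [hc, norm_smul, norm_inv, Real.norm_of_nonneg (by positivity : (0 : ℝ) ≤ 4 * r)]
      have h1 : ‖x - ξ - r • n‖ ≤ 2 * r := by
        have h3 := hx.2
        rw [Metric.mem_ball, dist_eq_norm] at h3
        have h4 : ‖r • n‖ ≤ r := by
          rw [norm_smul, Real.norm_of_nonneg hr.le]; nlinarith
        linarith [norm_sub_le (x - ξ) (r • n)]
      rw [inv_mul_le_iff₀ (by positivity)]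
      linarith
    have hball0 : ∀ y ∈ Metric.ball c (1 / 16), η y * v (x - (4 * r) • y) = 0 := by
      intro y hy
      have e1 : x - (4 * r) • y = ξ + r • (n + (4 : ℝ) • (c - y)) := by
        have : (4 * r) • c = x - ξ - r • n := by
          rw [hc, smul_smul, mul_inv_cancel₀ (by positivity), one_smul]
        have e2 : r • (4 : ℝ) • (c - y) = (4 * r) • c - (4 * r) • y := by
          rw [smul_smul, mul_comm r 4, smul_sub]
        rw [smul_add, e2, this]
        abel
      rw [hvΩ, mul_zero]
      rw [e1]
      refine hext r hr hr1 _ ?_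
      rw [Metric.mem_ball, dist_eq_norm, norm_sub_rev] at hy
      rw [norm_smul, Real.norm_of_nonneg (by norm_num)]
      linarith
    have hi := integrable_eta_mul hk hvm hvA' x (4 * r)
    have h6 : ∫ y, η y * v (x - (4 * r) • y) ≤ (1 - θ) * t := by
      rw [← integral_add_compl (measurableSet_ball (x := c) (ε := 1 / 16)) hi,
        setIntegral_congr_fun (g := fun _ => (0 : ℝ)) measurableSet_ball hball0]
      simp only [integral_zero, zero_add]
      have h7 : ∫ y in (Metric.ball c (1 / 16))ᶜ, η y * v (x - (4 * r) • y)
          ≤ ∫ y in (Metric.ball c (1 / 16))ᶜ, η y * t :=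
        integral_mono_ae hi.integrableOn (hk.eintegrable.mul_const t).integrableOn
          (ae_restrict_of_ae hvt)
      refine h7.trans ?_
      rw [integral_mul_const]
      refine mul_le_mul_of_nonneg_right ?_ ht
      have := integral_add_compl (measurableSet_ball (x := c) (ε := 1 / 16)) hk.eintegrable
      linarith [hmass c hcn]
    linarith
  have hSne : S.Nonempty := by
    refine ⟨A, hA0, 1, one_pos, fun x hx => ?_⟩
    refine le_of_ae_le_of_continuousOn (f := w) (g := fun _ => A) hΩ hwc continuousOn_const ?_ x hx.1
    filter_upwards [hvw] with x h1 hx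
    rw [← h1 hx]
    exact hvA x
  have hSb : BddBelow S := ⟨0, fun t ht => ht.1⟩
  set m := sInf S with hm
  have hm0 : 0 ≤ m := le_csInf hSne fun t ht => ht.1
  have hm1 : m ≤ 0 := by
    by_contra hcon
    push Not at hcon
    obtain ⟨t, htS, htm⟩ := exists_lt_of_csInf_lt hSne
      (show m < m + θ * m / 2 by nlinarith)
    have h8 : m ≤ (1 - θ) * t + θ * m / 4 := csInf_le hSb (hstep t htS _ (by positivity))
    have h9 : m ≤ t := csInf_le hSb htS
    nlinarith
  obtain ⟨t, ⟨_, r, hr, htr⟩, htm⟩ := exists_lt_of_csInf_lt hSne (show m < t₀ by linarith)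
  exact ⟨r, hr, fun x hx => (htr x hx).trans htm.le⟩

end boundary

section positivity

variable {N : ℕ} {ζ η : Euc N → ℝ}

theorem forall_eq_zero_of_iterate {m : ℝ → ℝ} {A Λ ε₀ : ℝ} (hm0 : ∀ s, 0 ≤ m s)
    (hmA : ∀ s, m s ≤ A) (hΛ : 0 ≤ Λ) (hΛε : Λ * ε₀ ^ 2 ≤ 1 / 2)
    (h : ∀ ε, 0 < ε → ε ≤ ε₀ → ∀ M, 0 ≤ M → (∀ s, 0 < s → s ≤ ε → m s ≤ M) →
      m ε ≤ Λ * (ε ^ 2 * M)) : ∀ ε, 0 < ε → ε ≤ ε₀ → m ε = 0 := by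
  have key : ∀ k : ℕ, ∀ ε, 0 < ε → ε ≤ ε₀ → m ε ≤ A * (1 / 2) ^ k := by
    intro k
    induction k with
    | zero => intro ε _ _; simpa using hmA ε
    | succ k ih =>
      intro ε hε hε₀
      have hA : 0 ≤ A := (hm0 0).trans (hmA 0)
      refine (h ε hε hε₀ (A * (1 / 2) ^ k) (by positivity) fun s hs hsε =>
        ih s hs (hsε.trans hε₀)).trans ?_
      have h1 : Λ * ε ^ 2 ≤ 1 / 2 := by
        refine le_trans ?_ hΛε
        gcongr
      rw [pow_succ (1 / 2 : ℝ) k]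
      nlinarith [mul_le_mul_of_nonneg_right h1 (by positivity : 0 ≤ A * (1 / 2 : ℝ) ^ k)]
  intro ε hε hε₀
  refine le_antisymm ?_ (hm0 ε)
  have h1 : Tendsto (fun k : ℕ => A * (1 / 2 : ℝ) ^ k) atTop (𝓝 (A * 0)) :=
    (tendsto_pow_atTop_nhds_zero_of_lt_one (by norm_num) (by norm_num)).const_mul A
  rw [mul_zero] at h1
  exact ge_of_tendsto' h1 fun k => key k ε hε hε₀

theorem eq_zero_near_of_eq_zero (hk : IsKer ζ η) (hintg : ∫ y, η y = 1) {Ω : Set (Euc N)}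
    (hΩ : IsOpen Ω)
    {v h w : Euc N → ℝ} (hv : Integrable v) (hvm : Measurable v) {A : ℝ}
    (hv0 : ∀ x, 0 ≤ v x) (hvA : ∀ x, v x ≤ A)
    (hh : Integrable h) (hhm : Measurable h) {B : ℝ} (hhB : ∀ x, |h x| ≤ B)
    {Λ : ℝ} (hΛ : 0 ≤ Λ) (hhΛ : ∀ x, -(Λ * v x) ≤ h x)
    (hweak : ∀ ψ : Euc N → ℝ, ContDiff ℝ ∞ ψ → HasCompactSupport ψ → tsupport ψ ⊆ Ω →
      -∫ x, v x * lap ψ x = ∫ x, h x * ψ x)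
    (hwc : ContinuousOn w Ω) (hvw : ∀ᵐ x, x ∈ Ω → v x = w x) {x₀ : Euc N} (hx₀ : x₀ ∈ Ω)
    (hw0 : w x₀ = 0) : ∃ ρ > 0, ∀ x ∈ Metric.ball x₀ ρ, x ∈ Ω ∧ w x = 0 := by
  have hvA' : ∀ x, |v x| ≤ A := fun x => by rw [abs_of_nonneg (hv0 x)]; exact hvA x
  obtain ⟨R, hR, hRΩ⟩ := Metric.nhds_basis_closedBall.mem_iff.1 (hΩ.mem_nhds hx₀)
  obtain ⟨ρ, hρ, hρR, hρΛ⟩ : ∃ ρ : ℝ, 0 < ρ ∧ 2 * ρ ≤ R ∧ Λ * ρ ^ 2 ≤ 1 / 2 := by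
    have h1 : Tendsto (fun r : ℝ => Λ * r ^ 2) (𝓝[>] 0) (𝓝 0) := by
      have h1 : Continuous fun r : ℝ => Λ * r ^ 2 := by fun_prop
      have h2 := h1.tendsto 0
      rw [show Λ * (0 : ℝ) ^ 2 = 0 by ring] at h2
      exact h2.mono_left nhdsWithin_le_nhds
    have h3 := h1.eventually (ge_mem_nhds (by norm_num : (0 : ℝ) < 1 / 2))
    have h4 : ∀ᶠ r : ℝ in 𝓝[>] 0, r < R / 2 :=
      mem_nhdsWithin_of_mem_nhds (Iio_mem_nhds (by positivity))
    obtain ⟨r, h5, h6, h7⟩ := (h3.and (h4.and self_mem_nhdsWithin)).exists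
    exact ⟨r, h7, by linarith, h5⟩
  set m : ℝ → ℝ := fun s => ∫ y, η y * v (x₀ - s • y) with hm
  have he0 : ∀ y, 0 ≤ η y := fun y => (hk.z0 y).trans (hk.zle y)
  have hm0 : ∀ s, 0 ≤ m s := fun s => integral_nonneg fun y => mul_nonneg (he0 y) (hv0 _)
  have hmA : ∀ s, m s ≤ A := by
    intro s
    have : m s ≤ ∫ y, η y * A := integral_mono (integrable_eta_mul hk hvm hvA' x₀ s)
      (hk.eintegrable.mul_const A) fun y => mul_le_mul_of_nonneg_left (hvA _) (he0 y)
    rwa [integral_mul_const, hintg, one_mul] at this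
  have hid : ∀ ε, 0 < ε → ε ≤ ρ → 0 = m ε + ∫ s in Ioc 0 ε, s * ∫ y, ζ y * h (x₀ - s • y) := by
    intro ε hε hερ
    have hball : ∀ x ∈ Metric.ball x₀ ρ, Metric.closedBall x ε ⊆ Ω := by
      intro x hx y hy
      refine hRΩ ?_
      rw [Metric.mem_closedBall] at hy ⊢
      rw [Metric.mem_ball] at hx
      linarith [dist_triangle y x x₀]
    have hsubΩ : Metric.ball x₀ ρ ⊆ Ω := fun x hx => hball x hx (Metric.mem_closedBall_self hε.le)
    have h1 := eq_mc_of_weak_solution hk hε hv hh Metric.isOpen_ball hball hweak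
    have h2 : EqOn w (fun x => mc (mol η ε) v x + mc (kap ζ ε) h x) (Metric.ball x₀ ρ) := by
      refine Measure.eqOn_open_of_ae_eq (μ := volume) ?_ Metric.isOpen_ball (hwc.mono hsubΩ)
        ((contDiff_mc_mol hk hε hvm hvA').continuous.add
          (contDiff_mc_kap hk hhm hhB).continuous).continuousOn
      refine (ae_restrict_iff' measurableSet_ball).2 ?_
      filter_upwards [h1, hvw] with x h3 h4 hx
      rw [← h4 (hsubΩ hx), h3 hx]
    have h3 := h2 (Metric.mem_ball_self hρ)
    simp only [hw0, mc_mol hk ε hvm, mc_kap hk ε hhm hhB] at h3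
    exact h3
  have hstep : ∀ ε, 0 < ε → ε ≤ ρ → ∀ M, 0 ≤ M → (∀ s, 0 < s → s ≤ ε → m s ≤ M) →
      m ε ≤ Λ * (ε ^ 2 * M) := by
    intro ε hε hερ M hM hmM
    have h1 := hid ε hε hερ
    have hpt : ∀ s ∈ Ioc 0 ε, -(Λ * (ε * M)) ≤ s * ∫ y, ζ y * h (x₀ - s • y) := by
      intro s hs
      have hzi : Integrable fun y => ζ y * h (x₀ - s • y) := by
        have : Measurable fun y : Euc N => h (x₀ - s • y) := hhm.comp (by fun_prop)
        exact hk.zintegrable.mul_bdd this.aestronglyMeasurable (Eventually.of_forall fun y => hhB _)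
      have h2 : ∫ y, (-Λ) * (η y * v (x₀ - s • y)) ≤ ∫ y, ζ y * h (x₀ - s • y) := by
        refine integral_mono ((integrable_eta_mul hk hvm hvA' x₀ s).const_mul _) hzi fun y => ?_
        simp only
        have h3 := mul_le_mul_of_nonneg_left (hhΛ (x₀ - s • y)) (hk.z0 y)
        have h4 := mul_le_mul_of_nonneg_right (hk.zle y) (mul_nonneg hΛ (hv0 (x₀ - s • y)))
        nlinarith
      rw [integral_const_mul] at h2
      have h5 := hmM s hs.1 hs.2
      have h6 : s * (-Λ * m s) ≤ s * ∫ y, ζ y * h (x₀ - s • y) :=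
        mul_le_mul_of_nonneg_left h2 hs.1.le
      have h7 : s * m s ≤ ε * M := mul_le_mul hs.2 h5 (hm0 s) hε.le
      nlinarith [mul_le_mul_of_nonneg_left h7 hΛ]
    have hintg2 : IntegrableOn (fun s => s * ∫ y, ζ y * h (x₀ - s • y)) (Ioc 0 ε) := by
      refine Measure.integrableOn_of_bounded (M := ε * (B * ∫ y, ζ y)) (by simp) ?_ ?_
      · have h3 : StronglyMeasurable fun s : ℝ => s * ∫ y, ζ y * h (x₀ - s • y) := by
          refine stronglyMeasurable_id.mul ?_
          have h4 : StronglyMeasurable fun q : ℝ × Euc N => ζ q.2 * h (x₀ - q.1 • q.2) := by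
            have h2 : Measurable fun q : ℝ × Euc N => h (x₀ - q.1 • q.2) := hhm.comp (by fun_prop)
            have h3 := hk.zs.continuous.measurable
            exact ((h3.comp measurable_snd).mul h2).stronglyMeasurable
          exact h4.integral_prod_right
        exact h3.aestronglyMeasurable
      · refine (ae_restrict_iff' measurableSet_Ioc).2 (Eventually.of_forall fun s hs => ?_)
        rw [norm_mul, Real.norm_of_nonneg hs.1.le]
        refine mul_le_mul hs.2 ?_ (norm_nonneg _) (hs.1.le.trans hs.2)
        rw [← integral_const_mul]
        refine norm_integral_le_of_norm_le (hk.zintegrable.const_mul B)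
          (Eventually.of_forall fun y => ?_)
        rw [norm_mul, Real.norm_of_nonneg (hk.z0 y), mul_comm]
        exact mul_le_mul_of_nonneg_right (hhB _) (hk.z0 y)
    have h9 : ∫ s in Ioc 0 ε, -(Λ * (ε * M)) ≤ ∫ s in Ioc 0 ε, s * ∫ y, ζ y * h (x₀ - s • y) :=
      setIntegral_mono_on (integrableOn_const (by simp)) hintg2 measurableSet_Ioc hpt
    rw [setIntegral_const] at h9
    simp only [measureReal_def, Real.volume_Ioc, sub_zero, ENNReal.toReal_ofReal hε.le,
      smul_eq_mul] at h9
    nlinarith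
  have hmz := forall_eq_zero_of_iterate hm0 hmA hΛ hρΛ hstep ρ hρ le_rfl
  have hsubΩ : Metric.ball x₀ ρ ⊆ Ω :=
    (Metric.ball_subset_closedBall.trans (Metric.closedBall_subset_closedBall (by linarith))).trans
      hRΩ
  have hvz : ∀ᵐ y : Euc N, y ∈ Metric.ball x₀ ρ → v y = 0 := by
    have h1 := (integral_eq_zero_iff_of_nonneg (fun y => mul_nonneg (he0 y) (hv0 _))
      (integrable_eta_mul hk hvm hvA' x₀ ρ)).1 hmz
    have q1 : Measure.QuasiMeasurePreserving (fun z : Euc N => ρ⁻¹ • (x₀ - z)) volume volume :=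
      (Measure.quasiMeasurePreserving_smul volume (by positivity)).comp
        ((Measure.measurePreserving_sub_left volume x₀).quasiMeasurePreserving)
    filter_upwards [q1.ae h1] with z hz hzb
    simp only [Pi.zero_apply, smul_smul, mul_inv_cancel₀ hρ.ne', one_smul, sub_sub_cancel] at hz
    refine (mul_eq_zero.1 hz).resolve_left (hk.epos _ ?_).ne'
    rw [norm_smul, norm_inv, Real.norm_of_nonneg hρ.le, inv_mul_lt_iff₀ hρ, mul_one, norm_sub_rev,
      ← dist_eq_norm]
    exact hzb
  have hfin : EqOn w 0 (Metric.ball x₀ ρ) := by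
    refine Measure.eqOn_open_of_ae_eq (μ := volume) ?_ Metric.isOpen_ball (hwc.mono hsubΩ)
      continuousOn_const
    refine (ae_restrict_iff' measurableSet_ball).2 ?_
    filter_upwards [hvz, hvw] with x h1 h2 hx
    rw [← h2 (hsubΩ hx), h1 hx]; rfl
  exact ⟨ρ, hρ, fun x hx => ⟨hsubΩ hx, hfin hx⟩⟩

theorem pos_of_zero_set_open {Ω : Set (Euc N)} (hΩ : IsOpen Ω) (hconn : IsConnected Ω)
    {w : Euc N → ℝ} (hwc : ContinuousOn w Ω) (hw0 : ∀ x ∈ Ω, 0 ≤ w x)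
    (hopen : ∀ x₀ ∈ Ω, w x₀ = 0 → ∃ ρ > 0, ∀ x ∈ Metric.ball x₀ ρ, x ∈ Ω ∧ w x = 0)
    (hne : ∃ x ∈ Ω, w x ≠ 0) : ∀ x ∈ Ω, 0 < w x := by
  by_contra hcon
  push Not at hcon
  obtain ⟨x₀, hx₀, hwx₀⟩ := hcon
  obtain ⟨x₁, hx₁, hwx₁⟩ := hne
  have hS : IsOpen {x | x ∈ Ω ∧ w x = 0} := by
    refine Metric.isOpen_iff.2 fun x hx => ?_
    obtain ⟨ρ, hρ, h⟩ := hopen x hx.1 hx.2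
    exact ⟨ρ, hρ, h⟩
  have hT : IsOpen (Ω ∩ w ⁻¹' {0}ᶜ) := hwc.isOpen_inter_preimage hΩ isOpen_compl_singleton
  obtain ⟨x, _, hx2, hx3⟩ := hconn.isPreconnected _ _ hS hT
    (fun x hx => by
      by_cases h : w x = 0
      · exact Or.inl ⟨hx, h⟩
      · exact Or.inr ⟨hx, h⟩)
    ⟨x₀, hx₀, hx₀, le_antisymm hwx₀ (hw0 x₀ hx₀)⟩ ⟨x₁, hx₁, hx₁, hwx₁⟩
  exact hx3.2 hx2.2

end positivity

section nonlinearity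

variable {N : ℕ}

theorem rpow_mul_le_of_deriv_ge {q q' : ℝ → ℝ} (hd : ∀ t, HasDerivAt q (q' t) t) {c : ℝ}
    (h : ∀ t, c * (q t * t) ≤ q' t * t ^ 2) (τ : ℝ) {s : ℝ} (hs : 1 ≤ s) :
    s ^ (c + 1) * (q τ * τ) ≤ q (s * τ) * (s * τ) := by
  set g : ℝ → ℝ := fun s => q (s * τ) * (s * τ) * s ^ (-(c + 1)) with hg
  have hder : ∀ s, 0 < s → HasDerivAt g
      (((q' (s * τ) * τ) * (s * τ) + q (s * τ) * τ) * s ^ (-(c + 1))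
        + q (s * τ) * (s * τ) * (-(c + 1) * s ^ (-(c + 1) - 1))) s := by
    intro s hs
    have h1 : HasDerivAt (fun s : ℝ => s * τ) τ s := by simpa using (hasDerivAt_id s).mul_const τ
    have h2 : HasDerivAt (fun s : ℝ => q (s * τ)) (q' (s * τ) * τ) s := (hd (s * τ)).comp s h1
    exact (h2.mul h1).mul (Real.hasDerivAt_rpow_const (Or.inl hs.ne'))
  have hmono : MonotoneOn g (Ici 1) := by
    refine monotoneOn_of_deriv_nonneg (convex_Ici 1) (fun s hs =>
      (hder s (by linarith [mem_Ici.1 hs])).continuousAt.continuousWithinAt)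
      (fun s hs => (hder s (by rw [interior_Ici] at hs; linarith [mem_Ioi.1 hs])).differentiableAt.differentiableWithinAt)
      fun s hs => ?_
    have hs0 : 0 < s := by rw [interior_Ici] at hs; linarith [mem_Ioi.1 hs]
    rw [(hder s hs0).deriv]
    have e : s ^ (-(c + 1) - 1) = s ^ (-(c + 1)) / s := by
      rw [Real.rpow_sub_one hs0.ne']
    rw [e]
    have h3 := h (s * τ)
    have h4 : ((q' (s * τ) * τ) * (s * τ) + q (s * τ) * τ) * s ^ (-(c + 1))
        + q (s * τ) * (s * τ) * (-(c + 1) * (s ^ (-(c + 1)) / s))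
        = (q' (s * τ) * (s * τ) ^ 2 - c * (q (s * τ) * (s * τ))) * (s ^ (-(c + 1)) / s) := by
      field_simp
      ring
    rw [h4]
    exact mul_nonneg (by linarith) (div_nonneg (Real.rpow_nonneg hs0.le _) hs0.le)
  have h5 := hmono (mem_Ici.2 le_rfl) (mem_Ici.2 hs) hs
  have hs0 : 0 < s := by linarith
  simp only [hg, one_mul, Real.one_rpow, mul_one] at h5
  rw [Real.rpow_neg hs0.le, ← div_eq_mul_inv, le_div_iff₀ (Real.rpow_pos_of_pos hs0 _)] at h5
  linarith

theorem le_rpow_mul_of_deriv_le {q q' : ℝ → ℝ} (hd : ∀ t, HasDerivAt q (q' t) t) {c : ℝ}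
    (h : ∀ t, q' t * t ^ 2 ≤ c * (q t * t)) (τ : ℝ) {s : ℝ} (hs : 1 ≤ s) :
    q (s * τ) * (s * τ) ≤ s ^ (c + 1) * (q τ * τ) := by
  have := rpow_mul_le_of_deriv_ge (q := fun t => - q t) (q' := fun t => - q' t)
    (fun t => (hd t).neg) (c := c) (fun t => by linarith [h t]) τ hs
  linarith

/-- A superlinear odd nonlinearity `q` on `Ω`, extended by zero, with derivative `q'` in the
second variable. -/
structure Nonlin (Ω : Set (Euc N)) (q q' : Euc N → ℝ → ℝ) (a b M : ℝ) : Prop where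
  ha : 2 < a
  hab : a ≤ b
  hM : 0 < M
  odd : ∀ x t, q x (-t) = - q x t
  meas : Measurable (Function.uncurry q)
  der : ∀ x t, HasDerivAt (q x) (q' x t) t
  off : ∀ x, x ∉ Ω → ∀ t, q x t = 0
  low : ∀ x t, (a - 1) * (q x t * t) ≤ q' x t * t ^ 2
  upp : ∀ x t, q' x t * t ^ 2 ≤ (b - 1) * (q x t * t)
  nonneg : ∀ x t, 0 ≤ q x t * t
  pos : ∀ᵐ x, x ∈ Ω → ∀ t, t ≠ 0 → 0 < q x t * t
  growth : ∀ x t, |q x t| ≤ M * (|t| ^ (a - 1) + |t| ^ (b - 1))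

theorem hasDerivAt_oddExtension {f : ℝ → ℝ} (hf : Differentiable ℝ f) (h0 : f 0 = 0)
    (h1 : deriv f 0 = 0) (t : ℝ) :
    HasDerivAt (fun t => if 0 ≤ t then f t else - f (-t)) (deriv f |t|) t := by
  set g : ℝ → ℝ := fun t => if 0 ≤ t then f t else - f (-t) with hg
  have hneg : ∀ t, HasDerivAt (fun t => - f (-t)) (deriv f (-t)) t := by
    intro t
    have h3 : HasDerivAt (fun t : ℝ => f (-t)) (deriv f (-t) * -1) t :=
      (hf (-t)).hasDerivAt.comp t (hasDerivAt_neg t)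
    have h4 := h3.neg
    rw [mul_neg_one, neg_neg] at h4
    exact h4
  rcases lt_trichotomy t 0 with ht | ht | ht
  · rw [abs_of_neg ht]
    refine (hneg t).congr_of_eventuallyEq ?_
    filter_upwards [Iio_mem_nhds ht] with s hs
    simp only [hg, if_neg (not_le.2 (mem_Iio.1 hs))]
  · subst ht
    rw [abs_zero, h1]
    have hr : HasDerivWithinAt g 0 (Ici 0) 0 := by
      have := (hf 0).hasDerivAt.hasDerivWithinAt (s := Ici 0)
      rw [h1] at this
      refine this.congr (fun s hs => ?_) ?_
      · simp only [hg, if_pos (mem_Ici.1 hs)]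
      · simp [hg]
    have hl : HasDerivWithinAt g 0 (Iic 0) 0 := by
      have := (hneg 0).hasDerivWithinAt (s := Iic 0)
      rw [neg_zero, h1] at this
      refine this.congr (fun s hs => ?_) ?_
      · rcases (mem_Iic.1 hs).lt_or_eq with h | h
        · simp only [hg, if_neg (not_le.2 h)]
        · subst h; simp [hg, h0]
      · simp [hg, h0]
    have := hl.union hr
    rw [Iic_union_Ici] at this
    exact hasDerivWithinAt_univ.1 this
  · rw [abs_of_pos ht]
    refine (hf t).hasDerivAt.congr_of_eventuallyEq ?_
    filter_upwards [Ioi_mem_nhds ht] with s hs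
    simp only [hg, if_pos (le_of_lt (mem_Ioi.1 hs))]

open Classical in
/-- The odd extension in `t` of `f x` restricted to positive arguments, zero for `x ∉ Ω`. -/
def oddExt (Ω : Set (Euc N)) (f : Euc N → ℝ → ℝ) (x : Euc N) (t : ℝ) : ℝ :=
  if x ∈ Ω then (if 0 ≤ t then f x t else - f x (-t)) else 0

theorem oddExt_of_nonneg {Ω : Set (Euc N)} {f : Euc N → ℝ → ℝ} {x : Euc N} (hx : x ∈ Ω) {t : ℝ}
    (ht : 0 ≤ t) : oddExt Ω f x t = f x t := by
  simp [oddExt, hx, ht]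

theorem measurable_oddExt {Ω : Set (Euc N)} (hΩ : IsOpen Ω) {f : Euc N → ℝ → ℝ}
    (hf : ContinuousOn (Function.uncurry f) (Ω ×ˢ (univ : Set ℝ))) :
    Measurable (Function.uncurry (oddExt Ω f)) := by
  classical
  have hS : MeasurableSet (Ω ×ˢ (univ : Set ℝ)) := hΩ.measurableSet.prod MeasurableSet.univ
  have h1 : Measurable ((Ω ×ˢ (univ : Set ℝ)).indicator (Function.uncurry f)) := by
    refine measurable_of_restrict_of_restrict_compl hS ?_ ?_
    · have : (Ω ×ˢ (univ : Set ℝ)).domRestrict ((Ω ×ˢ (univ : Set ℝ)).indicator (Function.uncurry f))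
          = (Ω ×ˢ (univ : Set ℝ)).domRestrict (Function.uncurry f) := by
        ext z; exact indicator_of_mem z.2 _
      rw [this]
      exact (continuousOn_iff_continuous_domRestrict.1 hf).measurable
    · have : (Ω ×ˢ (univ : Set ℝ))ᶜ.domRestrict ((Ω ×ˢ (univ : Set ℝ)).indicator (Function.uncurry f))
          = fun _ => 0 := by
        ext z; exact indicator_of_notMem z.2 _
      rw [this]
      exact measurable_const
  have h2 : Function.uncurry (oddExt Ω f) = fun z : Euc N × ℝ => if 0 ≤ z.2 then
      (Ω ×ˢ (univ : Set ℝ)).indicator (Function.uncurry f) z else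
      - (Ω ×ˢ (univ : Set ℝ)).indicator (Function.uncurry f) (z.1, -z.2) := by
    ext ⟨x, t⟩
    by_cases hx : x ∈ Ω <;> by_cases ht : 0 ≤ t <;>
      simp [oddExt, Function.uncurry, indicator, hx, ht]
  rw [h2]
  refine Measurable.ite (measurableSet_le measurable_const measurable_snd) h1 ?_
  exact (h1.comp (measurable_fst.prodMk measurable_snd.neg)).neg

theorem nonlin_oddExt {Ω : Set (Euc N)} (hΩ : IsOpen Ω) {f : Euc N → ℝ → ℝ}
    (hf : ContDiffOn ℝ 1 (Function.uncurry f) (Ω ×ˢ (univ : Set ℝ)))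
    (hf0 : ∀ x ∈ Ω, f x 0 = 0 ∧ deriv (f x) 0 = 0) {a b M : ℝ} (ha : 2 < a) (hab : a ≤ b)
    (har : ∀ᵐ x ∂(volume : Measure (Euc N)).restrict Ω, ∀ t : ℝ, t ≠ 0 →
        0 < (a - 1) * f x t * t ∧ (a - 1) * f x t * t ≤ deriv (f x) t * t ^ 2 ∧
          deriv (f x) t * t ^ 2 ≤ (b - 1) * f x t * t)
    (hM : 0 < M) (hfM : ∀ x ∈ Ω, |f x 1| < M) :
    Nonlin Ω (oddExt Ω f) (fun x t => Ω.indicator (fun x => deriv (f x) |t|) x) a b M := by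
  classical
  have hopen : IsOpen (Ω ×ˢ (univ : Set ℝ)) := hΩ.prod isOpen_univ
  have hdiff : ∀ x ∈ Ω, ∀ t, HasDerivAt (f x) (fderiv ℝ (Function.uncurry f) (x, t) (0, 1)) t := by
    intro x hx t
    have h1 : HasFDerivAt (Function.uncurry f) (fderiv ℝ (Function.uncurry f) (x, t)) (x, t) :=
      ((hf.contDiffAt (hopen.mem_nhds ⟨hx, mem_univ t⟩)).differentiableAt (by simp)).hasFDerivAt
    have h2 : HasDerivAt (fun s : ℝ => (x, s)) ((0 : Euc N), (1 : ℝ)) t :=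
      (hasDerivAt_const t x).prodMk (hasDerivAt_id t)
    exact h1.comp_hasDerivAt t h2
  have hcf : ∀ t, ContinuousOn (fun x => f x t) Ω := fun t =>
    hf.continuousOn.comp (f := fun x => (x, t)) (by fun_prop) fun x hx => ⟨hx, mem_univ t⟩
  have hcd : ∀ t, ContinuousOn (fun x => deriv (f x) t) Ω := by
    intro t
    have h1 : ContinuousOn (fun x => fderiv ℝ (Function.uncurry f) (x, t) (0, 1)) Ω := by
      have h2 := hf.continuousOn_fderiv_of_isOpen hopen (by simp)
      have h3 : ContinuousOn (fun x => fderiv ℝ (Function.uncurry f) (x, t)) Ω :=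
        h2.comp (f := fun x => (x, t)) (by fun_prop) fun x hx => ⟨hx, mem_univ t⟩
      exact h3.clm_apply continuousOn_const
    exact h1.congr fun x hx => (hdiff x hx t).deriv
  have har' := (ae_restrict_iff' hΩ.measurableSet).1 har
  have hall : ∀ x ∈ Ω, ∀ t, 0 ≤ f x t * t ∧ (a - 1) * (f x t * t) ≤ deriv (f x) t * t ^ 2 ∧
      deriv (f x) t * t ^ 2 ≤ (b - 1) * (f x t * t) := by
    intro x hx t
    rcases eq_or_ne t 0 with rfl | ht
    · simp
    refine ⟨?_, ?_, ?_⟩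
    · refine le_of_ae_le_of_continuousOn (f := fun _ => 0) (g := fun x => f x t * t) hΩ
        continuousOn_const ((hcf t).mul continuousOn_const) ?_ x hx
      filter_upwards [har'] with y hy hyΩ
      have h1 := (hy hyΩ t ht).1
      rw [mul_assoc] at h1
      exact (pos_of_mul_pos_right h1 (by linarith)).le
    · refine le_of_ae_le_of_continuousOn (f := fun x => (a - 1) * (f x t * t))
        (g := fun x => deriv (f x) t * t ^ 2) hΩ
        (continuousOn_const.mul ((hcf t).mul continuousOn_const))
        ((hcd t).mul continuousOn_const) ?_ x hx
      filter_upwards [har'] with y hy hyΩ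
      have h1 := (hy hyΩ t ht).2.1
      rwa [mul_assoc] at h1
    · refine le_of_ae_le_of_continuousOn (g := fun x => (b - 1) * (f x t * t))
        (f := fun x => deriv (f x) t * t ^ 2) hΩ ((hcd t).mul continuousOn_const)
        (continuousOn_const.mul ((hcf t).mul continuousOn_const)) ?_ x hx
      filter_upwards [har'] with y hy hyΩ
      have h1 := (hy hyΩ t ht).2.2
      rwa [mul_assoc (b - 1)] at h1
  have hodd : ∀ x ∈ Ω, ∀ t, oddExt Ω f x (-t) = - oddExt Ω f x t := by
    intro x hx t
    rcases lt_trichotomy t 0 with ht | ht | ht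
    · simp [oddExt, hx, ht.le, not_le.2 ht]
    · subst ht; simp [oddExt, hx, (hf0 x hx).1]
    · simp [oddExt, hx, ht.le, not_le.2 ht]
  have heq : ∀ x ∈ Ω, ∀ t, oddExt Ω f x t * t = f x |t| * |t| := by
    intro x hx t
    by_cases ht : 0 ≤ t
    · simp [oddExt, hx, ht, abs_of_nonneg ht]
    · simp [oddExt, hx, ht, abs_of_neg (not_le.1 ht)]
  have hder : ∀ x ∈ Ω, ∀ t, HasDerivAt (oddExt Ω f x) (deriv (f x) |t|) t := by
    intro x hx t
    have : oddExt Ω f x = fun t => if 0 ≤ t then f x t else - f x (-t) := by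
      ext t; simp [oddExt, hx]
    rw [this]
    exact hasDerivAt_oddExtension (fun t => (hdiff x hx t).differentiableAt) (hf0 x hx).1
      (hf0 x hx).2 t
  have hlow : ∀ x ∈ Ω, ∀ t, (a - 1) * (oddExt Ω f x t * t) ≤ deriv (f x) |t| * t ^ 2 := by
    intro x hx t
    rw [heq x hx, ← sq_abs t]
    exact (hall x hx |t|).2.1
  have hupp : ∀ x ∈ Ω, ∀ t, deriv (f x) |t| * t ^ 2 ≤ (b - 1) * (oddExt Ω f x t * t) := by
    intro x hx t
    rw [heq x hx, ← sq_abs t]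
    exact (hall x hx |t|).2.2
  have hgr : ∀ x ∈ Ω, ∀ t, 0 < t → oddExt Ω f x t ≤ M * (t ^ (a - 1) + t ^ (b - 1)) := by
    intro x hx t ht
    have hf1 : oddExt Ω f x 1 ≤ M := by
      rw [oddExt_of_nonneg hx zero_le_one]
      exact (le_abs_self _).trans (hfM x hx).le
    have hta := Real.rpow_pos_of_pos ht (a - 1)
    have htb := Real.rpow_pos_of_pos ht (b - 1)
    rcases le_total 1 t with h1 | h1
    · have h2 := le_rpow_mul_of_deriv_le (hder x hx) (hupp x hx) 1 h1
      rw [mul_one, mul_one, sub_add_cancel] at h2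
      have h3 : t ^ b = t ^ (b - 1) * t := by
        rw [← Real.rpow_add_one ht.ne', sub_add_cancel]
      rw [h3] at h2
      have h4 : oddExt Ω f x t ≤ t ^ (b - 1) * oddExt Ω f x 1 := by
        refine le_of_mul_le_mul_right ?_ ht
        linarith
      nlinarith [mul_le_mul_of_nonneg_left hf1 htb.le]
    · have h2 := rpow_mul_le_of_deriv_ge (hder x hx) (hlow x hx) t ((one_le_inv₀ ht).2 h1)
      rw [inv_mul_cancel₀ ht.ne', mul_one, sub_add_cancel, Real.inv_rpow ht.le] at h2
      have h3 : t ^ a = t ^ (a - 1) * t := by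
        rw [← Real.rpow_add_one ht.ne', sub_add_cancel]
      rw [inv_mul_le_iff₀ (Real.rpow_pos_of_pos ht a), h3] at h2
      have h4 : oddExt Ω f x t ≤ t ^ (a - 1) * oddExt Ω f x 1 := by
        refine le_of_mul_le_mul_right ?_ ht
        linarith
      nlinarith [mul_le_mul_of_nonneg_left hf1 hta.le]
  have hoff : ∀ x, x ∉ Ω → ∀ t, oddExt Ω f x t = 0 := fun x hx t => by simp [oddExt, hx]
  refine ⟨ha, hab, hM, fun x t => ?_, measurable_oddExt hΩ hf.continuousOn, fun x t => ?_,
    hoff, fun x t => ?_, fun x t => ?_, fun x t => ?_, ?_, fun x t => ?_⟩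
  · by_cases hx : x ∈ Ω
    · exact hodd x hx t
    · simp [hoff x hx]
  · by_cases hx : x ∈ Ω
    · simpa [hx] using hder x hx t
    · simp only [indicator_of_notMem hx]
      have : oddExt Ω f x = fun _ => 0 := funext (hoff x hx)
      rw [this]
      exact hasDerivAt_const t 0
  · by_cases hx : x ∈ Ω
    · simpa [hx] using hlow x hx t
    · simp [hx, hoff x hx]
  · by_cases hx : x ∈ Ω
    · simpa [hx] using hupp x hx t
    · simp [hx, hoff x hx]
  · by_cases hx : x ∈ Ω
    · rw [heq x hx]; exact (hall x hx |t|).1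
    · simp [hoff x hx]
  · filter_upwards [har'] with x hx hxΩ t ht
    have h1 := (hx hxΩ |t| (abs_pos.2 ht).ne').1
    rw [heq x hxΩ]
    rw [mul_assoc] at h1
    exact pos_of_mul_pos_right h1 (by linarith)
  · by_cases hx : x ∈ Ω
    · have hnn : ∀ t, 0 < t → 0 ≤ oddExt Ω f x t := fun t ht => by
        have h1 := (hall x hx |t|).1
        rw [← heq x hx] at h1
        exact nonneg_of_mul_nonneg_left h1 ht
      rcases lt_trichotomy t 0 with ht | ht | ht
      · have h1 : oddExt Ω f x t = - oddExt Ω f x (-t) := by rw [hodd x hx, neg_neg]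
        rw [h1, abs_neg, abs_of_nonneg (hnn (-t) (by linarith)), abs_of_neg ht]
        exact hgr x hx (-t) (by linarith)
      · subst ht
        have : oddExt Ω f x 0 = 0 := by simp [oddExt, hx, (hf0 x hx).1]
        rw [this, abs_zero]
        have := Real.rpow_nonneg le_rfl (x := 0) (y := a - 1)
        have := Real.rpow_nonneg le_rfl (x := 0) (y := b - 1)
        positivity
      · rw [abs_of_nonneg (hnn t ht), abs_of_pos ht]
        exact hgr x hx t ht
    · rw [hoff x hx, abs_zero]
      have := Real.rpow_nonneg (abs_nonneg t) (a - 1)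
      have := Real.rpow_nonneg (abs_nonneg t) (b - 1)
      have := hM.le
      positivity

end nonlinearity

section integrands

variable {N : ℕ}

theorem exists_rpow_le_mul_rpow_add {b r δ : ℝ} (hb : 0 ≤ b) (hbr : b < r) (hδ : 0 < δ) :
    ∃ C, 0 ≤ C ∧ ∀ t : ℝ, 0 ≤ t → t ^ b ≤ δ * t ^ r + C := by
  set T : ℝ := δ⁻¹ ^ (r - b)⁻¹ with hT
  have hT0 : 0 < T := Real.rpow_pos_of_pos (inv_pos.2 hδ) _
  refine ⟨T ^ b, (Real.rpow_pos_of_pos hT0 b).le, fun t ht => ?_⟩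
  rcases le_total t T with h | h
  · have h1 := Real.rpow_le_rpow ht h hb
    have h2 := mul_nonneg hδ.le (Real.rpow_nonneg ht r)
    linarith
  · have ht0 : 0 < t := hT0.trans_le h
    have h1 : T ^ (r - b) ≤ t ^ (r - b) := Real.rpow_le_rpow hT0.le h (by linarith)
    rw [hT, ← Real.rpow_mul (inv_pos.2 hδ).le, inv_mul_cancel₀ (by linarith), Real.rpow_one] at h1
    have h2 : t ^ r = t ^ (r - b) * t ^ b := by
      rw [← Real.rpow_add ht0, sub_add_cancel]
    have h3 : δ * t ^ r = (δ * t ^ (r - b)) * t ^ b := by rw [h2]; ring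
    have h4 : 1 ≤ δ * t ^ (r - b) := by
      have := mul_le_mul_of_nonneg_left h1 hδ.le
      rwa [mul_inv_cancel₀ hδ.ne'] at this
    have h5 := Real.rpow_nonneg ht b
    have h6 := Real.rpow_nonneg hT0.le b
    rw [h3]
    nlinarith

theorem exists_rpow_le_sq_add_rpow {a r δ : ℝ} (ha : 2 < a) (har : a < r) (hδ : 0 < δ) :
    ∃ C, 0 ≤ C ∧ ∀ t : ℝ, 0 ≤ t → t ^ a ≤ δ * t ^ 2 + C * t ^ r := by
  obtain ⟨C, hC0, hC⟩ := exists_rpow_le_mul_rpow_add (b := r - a) (r := r - 2) (by linarith)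
    (by linarith) hδ
  set T : ℝ := δ ^ (a - 2)⁻¹ with hT
  have hT0 : 0 < T := Real.rpow_pos_of_pos hδ _
  refine ⟨T ^ (a - r), (Real.rpow_pos_of_pos hT0 _).le, fun t ht => ?_⟩
  rcases ht.eq_or_lt with rfl | ht0
  · rw [Real.zero_rpow (by linarith), Real.zero_rpow (by linarith)]; simp
  have e2 : t ^ a = t ^ (a - 2) * t ^ 2 := by
    rw [← Real.rpow_natCast t 2, ← Real.rpow_add ht0]; norm_num
  rcases le_total t T with h | h
  · have h1 : t ^ (a - 2) ≤ T ^ (a - 2) := Real.rpow_le_rpow ht h (by linarith)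
    rw [hT, ← Real.rpow_mul hδ.le, inv_mul_cancel₀ (by linarith), Real.rpow_one] at h1
    rw [e2]
    have h3 := mul_le_mul_of_nonneg_right h1 (sq_nonneg t)
    have h4 := mul_nonneg (Real.rpow_nonneg hT0.le (a - r)) (Real.rpow_nonneg ht r)
    linarith
  · have h1 : t ^ (a - r) ≤ T ^ (a - r) := Real.rpow_le_rpow_of_nonpos hT0 h (by linarith)
    have e3 : t ^ a = t ^ (a - r) * t ^ r := by
      rw [← Real.rpow_add ht0, sub_add_cancel]
    rw [e3]
    have h3 := mul_le_mul_of_nonneg_right h1 (Real.rpow_nonneg ht r)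
    have h4 := mul_nonneg hδ.le (sq_nonneg t)
    linarith

theorem nonneg_of_deriv_mul_nonneg {g g' : ℝ → ℝ} (hd : ∀ t, HasDerivAt g (g' t) t)
    (h0 : g 0 = 0) (h : ∀ t, 0 ≤ g' t * t) (t : ℝ) : 0 ≤ g t := by
  have hc : Continuous g := continuous_iff_continuousAt.2 fun t => (hd t).continuousAt
  rcases lt_trichotomy t 0 with ht | ht | ht
  · obtain ⟨s, hs, h1⟩ := exists_hasDerivAt_eq_slope g g' ht hc.continuousOn fun x _ => hd x
    rw [h0, eq_div_iff (by linarith)] at h1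
    have h2 := h s
    have h3 : g' s ≤ 0 := by
      by_contra h4
      nlinarith [hs.2]
    nlinarith
  · rw [ht, h0]
  · obtain ⟨s, hs, h1⟩ := exists_hasDerivAt_eq_slope g g' ht hc.continuousOn fun x _ => hd x
    rw [h0, eq_div_iff (by linarith)] at h1
    have h2 := h s
    have h3 : 0 ≤ g' s := nonneg_of_mul_nonneg_left h2 hs.1
    nlinarith

/-- A differentiable integrand on `Ω` of polynomial growth of order `b`. -/
structure Integrand (Ω : Set (Euc N)) (G G' : Euc N → ℝ → ℝ) (b C : ℝ) : Prop where
  meas : Measurable (Function.uncurry G)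
  meas' : Measurable (Function.uncurry G')
  der : ∀ x t, HasDerivAt (G x) (G' x t) t
  off : ∀ x, x ∉ Ω → ∀ t, G x t = 0
  off' : ∀ x, x ∉ Ω → ∀ t, G' x t = 0
  bd : ∀ x t, |G x t| ≤ C * (1 + |t| ^ b)
  bd' : ∀ x t, |G' x t| ≤ C * (1 + |t| ^ (b - 1))

theorem measurable_deriv_of_measurable {q q' : Euc N → ℝ → ℝ}
    (hq : Measurable (Function.uncurry q)) (hd : ∀ x t, HasDerivAt (q x) (q' x t) t) :
    Measurable (Function.uncurry q') := by
  refine measurable_of_tendsto_metrizable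
    (f := fun (n : ℕ) (z : Euc N × ℝ) => (((n : ℝ) + 1)⁻¹)⁻¹ *
      (q z.1 (z.2 + ((n : ℝ) + 1)⁻¹) - q z.1 z.2)) ?_ ?_
  · intro n
    refine Measurable.const_mul (Measurable.sub ?_ hq) _
    exact hq.comp (measurable_fst.prodMk (measurable_snd.add_const _))
  · rw [tendsto_pi_nhds]
    rintro ⟨x, t⟩
    have h1 := (hd x t).tendsto_slope_zero
    have h2 : Tendsto (fun n : ℕ => ((n : ℝ) + 1)⁻¹) atTop (𝓝[≠] 0) := by
      refine tendsto_nhdsWithin_iff.2 ⟨?_, Eventually.of_forall fun n => ?_⟩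
      · simpa using tendsto_one_div_add_atTop_nhds_zero_nat (𝕜 := ℝ)
      · exact inv_ne_zero (by positivity)
    exact h1.comp h2

namespace Nonlin

variable {Ω : Set (Euc N)} {q q' : Euc N → ℝ → ℝ} {a b M : ℝ}

/-- The primitive of a nonlinearity. -/
def prim (q : Euc N → ℝ → ℝ) (x : Euc N) (t : ℝ) : ℝ := ∫ s in (0 : ℝ)..t, q x s

/-- The energy density on the Nehari set. -/
def dens (q : Euc N → ℝ → ℝ) (x : Euc N) (t : ℝ) : ℝ := q x t * t / 2 - prim q x t

theorem continuous (hq : Nonlin Ω q q' a b M) (x : Euc N) : Continuous (q x) :=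
  continuous_iff_continuousAt.2 fun t => (hq.der x t).continuousAt

theorem zero (hq : Nonlin Ω q q' a b M) (x : Euc N) : q x 0 = 0 := by
  have := hq.odd x 0
  rw [neg_zero] at this
  linarith

theorem meas' (hq : Nonlin Ω q q' a b M) : Measurable (Function.uncurry q') :=
  measurable_deriv_of_measurable hq.meas hq.der

theorem off' (hq : Nonlin Ω q q' a b M) (x : Euc N) (hx : x ∉ Ω) (t : ℝ) : q' x t = 0 := by
  have h := hq.der x t
  rw [show q x = fun _ => 0 from funext (hq.off x hx)] at h
  exact h.unique (hasDerivAt_const t (0 : ℝ))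

theorem hasDerivAt_prim (hq : Nonlin Ω q q' a b M) (x : Euc N) (t : ℝ) :
    HasDerivAt (prim q x) (q x t) t :=
  (hq.continuous x).integral_hasStrictDerivAt 0 t |>.hasDerivAt

theorem prim_zero (x : Euc N) : prim q x 0 = 0 := by simp [prim]

theorem prim_neg (hq : Nonlin Ω q q' a b M) (x : Euc N) (t : ℝ) : prim q x (-t) = prim q x t := by
  have h := intervalIntegral.integral_comp_neg (a := 0) (b := t) (fun s => q x s)
  simp only [hq.odd x, neg_zero, intervalIntegral.integral_neg] at h
  have h1 := intervalIntegral.integral_symm (f := fun s => q x s) (μ := volume) (-t) 0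
  unfold prim
  linarith

theorem prim_nonneg (hq : Nonlin Ω q q' a b M) (x : Euc N) (t : ℝ) : 0 ≤ prim q x t :=
  nonneg_of_deriv_mul_nonneg (hq.hasDerivAt_prim x) (prim_zero x) (hq.nonneg x) t

theorem hasDerivAt_mul (hq : Nonlin Ω q q' a b M) (x : Euc N) (t : ℝ) :
    HasDerivAt (fun t => q x t * t) (q' x t * t + q x t) t := by
  exact ((hq.der x t).mul (hasDerivAt_id t)).congr_deriv (by simp)

theorem hasDerivAt_dens (hq : Nonlin Ω q q' a b M) (x : Euc N) (t : ℝ) :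
    HasDerivAt (dens q x) ((q' x t * t - q x t) / 2) t := by
  refine (((hq.hasDerivAt_mul x t).div_const 2).sub (hq.hasDerivAt_prim x t)).congr_deriv ?_
  ring

theorem prim_le (hq : Nonlin Ω q q' a b M) (x : Euc N) (t : ℝ) :
    a * prim q x t ≤ q x t * t := by
  have := nonneg_of_deriv_mul_nonneg (g := fun t => q x t * t - a * prim q x t)
    (fun t => (hq.hasDerivAt_mul x t).sub ((hq.hasDerivAt_prim x t).const_mul a))
    (by simp [prim_zero]) (fun t => by nlinarith [hq.low x t]) t
  linarith

theorem le_dens (hq : Nonlin Ω q q' a b M) (x : Euc N) (t : ℝ) :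
    (1 / 2 - 1 / a) * (q x t * t) ≤ dens q x t := by
  have h1 := hq.prim_le x t
  have ha : 0 < a := by linarith [hq.ha]
  have h2 : prim q x t ≤ q x t * t / a := by rw [le_div_iff₀ ha]; linarith
  unfold dens
  have : (1 / 2 - 1 / a) * (q x t * t) = q x t * t / 2 - q x t * t / a := by ring
  linarith

theorem dens_neg (hq : Nonlin Ω q q' a b M) (x : Euc N) (t : ℝ) : dens q x (-t) = dens q x t := by
  unfold dens
  rw [hq.prim_neg, hq.odd]
  ring

theorem measurable_mul (hq : Nonlin Ω q q' a b M) :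
    Measurable (Function.uncurry fun x t => q x t * t) :=
  hq.meas.mul measurable_snd

theorem measurable_prim (hq : Nonlin Ω q q' a b M) :
    Measurable (Function.uncurry (prim q)) := by
  have h1 : Function.uncurry (prim q) = fun z : Euc N × ℝ =>
      ∫ s, z.2 * q z.1 (z.2 * s) ∂((volume : Measure ℝ).restrict (Ioc 0 1)) := by
    ext ⟨x, t⟩
    have h2 := intervalIntegral.smul_integral_comp_mul_left (a := 0) (b := 1) (fun s => q x s) t
    rw [mul_zero, mul_one, smul_eq_mul, intervalIntegral.integral_of_le zero_le_one,
      ← integral_const_mul] at h2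
    exact h2.symm
  rw [h1]
  refine StronglyMeasurable.measurable ?_
  refine StronglyMeasurable.integral_prod_right
    (f := fun (z : Euc N × ℝ) (s : ℝ) => z.2 * q z.1 (z.2 * s)) ?_
  refine Measurable.stronglyMeasurable ?_
  refine (measurable_fst.snd).mul ?_
  exact hq.meas.comp (measurable_fst.fst.prodMk (measurable_fst.snd.mul measurable_snd))

theorem abs_le (hq : Nonlin Ω q q' a b M) (x : Euc N) (t : ℝ) :
    |q x t| ≤ 2 * M * (1 + |t| ^ (b - 1)) := by
  have h := hq.growth x t
  have hM := hq.hM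
  have ha := hq.ha
  have hab := hq.hab
  have h1 : |t| ^ (a - 1) ≤ 1 + |t| ^ (b - 1) := by
    have h0 := abs_nonneg t
    rcases le_total |t| 1 with h1 | h1
    · have := Real.rpow_le_one h0 h1 (by linarith : 0 ≤ a - 1)
      have := Real.rpow_nonneg h0 (b - 1)
      linarith
    · have := Real.rpow_le_rpow_of_exponent_le h1 (by linarith : a - 1 ≤ b - 1)
      linarith
  nlinarith [Real.rpow_nonneg (abs_nonneg t) (b - 1)]

theorem abs_mul_le (hq : Nonlin Ω q q' a b M) (x : Euc N) (t : ℝ) :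
    q x t * t ≤ M * (|t| ^ a + |t| ^ b) := by
  have h := hq.growth x t
  have e : ∀ c : ℝ, 2 < c → |t| ^ (c - 1) * |t| = |t| ^ c := by
    intro c hc
    rcases eq_or_ne t 0 with rfl | ht
    · rw [abs_zero, Real.zero_rpow (by linarith : c ≠ 0)]; simp
    · rw [← Real.rpow_add_one (abs_pos.2 ht).ne', sub_add_cancel]
  calc q x t * t ≤ |q x t * t| := le_abs_self _
    _ = |q x t| * |t| := abs_mul _ _
    _ ≤ M * (|t| ^ (a - 1) + |t| ^ (b - 1)) * |t| := mul_le_mul_of_nonneg_right h (abs_nonneg t)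
    _ = M * (|t| ^ (a - 1) * |t| + |t| ^ (b - 1) * |t|) := by ring
    _ = _ := by rw [e a hq.ha, e b (hq.ha.trans_le hq.hab)]

theorem mul_le (hq : Nonlin Ω q q' a b M) (x : Euc N) (t : ℝ) :
    q x t * t ≤ 2 * M * (1 + |t| ^ b) := by
  have h := hq.abs_mul_le x t
  have hM := hq.hM
  have ha := hq.ha
  have hab := hq.hab
  have h1 : |t| ^ a ≤ 1 + |t| ^ b := by
    have h0 := abs_nonneg t
    rcases le_total |t| 1 with h1 | h1
    · have := Real.rpow_le_one h0 h1 (by linarith : 0 ≤ a)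
      have := Real.rpow_nonneg h0 b
      linarith
    · have := Real.rpow_le_rpow_of_exponent_le h1 hab
      linarith
  nlinarith [Real.rpow_nonneg (abs_nonneg t) b]

theorem abs_deriv_mul_le (hq : Nonlin Ω q q' a b M) (x : Euc N) (t : ℝ) :
    |q' x t * t| ≤ (b - 1) * |q x t| := by
  rcases eq_or_ne t 0 with rfl | ht
  · have := hq.ha
    have := hq.hab
    simp only [mul_zero, abs_zero]
    exact mul_nonneg (by linarith) (abs_nonneg _)
  · have h1 := hq.low x t
    have h2 := hq.upp x t
    have h3 := hq.nonneg x t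
    have ha := hq.ha
    have h4 : |q' x t * t| * |t| ≤ (b - 1) * |q x t| * |t| := by
      rw [← abs_mul, mul_assoc (b - 1), ← abs_mul, abs_of_nonneg h3,
        show q' x t * t * t = q' x t * t ^ 2 by ring, abs_of_nonneg]
      · exact h2
      · nlinarith
    exact le_of_mul_le_mul_right h4 (abs_pos.2 ht)

theorem integrand_mul (hq : Nonlin Ω q q' a b M) :
    Integrand Ω (fun x t => q x t * t) (fun x t => q' x t * t + q x t) b (2 * M * b) := by
  have hM := hq.hM
  have ha := hq.ha
  have hab := hq.hab
  refine ⟨hq.measurable_mul, (hq.meas'.mul measurable_snd).add hq.meas, hq.hasDerivAt_mul,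
    fun x hx t => by simp [hq.off x hx], fun x hx t => by simp [hq.off x hx, hq.off' x hx],
    fun x t => ?_, fun x t => ?_⟩
  · rw [abs_of_nonneg (hq.nonneg x t)]
    refine (hq.mul_le x t).trans ?_
    have := Real.rpow_nonneg (abs_nonneg t) b
    refine mul_le_mul_of_nonneg_right ?_ (by linarith)
    nlinarith
  · refine (abs_add_le _ _).trans ?_
    have h1 := hq.abs_deriv_mul_le x t
    have h2 := hq.abs_le x t
    have : b * |q x t| ≤ b * (2 * M * (1 + |t| ^ (b - 1))) :=
      mul_le_mul_of_nonneg_left h2 (by linarith)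
    nlinarith

theorem integrand_dens (hq : Nonlin Ω q q' a b M) :
    Integrand Ω (dens q) (fun x t => (q' x t * t - q x t) / 2) b (2 * M * b) := by
  have hM := hq.hM
  have ha := hq.ha
  have hab := hq.hab
  refine ⟨(hq.measurable_mul.div_const 2).sub hq.measurable_prim,
    ((hq.meas'.mul measurable_snd).sub hq.meas).div_const 2, hq.hasDerivAt_dens,
    fun x hx t => by simp [dens, prim, hq.off x hx],
    fun x hx t => by simp [hq.off x hx, hq.off' x hx],
    fun x t => ?_, fun x t => ?_⟩
  · have h1 := hq.le_dens x t
    have h2 := hq.prim_nonneg x t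
    have h3 := hq.nonneg x t
    have h4 : 1 / a ≤ 1 / 2 := one_div_le_one_div_of_le two_pos ha.le
    rw [abs_of_nonneg (le_trans (mul_nonneg (by linarith) h3) h1)]
    have h5 : dens q x t ≤ q x t * t := by unfold dens; linarith
    refine (h5.trans (hq.mul_le x t)).trans ?_
    have := Real.rpow_nonneg (abs_nonneg t) b
    refine mul_le_mul_of_nonneg_right ?_ (by linarith)
    nlinarith
  · rw [abs_div, abs_two]
    have h0 := abs_sub (q' x t * t) (q x t)
    have h1 := hq.abs_deriv_mul_le x t
    have h2 := hq.abs_le x t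
    have : b * |q x t| ≤ b * (2 * M * (1 + |t| ^ (b - 1))) :=
      mul_le_mul_of_nonneg_left h2 (by linarith)
    have h6 := abs_nonneg (q' x t * t - q x t)
    nlinarith

theorem exists_mul_le (hq : Nonlin Ω q q' a b M) {r : ℝ} (hr : b < r) {δ : ℝ} (hδ : 0 < δ) :
    ∃ C, 0 ≤ C ∧ ∀ x t, q x t * t ≤ δ * t ^ 2 + C * |t| ^ r := by
  have hM := hq.hM
  have hd : 0 < δ / (2 * M) := by positivity
  obtain ⟨C1, hC1, h1⟩ := exists_rpow_le_sq_add_rpow hq.ha (hq.hab.trans_lt hr) hd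
  obtain ⟨C2, hC2, h2⟩ := exists_rpow_le_sq_add_rpow (hq.ha.trans_le hq.hab) hr hd
  refine ⟨M * (C1 + C2), by positivity, fun x t => (hq.abs_mul_le x t).trans ?_⟩
  have h3 := h1 |t| (abs_nonneg t)
  have h4 := h2 |t| (abs_nonneg t)
  rw [sq_abs] at h3 h4
  calc M * (|t| ^ a + |t| ^ b) ≤ M * ((δ / (2 * M) * t ^ 2 + C1 * |t| ^ r)
        + (δ / (2 * M) * t ^ 2 + C2 * |t| ^ r)) := by gcongr
    _ = _ := by field_simp; ring

end Nonlin

end integrands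

section integrandLemmas

variable {N : ℕ} {Ω : Set (Euc N)} {G G' : Euc N → ℝ → ℝ} {b C r : ℝ}

theorem rpow_le_one_add_rpow {t b r : ℝ} (ht : 0 ≤ t) (hb : 0 ≤ b) (hbr : b ≤ r) :
    t ^ b ≤ 1 + t ^ r := by
  rcases le_total t 1 with h1 | h1
  · have := Real.rpow_le_one ht h1 hb
    have := Real.rpow_nonneg ht r
    linarith
  · have := Real.rpow_le_rpow_of_exponent_le h1 hbr
    linarith

theorem add_rpow_le_two_rpow {s t r : ℝ} (hs : 0 ≤ s) (ht : 0 ≤ t) (hr : 0 ≤ r) :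
    (s + t) ^ r ≤ 2 ^ r * (s ^ r + t ^ r) := by
  have h1 : s + t ≤ 2 * max s t := by
    have := le_max_left s t
    have := le_max_right s t
    linarith
  have h2 : (max s t) ^ r ≤ s ^ r + t ^ r := by
    rcases le_total s t with h | h
    · rw [max_eq_right h]; have := Real.rpow_nonneg hs r; linarith
    · rw [max_eq_left h]; have := Real.rpow_nonneg ht r; linarith
  calc (s + t) ^ r ≤ (2 * max s t) ^ r := Real.rpow_le_rpow (by positivity) h1 hr
    _ = 2 ^ r * (max s t) ^ r := Real.mul_rpow (by norm_num) (hs.trans (le_max_left _ _))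
    _ ≤ _ := by gcongr

theorem integrable_abs_rpow {v : Euc N → ℝ} (hv : AEMeasurable v)
    (h : ∫⁻ x, ENNReal.ofReal (|v x| ^ r) ≠ ⊤) : Integrable fun x => |v x| ^ r := by
  refine ⟨(hv.abs.pow_const r).aestronglyMeasurable, ?_⟩
  rw [hasFiniteIntegral_iff_ofReal
    (Eventually.of_forall fun x => Real.rpow_nonneg (abs_nonneg _) _)]
  exact lt_top_iff_ne_top.2 h

namespace Integrand

theorem aemeasurable_comp (hG : Integrand Ω G G' b C) {v : Euc N → ℝ} (hv : AEMeasurable v) :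
    AEMeasurable fun x => G x (v x) :=
  hG.meas.comp_aemeasurable (aemeasurable_id.prodMk hv)

theorem aemeasurable_comp' (hG : Integrand Ω G G' b C) {v : Euc N → ℝ} (hv : AEMeasurable v) :
    AEMeasurable fun x => G' x (v x) :=
  hG.meas'.comp_aemeasurable (aemeasurable_id.prodMk hv)

theorem const_nonneg (hG : Integrand Ω G G' b C) : 0 ≤ C := by
  have := (abs_nonneg _).trans (hG.bd 0 1)
  norm_num at this
  linarith

theorem abs_le_indicator (hG : Integrand Ω G G' b C) (x : Euc N) (t : ℝ) :
    |G x t| ≤ Ω.indicator (fun _ => C * (1 + |t| ^ b)) x := by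
  by_cases hx : x ∈ Ω
  · rw [indicator_of_mem hx]; exact hG.bd x t
  · rw [indicator_of_notMem hx, hG.off x hx, abs_zero]

theorem integrable (hG : Integrand Ω G G' b C) (hΩ : MeasurableSet Ω) (hfin : volume Ω ≠ ⊤)
    (hb : 0 ≤ b) (hbr : b ≤ r) {v : Euc N → ℝ} (hv : AEMeasurable v)
    (hr : ∫⁻ x, ENNReal.ofReal (|v x| ^ r) ≠ ⊤) : Integrable fun x => G x (v x) := by
  have h1 : Integrable (Ω.indicator fun x => C * (2 + |v x| ^ r)) := by
    rw [integrable_indicator_iff hΩ]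
    refine Integrable.const_mul ?_ C
    exact (integrableOn_const hfin).add (integrable_abs_rpow hv hr).integrableOn
  refine h1.mono' (hG.aemeasurable_comp hv).aestronglyMeasurable (Eventually.of_forall fun x => ?_)
  rw [Real.norm_eq_abs]
  refine (hG.abs_le_indicator x (v x)).trans ?_
  refine indicator_le_indicator ?_
  have := rpow_le_one_add_rpow (abs_nonneg (v x)) hb hbr
  refine mul_le_mul_of_nonneg_left (by linarith) hG.const_nonneg

theorem tendsto_integral (hG : Integrand Ω G G' b C) (hΩ : MeasurableSet Ω)
    (hfin : volume Ω ≠ ⊤) (hb : 0 ≤ b) (hbr : b < r) {v : ℕ → Euc N → ℝ} {w : Euc N → ℝ}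
    (hv : ∀ n, AEMeasurable (v n)) (hw : AEMeasurable w) {K : ℝ≥0∞} (hK : K ≠ ⊤)
    (hvK : ∀ n, ∫⁻ x, ENNReal.ofReal (|v n x| ^ r) ≤ K)
    (hwK : ∫⁻ x, ENNReal.ofReal (|w x| ^ r) ≤ K)
    (hlim : ∀ᵐ x, Tendsto (fun n => v n x) atTop (𝓝 (w x))) :
    Tendsto (fun n => ∫ x, G x (v n x)) atTop (𝓝 (∫ x, G x (w x))) := by
  have hC := hG.const_nonneg
  have hmD : ∀ n, AEMeasurable fun x => |G x (v n x) - G x (w x)| := fun n =>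
    ((hG.aemeasurable_comp (hv n)).sub (hG.aemeasurable_comp hw)).abs
  have hmS : ∀ n, AEMeasurable fun x => |v n x| ^ r + |w x| ^ r := fun n =>
    ((hv n).abs.pow_const r).add (hw.abs.pow_const r)
  have hmS' : ∀ (n : ℕ) (δ : ℝ), AEMeasurable fun x => ENNReal.ofReal
      (|G x (v n x) - G x (w x)| - δ * (|v n x| ^ r + |w x| ^ r)) := fun n δ =>
    ((hmD n).sub ((hmS n).const_mul δ)).ennreal_ofReal
  have hmV : ∀ n, AEMeasurable fun x => ENNReal.ofReal (|v n x| ^ r) := fun n =>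
    ((hv n).abs.pow_const r).ennreal_ofReal
  have key : ∀ δ : ℝ, 0 < δ → Tendsto (fun n => ∫⁻ x, ENNReal.ofReal
      (|G x (v n x) - G x (w x)| - δ * (|v n x| ^ r + |w x| ^ r))) atTop (𝓝 0) := by
    intro δ hδ
    obtain ⟨B, hB0, hB⟩ := exists_rpow_le_mul_rpow_add hb hbr
      (show 0 < δ / (C + 1) by positivity)
    have h0 : ∀ t : ℝ, C * |t| ^ b ≤ δ * |t| ^ r + C * B := by
      intro t
      have h1 := mul_le_mul_of_nonneg_left (hB |t| (abs_nonneg t)) hC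
      have h2 : C * (δ / (C + 1) * |t| ^ r) ≤ δ * |t| ^ r := by
        rw [← mul_assoc]
        refine mul_le_mul_of_nonneg_right ?_ (Real.rpow_nonneg (abs_nonneg t) r)
        rw [← mul_div_assoc, div_le_iff₀ (by linarith)]
        nlinarith
      linarith
    have := tendsto_lintegral_of_dominated_convergence' (μ := volume)
      (F := fun n x => ENNReal.ofReal
        (|G x (v n x) - G x (w x)| - δ * (|v n x| ^ r + |w x| ^ r)))
      (f := fun _ => 0) (Ω.indicator fun _ => ENNReal.ofReal (2 * C + 2 * (C * B)))
      (fun n => hmS' n δ) ?_ ?_ ?_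
    · simpa using this
    · intro n
      refine Eventually.of_forall fun x => ?_
      by_cases hx : x ∈ Ω
      · simp only [indicator_of_mem hx]
        refine ENNReal.ofReal_le_ofReal ?_
        have h1 := abs_sub (G x (v n x)) (G x (w x))
        have h2 := hG.bd x (v n x)
        have h3 := hG.bd x (w x)
        have h4 := h0 (v n x)
        have h5 := h0 (w x)
        linarith
      · simp only [indicator_of_notMem hx]
        rw [hG.off x hx, hG.off x hx, sub_zero, abs_zero, zero_sub]
        refine (ENNReal.ofReal_of_nonpos ?_).le
        have := Real.rpow_nonneg (abs_nonneg (v n x)) r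
        have := Real.rpow_nonneg (abs_nonneg (w x)) r
        have : 0 ≤ δ * (|v n x| ^ r + |w x| ^ r) := by positivity
        linarith
    · rw [lintegral_indicator hΩ, lintegral_const, Measure.restrict_apply_univ]
      exact ENNReal.mul_ne_top ENNReal.ofReal_ne_top hfin
    · filter_upwards [hlim] with x hx
      have h1 : Tendsto (fun n => |G x (v n x) - G x (w x)|) atTop (𝓝 0) := by
        have := (((hG.der x (w x)).continuousAt.tendsto.comp hx).sub_const (G x (w x))).abs
        simpa using this
      refine tendsto_of_tendsto_of_tendsto_of_le_of_le tendsto_const_nhds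
        (h := fun n => ENNReal.ofReal |G x (v n x) - G x (w x)|) ?_
        (fun n => zero_le) (fun n => ENNReal.ofReal_le_ofReal ?_)
      · have h2 := (ENNReal.continuous_ofReal.tendsto 0).comp h1
        rw [ENNReal.ofReal_zero] at h2
        exact h2
      · have := Real.rpow_nonneg (abs_nonneg (v n x)) r
        have := Real.rpow_nonneg (abs_nonneg (w x)) r
        have : 0 ≤ δ * (|v n x| ^ r + |w x| ^ r) := by positivity
        linarith
  have hbound : ∀ δ : ℝ, 0 < δ → ∀ n, ∫⁻ x, ENNReal.ofReal |G x (v n x) - G x (w x)| ≤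
      (∫⁻ x, ENNReal.ofReal (|G x (v n x) - G x (w x)| - δ * (|v n x| ^ r + |w x| ^ r)))
        + ENNReal.ofReal δ * (K + K) := by
    intro δ hδ n
    calc ∫⁻ x, ENNReal.ofReal |G x (v n x) - G x (w x)|
        ≤ ∫⁻ x, (ENNReal.ofReal (|G x (v n x) - G x (w x)| - δ * (|v n x| ^ r + |w x| ^ r))
          + ENNReal.ofReal δ * (ENNReal.ofReal (|v n x| ^ r) + ENNReal.ofReal (|w x| ^ r))) := by
          refine lintegral_mono fun x => ?_
          have h1 := Real.rpow_nonneg (abs_nonneg (v n x)) r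
          have h2 := Real.rpow_nonneg (abs_nonneg (w x)) r
          rw [← ENNReal.ofReal_add h1 h2, ← ENNReal.ofReal_mul hδ.le]
          refine le_trans (ENNReal.ofReal_le_ofReal ?_) ENNReal.ofReal_add_le
          linarith
      _ = (∫⁻ x, ENNReal.ofReal (|G x (v n x) - G x (w x)| - δ * (|v n x| ^ r + |w x| ^ r)))
          + ENNReal.ofReal δ * ((∫⁻ x, ENNReal.ofReal (|v n x| ^ r))
            + ∫⁻ x, ENNReal.ofReal (|w x| ^ r)) := by
          rw [lintegral_add_left' (hmS' n δ),
            lintegral_const_mul' _ _ ENNReal.ofReal_ne_top,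
            lintegral_add_left' (hmV n)]
      _ ≤ _ := by
          gcongr
          exact hvK n
  have hI : ∀ n, Integrable fun x => G x (v n x) := fun n =>
    hG.integrable hΩ hfin hb hbr.le (hv n) (ne_top_of_le_ne_top hK (hvK n))
  have hIw : Integrable fun x => G x (w x) :=
    hG.integrable hΩ hfin hb hbr.le hw (ne_top_of_le_ne_top hK hwK)
  refine tendsto_integral_of_L1 _ hIw.1 (Eventually.of_forall hI) ?_
  have hn : ∀ n x, ‖G x (v n x) - G x (w x)‖ₑ = ENNReal.ofReal |G x (v n x) - G x (w x)| :=
    fun n x => Real.enorm_eq_ofReal_abs _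
  simp only [hn]
  rw [ENNReal.tendsto_atTop_zero]
  intro ε hε
  obtain ⟨δ, hδ, hδε⟩ : ∃ δ : ℝ, 0 < δ ∧ ENNReal.ofReal δ * (K + K) ≤ ε / 2 := by
    have h2K : K + K ≠ ⊤ := ENNReal.add_ne_top.2 ⟨hK, hK⟩
    have h1 : Tendsto (fun δ : ℝ => ENNReal.ofReal δ * (K + K)) (𝓝[>] 0) (𝓝 0) := by
      have : Tendsto (fun δ : ℝ => ENNReal.ofReal δ) (𝓝[>] 0) (𝓝 0) := by
        simpa using (ENNReal.continuous_ofReal.tendsto 0).mono_left nhdsWithin_le_nhds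
      simpa using ENNReal.Tendsto.mul_const this (Or.inr h2K)
    have h3 := h1.eventually (Iic_mem_nhds (ENNReal.half_pos hε.ne'))
    obtain ⟨δ, h4, h5⟩ := (h3.and self_mem_nhdsWithin).exists
    exact ⟨δ, h5, h4⟩
  obtain ⟨n₀, hn₀⟩ := ENNReal.tendsto_atTop_zero.1 (key δ hδ) (ε / 2) (ENNReal.half_pos hε.ne')
  refine ⟨n₀, fun n hn => (hbound δ hδ n).trans ?_⟩
  calc _ ≤ ε / 2 + ε / 2 := add_le_add (hn₀ n hn) hδε
    _ = ε := ENNReal.add_halves ε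

theorem hasDerivAt_integral (hG : Integrand Ω G G' b C) (hΩ : MeasurableSet Ω)
    (hfin : volume Ω ≠ ⊤) (hb : 1 ≤ b) (hbr : b ≤ r) {v ψ : Euc N → ℝ}
    (hv : AEMeasurable v) (hψ : AEMeasurable ψ)
    (hvr : ∫⁻ x, ENNReal.ofReal (|v x| ^ r) ≠ ⊤) (hψr : ∫⁻ x, ENNReal.ofReal (|ψ x| ^ r) ≠ ⊤) :
    Integrable (fun x => G' x (v x) * ψ x) ∧
    HasDerivAt (fun s : ℝ => ∫ x, G x (v x + s * ψ x)) (∫ x, G' x (v x) * ψ x) 0 := by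
  have hC := hG.const_nonneg
  set B : Euc N → ℝ := Ω.indicator fun x => 2 * C * (1 + 2 ^ r * (|v x| ^ r + |ψ x| ^ r)) with hB
  have hBi : Integrable B := by
    rw [hB, integrable_indicator_iff hΩ]
    refine Integrable.const_mul ?_ _
    refine Integrable.add (integrableOn_const hfin) (Integrable.const_mul ?_ _)
    exact (integrable_abs_rpow hv hvr).integrableOn.add (integrable_abs_rpow hψ hψr).integrableOn
  have hbd : ∀ x, ∀ s ∈ Metric.ball (0 : ℝ) 1, ‖G' x (v x + s * ψ x) * ψ x‖ ≤ B x := by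
    intro x s hs
    rw [mem_ball_zero_iff, Real.norm_eq_abs] at hs
    rw [norm_mul, Real.norm_eq_abs, Real.norm_eq_abs]
    by_cases hx : x ∈ Ω
    · rw [hB, indicator_of_mem hx]
      set w := |v x| + |ψ x| with hw
      have hw0 : 0 ≤ w := by positivity
      have h1 : |v x + s * ψ x| ≤ w := by
        refine (abs_add_le _ _).trans ?_
        rw [abs_mul]
        have := mul_le_mul_of_nonneg_right hs.le (abs_nonneg (ψ x))
        linarith
      have h2 : |G' x (v x + s * ψ x)| ≤ C * (1 + w ^ (b - 1)) := by
        refine (hG.bd' x _).trans ?_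
        have := Real.rpow_le_rpow (abs_nonneg _) h1 (by linarith : 0 ≤ b - 1)
        gcongr
      have h3 : |ψ x| ≤ w := by have := abs_nonneg (v x); linarith
      have h4 : w ^ (b - 1) * w = w ^ b := by
        rcases hw0.eq_or_lt with h | h
        · rw [← h, Real.zero_rpow (by linarith : b ≠ 0)]; simp
        · rw [← Real.rpow_add_one h.ne', sub_add_cancel]
      have h5 : w ^ b ≤ 1 + w ^ r := rpow_le_one_add_rpow hw0 (by linarith) hbr
      have h6 : w ≤ 1 + w ^ r := by
        have := rpow_le_one_add_rpow hw0 zero_le_one (hb.trans hbr)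
        rwa [Real.rpow_one] at this
      have h7 := add_rpow_le_two_rpow (abs_nonneg (v x)) (abs_nonneg (ψ x))
        (by linarith : 0 ≤ r)
      have h8 := Real.rpow_nonneg hw0 (b - 1)
      calc |G' x (v x + s * ψ x)| * |ψ x| ≤ C * (1 + w ^ (b - 1)) * w := by gcongr
        _ = C * (w + w ^ (b - 1) * w) := by ring
        _ ≤ C * ((1 + w ^ r) + (1 + w ^ r)) := by rw [h4]; gcongr
        _ = 2 * C * (1 + w ^ r) := by ring
        _ ≤ _ := by gcongr
    · rw [hB, indicator_of_notMem hx, hG.off' x hx, abs_zero, zero_mul]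
  have := hasDerivAt_integral_of_dominated_loc_of_deriv_le (μ := volume)
    (F := fun s x => G x (v x + s * ψ x)) (F' := fun s x => G' x (v x + s * ψ x) * ψ x)
    (x₀ := (0 : ℝ)) (s := Metric.ball 0 1) (bound := B) (Metric.ball_mem_nhds 0 one_pos)
    (Eventually.of_forall fun s =>
      (hG.aemeasurable_comp (hv.add (hψ.const_mul s))).aestronglyMeasurable)
    (by simpa using hG.integrable hΩ hfin (by linarith) hbr hv hvr)
    (by
      have h1 : AEMeasurable fun x => G' x (v x) * ψ x := (hG.aemeasurable_comp' hv).mul hψ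
      simpa using h1.aestronglyMeasurable)
    (Eventually.of_forall hbd) hBi
    (Eventually.of_forall fun x s _ => by
      have h1 : HasDerivAt (fun s : ℝ => v x + s * ψ x) (ψ x) s := by
        simpa using ((hasDerivAt_id s).mul_const (ψ x)).const_add (v x)
      exact (hG.der x (v x + s * ψ x)).comp s h1)
  simpa using this

end Integrand

end integrandLemmas

section energySpace

variable {N : ℕ}

/-- The gradient, in coordinates. -/
def gr (φ : Euc N → ℝ) (x : Euc N) : Euc N := WithLp.toLp 2 fun i => pd i φ x

theorem inner_gr (φ : Euc N → ℝ) (x v : Euc N) : inner ℝ (gr φ x) v = ∑ i, pd i φ x * v i := by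
  simp [gr, PiLp.inner_apply, mul_comm]

theorem gr_eq (φ : Euc N → ℝ) (x : Euc N) :
    gr φ x = (InnerProductSpace.toDual ℝ (Euc N)).symm (fderiv ℝ φ x) := by
  refine ext_inner_right ℝ fun v => ?_
  rw [InnerProductSpace.toDual_symm_apply, inner_gr, fderiv_eq_sum_pd]
  simp only [mul_comm]

theorem norm_gr (φ : Euc N → ℝ) (x : Euc N) : ‖gr φ x‖ = ‖fderiv ℝ φ x‖ := by
  rw [gr_eq, LinearIsometryEquiv.norm_map]

theorem continuous_gr {φ : Euc N → ℝ} (hφ : ContDiff ℝ 1 φ) : Continuous (gr φ) := by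
  have : gr φ = fun x => (InnerProductSpace.toDual ℝ (Euc N)).symm (fderiv ℝ φ x) :=
    funext (gr_eq φ)
  rw [this]
  exact (LinearIsometryEquiv.continuous _).comp (hφ.continuous_fderiv (by simp))

/-- Pairs of a function and a vector field. -/
abbrev Pt (N : ℕ) := WithLp 2 (ℝ × Euc N)

/-- Square integrable pairs of a function and a vector field. -/
abbrev Z (N : ℕ) := Lp (Pt N) 2 (volume : Measure (Euc N))

/-- The function component. -/
def vz : Z N →L[ℝ] Lp ℝ 2 (volume : Measure (Euc N)) :=
  (WithLp.fstL 2 ℝ ℝ (Euc N)).compLpL 2 volume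

/-- The vector field component. -/
def gz : Z N →L[ℝ] Lp (Euc N) 2 (volume : Measure (Euc N)) :=
  (WithLp.sndL 2 ℝ ℝ (Euc N)).compLpL 2 volume

theorem coe_vz (z : Z N) : vz z =ᵐ[volume] fun x => (z x).fst :=
  ContinuousLinearMap.coeFn_compLpL _ _

theorem coe_gz (z : Z N) : gz z =ᵐ[volume] fun x => (z x).snd :=
  ContinuousLinearMap.coeFn_compLpL _ _

theorem inner_Z (z w : Z N) :
    inner ℝ z w = inner ℝ (vz z) (vz w) + inner ℝ (gz z) (gz w) := by
  rw [L2.inner_def, L2.inner_def, L2.inner_def, ← integral_add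
    (L2.integrable_inner (𝕜 := ℝ) (vz z) (vz w)) (L2.integrable_inner (𝕜 := ℝ) (gz z) (gz w))]
  refine integral_congr_ae ?_
  filter_upwards [coe_vz z, coe_vz w, coe_gz z, coe_gz w] with x h1 h2 h3 h4
  rw [h1, h2, h3, h4, WithLp.prod_inner_apply]
  rfl

theorem norm_sq_Z (z : Z N) : ‖z‖ ^ 2 = ‖vz z‖ ^ 2 + ‖gz z‖ ^ 2 := by
  have := inner_Z z z
  simpa only [real_inner_self_eq_norm_sq] using this

theorem norm_vz_le (z : Z N) : ‖vz z‖ ≤ ‖z‖ := by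
  refine abs_le_of_sq_le_sq' ?_ (norm_nonneg z) |>.2
  rw [norm_sq_Z z]
  nlinarith [sq_nonneg ‖gz z‖]

theorem norm_gz_le (z : Z N) : ‖gz z‖ ≤ ‖z‖ := by
  refine abs_le_of_sq_le_sq' ?_ (norm_nonneg z) |>.2
  rw [norm_sq_Z z]
  nlinarith [sq_nonneg ‖vz z‖]

/-- Smooth functions with compact support in `Ω`. -/
structure IsTest (Ω : Set (Euc N)) (φ : Euc N → ℝ) : Prop where
  smooth : ContDiff ℝ ∞ φ
  compact : HasCompactSupport φ
  supp : tsupport φ ⊆ Ω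

/-- The pair of a function and its gradient. -/
def pairFn (φ : Euc N → ℝ) (x : Euc N) : Pt N := WithLp.toLp 2 (φ x, gr φ x)

theorem memLp_pairFn {Ω : Set (Euc N)} {φ : Euc N → ℝ} (h : IsTest Ω φ) :
    MemLp (pairFn φ) 2 volume := by
  refine Continuous.memLp_of_hasCompactSupport ?_ ?_
  · exact (WithLp.prod_continuous_toLp 2 ℝ (Euc N)).comp
      (h.smooth.continuous.prodMk (continuous_gr (h.smooth.of_le (by simp))))
  · refine HasCompactSupport.intro' (K := tsupport φ) h.compact (isClosed_tsupport φ) fun x hx => ?_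
    have h1 : φ x = 0 := image_eq_zero_of_notMem_tsupport hx
    have h2 : gr φ x = 0 := norm_eq_zero.1 (by
      rw [norm_gr, norm_eq_zero]
      exact image_eq_zero_of_notMem_tsupport fun h => hx (tsupport_fderiv_subset ℝ h))
    simp only [pairFn, h1, h2]
    rfl

/-- A test function as an element of the energy space. -/
def embZ {Ω : Set (Euc N)} {φ : Euc N → ℝ} (h : IsTest Ω φ) : Z N := (memLp_pairFn h).toLp

theorem coe_embZ {Ω : Set (Euc N)} {φ : Euc N → ℝ} (h : IsTest Ω φ) :
    embZ h =ᵐ[volume] pairFn φ := (memLp_pairFn h).coeFn_toLp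

theorem vz_embZ {Ω : Set (Euc N)} {φ : Euc N → ℝ} (h : IsTest Ω φ) : vz (embZ h) =ᵐ[volume] φ := by
  filter_upwards [coe_vz (embZ h), (memLp_pairFn h).coeFn_toLp] with x h1 h2
  rw [h1, embZ, h2]; rfl

theorem gz_embZ {Ω : Set (Euc N)} {φ : Euc N → ℝ} (h : IsTest Ω φ) :
    gz (embZ h) =ᵐ[volume] gr φ := by
  filter_upwards [coe_gz (embZ h), (memLp_pairFn h).coeFn_toLp] with x h1 h2
  rw [h1, embZ, h2]; rfl

theorem pd_add {φ ψ : Euc N → ℝ} (hφ : Differentiable ℝ φ) (hψ : Differentiable ℝ ψ) (i : Fin N)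
    (x : Euc N) : pd i (φ + ψ) x = pd i φ x + pd i ψ x := by
  unfold pd
  rw [fderiv_add (hφ x) (hψ x)]; rfl

theorem pd_smul {φ : Euc N → ℝ} (hφ : Differentiable ℝ φ) (c : ℝ) (i : Fin N)
    (x : Euc N) : pd i (c • φ) x = c * pd i φ x := by
  unfold pd
  rw [fderiv_const_smul (hφ x)]; rfl

/-- Test functions in `Ω` form a subspace of the energy space. -/
def tests (Ω : Set (Euc N)) : Submodule ℝ (Z N) where
  carrier := {z | ∃ φ, ∃ h : IsTest Ω φ, z = embZ h}
  zero_mem' := by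
    have h0 : IsTest Ω (0 : Euc N → ℝ) := ⟨contDiff_const, HasCompactSupport.zero, by simp⟩
    refine ⟨0, h0, ?_⟩
    rw [embZ, eq_comm, Lp.eq_zero_iff_ae_eq_zero]
    filter_upwards [(memLp_pairFn h0).coeFn_toLp] with x hx
    rw [hx]
    have : gr (0 : Euc N → ℝ) x = 0 := by
      rw [gr_eq]
      have : fderiv ℝ (0 : Euc N → ℝ) x = 0 := fderiv_const_apply 0
      rw [this, map_zero]
    simp only [pairFn, this]
    rfl
  add_mem' := by
    rintro _ _ ⟨φ, h, rfl⟩ ⟨ψ, h', rfl⟩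
    have h2 : IsTest Ω (φ + ψ) := ⟨h.smooth.add h'.smooth, h.compact.add h'.compact,
      (tsupport_add φ ψ).trans (union_subset h.supp h'.supp)⟩
    refine ⟨φ + ψ, h2, Lp.ext ?_⟩
    filter_upwards [Lp.coeFn_add (embZ h) (embZ h'), coe_embZ h,
      coe_embZ h', coe_embZ h2] with x h3 h4 h5 h6
    rw [h3, h6, Pi.add_apply, h4, h5]
    have : gr (φ + ψ) x = gr φ x + gr ψ x := by
      ext i
      exact pd_add (h.smooth.differentiable (by simp)) (h'.smooth.differentiable (by simp)) i x
    simp only [pairFn, this, Pi.add_apply]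
    rfl
  smul_mem' := by
    rintro c _ ⟨φ, h, rfl⟩
    have h2 : IsTest Ω (c • φ) := ⟨h.smooth.const_smul c, h.compact.smul_left (f := fun _ => c),
      (closure_mono (Function.support_const_smul_subset c φ)).trans h.supp⟩
    refine ⟨c • φ, h2, Lp.ext ?_⟩
    filter_upwards [Lp.coeFn_smul c (embZ h), coe_embZ h,
      coe_embZ h2] with x h3 h4 h6
    rw [h3, h6, Pi.smul_apply, h4]
    have : gr (c • φ) x = c • gr φ x := by
      ext i
      exact pd_smul (h.smooth.differentiable (by simp)) c i x
    simp only [pairFn, this, Pi.smul_apply]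
    rfl

/-- The closure of the test functions in the energy space. -/
def H0 (Ω : Set (Euc N)) : Submodule ℝ (Z N) := (tests Ω).topologicalClosure

theorem embZ_mem {Ω : Set (Euc N)} {φ : Euc N → ℝ} (h : IsTest Ω φ) : embZ h ∈ H0 Ω :=
  (tests Ω).le_topologicalClosure ⟨φ, h, rfl⟩

theorem isClosed_H0 (Ω : Set (Euc N)) : IsClosed (H0 Ω : Set (Z N)) :=
  (tests Ω).isClosed_topologicalClosure

theorem exists_subseq_ae {E : Type*} [NormedAddCommGroup E] {f : ℕ → Lp E 2 (volume : Measure (Euc N))}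
    {g : Lp E 2 (volume : Measure (Euc N))} (h : Tendsto f atTop (𝓝 g)) :
    ∃ ns : ℕ → ℕ, StrictMono ns ∧ ∀ᵐ x, Tendsto (fun i => f (ns i) x) atTop (𝓝 (g x)) :=
  (tendstoInMeasure_of_tendsto_Lp h).exists_seq_tendsto_ae

theorem exists_seq_test {Ω : Set (Euc N)} {z : Z N} (hz : z ∈ H0 Ω) :
    ∃ (φ : ℕ → Euc N → ℝ) (h : ∀ n, IsTest Ω (φ n)),
      Tendsto (fun n => embZ (h n)) atTop (𝓝 z) ∧
      ∀ᵐ x, Tendsto (fun n => φ n x) atTop (𝓝 (vz z x)) := by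
  obtain ⟨w, hw, hlim⟩ := mem_closure_iff_seq_limit.1 hz
  choose φ h hφ using hw
  obtain rfl : w = fun n => embZ (h n) := funext hφ
  obtain ⟨ns, hns, hae⟩ := exists_subseq_ae ((vz.continuous.tendsto z).comp hlim)
  refine ⟨fun n => φ (ns n), fun n => h (ns n), hlim.comp hns.tendsto_atTop, ?_⟩
  filter_upwards [hae, ae_all_iff.2 fun n => vz_embZ (h n)] with x hx h2
  refine hx.congr fun n => ?_
  exact h2 (ns n)

theorem vz_eq_zero_off {Ω : Set (Euc N)} {z : Z N} (hz : z ∈ H0 Ω) :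
    ∀ᵐ x, x ∉ Ω → vz z x = 0 := by
  obtain ⟨φ, h, -, hae⟩ := exists_seq_test hz
  filter_upwards [hae] with x hx hxΩ
  refine tendsto_nhds_unique hx ?_
  have : (fun n => φ n x) = fun _ => 0 :=
    funext fun n => image_eq_zero_of_notMem_tsupport fun h' => hxΩ ((h n).supp h')
  rw [this]
  exact tendsto_const_nhds

theorem H0_induction {Ω : Set (Euc N)} {p : Z N → Prop} (hp : IsClosed {z | p z})
    (h : ∀ φ, ∀ hφ : IsTest Ω φ, p (embZ hφ)) {z : Z N} (hz : z ∈ H0 Ω) : p z := by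
  refine closure_minimal (s := (tests Ω : Set (Z N))) ?_ hp hz
  rintro _ ⟨φ, hφ, rfl⟩
  exact h φ hφ

theorem norm_vz_embZ_sq {Ω : Set (Euc N)} {φ : Euc N → ℝ} (h : IsTest Ω φ) :
    ‖vz (embZ h)‖ ^ 2 = ∫ x, (φ x) ^ 2 := by
  rw [← real_inner_self_eq_norm_sq, L2.inner_def]
  refine integral_congr_ae ?_
  filter_upwards [vz_embZ h] with x hx
  rw [hx, real_inner_self_eq_norm_sq, Real.norm_eq_abs, sq_abs]

theorem norm_gz_embZ_sq {Ω : Set (Euc N)} {φ : Euc N → ℝ} (h : IsTest Ω φ) :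
    ‖gz (embZ h)‖ ^ 2 = ∫ x, ‖fderiv ℝ φ x‖ ^ 2 := by
  rw [← real_inner_self_eq_norm_sq, L2.inner_def]
  refine integral_congr_ae ?_
  filter_upwards [gz_embZ h] with x hx
  rw [hx, real_inner_self_eq_norm_sq, norm_gr]

theorem firstEig_nonneg (Ω : Set (Euc N)) : 0 ≤ firstEig Ω := by
  refine Real.sInf_nonneg ?_
  rintro r ⟨φ, -, -, -, -, rfl⟩
  exact div_nonneg (integral_nonneg fun x => sq_nonneg _) (integral_nonneg fun x => sq_nonneg _)

theorem firstEig_mul_le {Ω : Set (Euc N)} {z : Z N} (hz : z ∈ H0 Ω) :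
    firstEig Ω * ‖vz z‖ ^ 2 ≤ ‖gz z‖ ^ 2 := by
  refine H0_induction (p := fun z => firstEig Ω * ‖vz z‖ ^ 2 ≤ ‖gz z‖ ^ 2)
    (isClosed_le (by fun_prop) (by fun_prop)) (fun φ hφ => ?_) hz
  rcases eq_or_ne (∫ x, (φ x) ^ 2) 0 with h0 | h0
  · rw [norm_vz_embZ_sq, h0, mul_zero]; positivity
  · have hpos : 0 < ∫ x, (φ x) ^ 2 :=
      lt_of_le_of_ne (integral_nonneg fun x => sq_nonneg _) (Ne.symm h0)
    rw [norm_vz_embZ_sq, norm_gz_embZ_sq, ← le_div_iff₀ hpos]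
    refine csInf_le ⟨0, ?_⟩ ⟨φ, hφ.smooth, hφ.compact, hφ.supp, ?_, rfl⟩
    · rintro r ⟨φ, -, -, -, -, rfl⟩
      exact div_nonneg (integral_nonneg fun x => sq_nonneg _) (integral_nonneg fun x => sq_nonneg _)
    · rintro rfl
      simp at h0

/-- The quadratic form of `-Δ + lam`. -/
def en (lam : ℝ) (z w : Z N) : ℝ := inner ℝ (gz z) (gz w) + lam * inner ℝ (vz z) (vz w)

theorem en_self (lam : ℝ) (z : Z N) : en lam z z = ‖gz z‖ ^ 2 + lam * ‖vz z‖ ^ 2 := by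
  rw [en, real_inner_self_eq_norm_sq, real_inner_self_eq_norm_sq]

theorem en_eq (lam : ℝ) (z w : Z N) :
    en lam z w = inner ℝ z w + (lam - 1) * inner ℝ (vz z) (vz w) := by
  rw [en, inner_Z]; ring

theorem exists_coercive {Ω : Set (Euc N)} {lam : ℝ} (h : -firstEig Ω < lam) :
    ∃ κ δ : ℝ, 0 < κ ∧ 0 < δ ∧ ∀ mu, |mu - lam| < δ → ∀ z ∈ H0 Ω, κ * ‖z‖ ^ 2 ≤ en mu z z := by
  have h0 := firstEig_nonneg Ω
  set g := firstEig Ω + lam with hg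
  have hg0 : 0 < g := by linarith
  have h1 : 0 < 1 + firstEig Ω := by linarith
  refine ⟨min 1 (g / 2 / (1 + firstEig Ω)), g / 2, lt_min one_pos (by positivity), by positivity,
    fun mu hmu z hz => ?_⟩
  set κ := min 1 (g / 2 / (1 + firstEig Ω)) with hκ
  have h2 := firstEig_mul_le hz
  have h3 : κ ≤ 1 := min_le_left _ _
  have h4 : κ * (1 + firstEig Ω) ≤ g / 2 := by
    rw [← le_div_iff₀ h1]; exact min_le_right _ _
  have h5 := (abs_lt.1 hmu).1
  rw [en_self, norm_sq_Z]
  have h6 := mul_le_mul_of_nonneg_left h2 (sub_nonneg.2 h3)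
  have h7 := sq_nonneg ‖vz z‖
  nlinarith

end energySpace

section sobolev

variable {N : ℕ}

theorem eLpNorm_fderiv_le {Ω : Set (Euc N)} {φ : Euc N → ℝ} (h : IsTest Ω φ) :
    eLpNorm (fderiv ℝ φ) 2 volume ≤ ‖embZ h‖ₑ := by
  have h1 : eLpNorm (fderiv ℝ φ) 2 volume = ‖gz (embZ h)‖ₑ := by
    rw [Lp.enorm_def]
    refine eLpNorm_congr_norm_ae ?_
    filter_upwards [gz_embZ h] with x hx
    rw [hx, norm_gr]
  rw [h1, ← ofReal_norm, ← ofReal_norm]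
  exact ENNReal.ofReal_le_ofReal (norm_gz_le _)

theorem eLpNorm_le_of_tests {Ω : Set (Euc N)} {r S : ℝ≥0∞} (hS : S ≠ ⊤)
    (hφ : ∀ φ, ∀ h : IsTest Ω φ, eLpNorm φ r volume ≤ S * ‖embZ h‖ₑ) {z : Z N} (hz : z ∈ H0 Ω) :
    eLpNorm (vz z) r volume ≤ S * ‖z‖ₑ := by
  obtain ⟨φ, h, hlim, hae⟩ := exists_seq_test hz
  refine (Lp.eLpNorm_lim_le_liminf_eLpNorm
    (fun n => (h n).smooth.continuous.aestronglyMeasurable) _ hae).trans ?_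
  have h1 : Tendsto (fun n => S * ‖embZ (h n)‖ₑ) atTop (𝓝 (S * ‖z‖ₑ)) :=
    ENNReal.Tendsto.const_mul hlim.enorm (Or.inr hS)
  rw [← h1.liminf_eq]
  exact liminf_le_liminf (Eventually.of_forall fun n => hφ _ (h n))

theorem exists_sobolev_test {Ω : Set (Euc N)} (hΩ : Bornology.IsBounded Ω) (hN : 2 ≤ N) {r : ℝ}
    (hr : 2 ≤ r) (hr' : 3 ≤ N → r = 2 * N / ((N : ℝ) - 2)) :
    ∃ S : ℝ≥0∞, S ≠ ⊤ ∧ ∀ φ, ∀ h : IsTest Ω φ,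
      eLpNorm φ (ENNReal.ofReal r) volume ≤ S * ‖embZ h‖ₑ := by
  have hr0 : 0 < r := by linarith
  rcases Nat.lt_or_ge 2 N with h3 | h2
  · have h3' : 3 ≤ N := h3
    have h3r : (3 : ℝ) ≤ N := by exact_mod_cast h3'
    refine ⟨eLpNormLESNormFDerivOfLeConst ℝ (volume : Measure (Euc N)) Ω 2 r.toNNReal,
      ENNReal.coe_ne_top, fun φ h => ?_⟩
    refine (eLpNorm_le_eLpNorm_fderiv_of_le (F := ℝ) (μ := volume) (p := 2) (q := r.toNNReal)
      (h.smooth.of_le (by simp)) ((subset_tsupport φ).trans h.supp) (by norm_num) ?_ ?_ hΩ).trans ?_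
    · rw [finrank_euclideanSpace_fin]; exact_mod_cast h3
    · rw [finrank_euclideanSpace_fin, Real.coe_toNNReal _ hr0.le, hr' h3']
      have : (N : ℝ) - 2 ≠ 0 := by linarith
      refine le_of_eq ?_
      push_cast
      field_simp
    · gcongr
      exact eLpNorm_fderiv_le h
  · have hN2 : N = 2 := le_antisymm h2 hN
    set p : NNReal := (2 * r / (r + 2)).toNNReal with hp
    have hpr : (p : ℝ) = 2 * r / (r + 2) := Real.coe_toNNReal _ (by positivity)
    have hp1 : 1 ≤ p := by
      rw [← NNReal.coe_le_coe, hpr, NNReal.coe_one, le_div_iff₀ (by positivity)]; linarith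
    have hp2 : p < 2 := by
      rw [← NNReal.coe_lt_coe, hpr, NNReal.coe_ofNat, div_lt_iff₀ (by positivity)]; linarith
    have hfin : volume Ω ≠ ⊤ := hΩ.measure_lt_top.ne
    refine ⟨eLpNormLESNormFDerivOfLeConst ℝ (volume : Measure (Euc N)) Ω p r.toNNReal *
      (volume Ω) ^ (1 / (p : ℝ≥0∞).toReal - 1 / (2 : ℝ≥0∞).toReal), ?_, fun φ h => ?_⟩
    · refine ENNReal.mul_ne_top ENNReal.coe_ne_top (ENNReal.rpow_ne_top_of_nonneg ?_ hfin)
      rw [ENNReal.coe_toReal, ENNReal.toReal_ofNat, sub_nonneg]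
      exact one_div_le_one_div_of_le (by positivity) (by exact_mod_cast hp2.le)
    refine (eLpNorm_le_eLpNorm_fderiv_of_le (F := ℝ) (μ := volume) (p := p) (q := r.toNNReal)
      (h.smooth.of_le (by simp)) ((subset_tsupport φ).trans h.supp) hp1 ?_ ?_ hΩ).trans ?_
    · rw [finrank_euclideanSpace_fin, hN2]; exact_mod_cast hp2
    · rw [finrank_euclideanSpace_fin, Real.coe_toNNReal _ hr0.le, hN2]
      push_cast
      rw [hpr]
      refine le_of_eq ?_
      field_simp
      ring
    · rw [mul_assoc]
      gcongr
      have hs : Function.support (fun x => ‖fderiv ℝ φ x‖) ⊆ Ω := by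
        intro x hx
        refine h.supp (tsupport_fderiv_subset ℝ (subset_tsupport _ ?_))
        intro h0
        exact hx (by simp only [h0, norm_zero])
      rw [← eLpNorm_norm, ← eLpNorm_restrict_eq_of_support_subset hs, eLpNorm_norm]
      have := eLpNorm_le_eLpNorm_mul_rpow_measure_univ (μ := volume.restrict Ω) (p := p) (q := 2)
        (f := fderiv ℝ φ) (by exact_mod_cast hp2.le)
        (((h.smooth.of_le (by simp) : ContDiff ℝ 1 φ).continuous_fderiv
          (by simp)).aestronglyMeasurable)
      refine this.trans ?_
      rw [Measure.restrict_apply_univ, mul_comm]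
      gcongr
      exact (eLpNorm_mono_measure _ Measure.restrict_le_self).trans (eLpNorm_fderiv_le h)

/-- The Sobolev inequality in the energy space, with an exponent that leaves some room. -/
theorem exists_sobolev {Ω : Set (Euc N)} (hΩ : Bornology.IsBounded Ω) (hN : 2 ≤ N) {b : ℝ}
    (hb : 2 < b) (hb' : 3 ≤ N → b < 2 * N / ((N : ℝ) - 2)) :
    ∃ r S : ℝ, b < r ∧ N < 2 * (r / (b - 2)) ∧ 0 ≤ S ∧ ∀ z ∈ H0 Ω,
      ∫⁻ x, ENNReal.ofReal (|vz z x| ^ r) ≤ ENNReal.ofReal (S * ‖z‖ ^ r) := by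
  obtain ⟨r, hbr, hrN, hr'⟩ : ∃ r : ℝ, b < r ∧ N < 2 * (r / (b - 2)) ∧
      (3 ≤ N → r = 2 * N / ((N : ℝ) - 2)) := by
    rcases Nat.lt_or_ge 2 N with h3 | h2
    · have h3r : (3 : ℝ) ≤ N := by exact_mod_cast h3
      have hb2 := hb' h3
      refine ⟨_, hb2, ?_, fun _ => rfl⟩
      have hN2 : 0 < (N : ℝ) - 2 := by linarith
      rw [lt_div_iff₀ hN2] at hb2
      rw [div_div, ← mul_div_assoc, lt_div_iff₀ (mul_pos hN2 (by linarith))]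
      nlinarith
    · have hN2 : N = 2 := le_antisymm h2 hN
      refine ⟨b + 1, by linarith, ?_, fun h => by omega⟩
      rw [hN2, ← mul_div_assoc, lt_div_iff₀ (by linarith)]
      push_cast
      linarith
  have hr0 : 0 < r := by linarith
  obtain ⟨S, hS, hSφ⟩ := exists_sobolev_test hΩ hN (by linarith : 2 ≤ r) hr'
  refine ⟨r, S.toReal ^ r, hbr, hrN, by positivity, fun z hz => ?_⟩
  have h1 := eLpNorm_le_of_tests hS hSφ hz
  rw [eLpNorm_eq_lintegral_rpow_enorm_toReal (by simpa using hr0) ENNReal.ofReal_ne_top,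
    ENNReal.toReal_ofReal hr0.le, one_div, ENNReal.rpow_inv_le_iff hr0] at h1
  have h2 : ∀ x, ENNReal.ofReal (|vz z x| ^ r) = ‖vz z x‖ₑ ^ r := fun x => by
    rw [← ofReal_norm, ENNReal.ofReal_rpow_of_nonneg (norm_nonneg _) hr0.le, Real.norm_eq_abs]
  simp only [h2]
  refine h1.trans (le_of_eq ?_)
  rw [ENNReal.mul_rpow_of_nonneg _ _ hr0.le, ENNReal.ofReal_mul (by positivity),
    ← ofReal_norm, ENNReal.ofReal_rpow_of_nonneg (norm_nonneg _) hr0.le,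
    ← ENNReal.ofReal_rpow_of_nonneg ENNReal.toReal_nonneg hr0.le, ENNReal.ofReal_toReal hS]

end sobolev

section weakCompactness

theorem exists_weak_limit {E : Type*} [NormedAddCommGroup E] [InnerProductSpace ℝ E]
    [CompleteSpace E] [TopologicalSpace.SeparableSpace E] (K : Submodule ℝ E)
    (hK : IsClosed (K : Set E)) {C : ℝ} {z : ℕ → E} (hz : ∀ n, z n ∈ K) (hC : ∀ n, ‖z n‖ ≤ C) :
    ∃ ns : ℕ → ℕ, StrictMono ns ∧ ∃ w ∈ K, ∀ y, Tendsto (fun n => inner ℝ (z (ns n)) y) atTop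
      (𝓝 (inner ℝ w y)) := by
  obtain ⟨a, -, ns, hns, hlim⟩ := WeakDual.isSeqCompact_closedBall ℝ E 0 C
    (x := fun n => StrongDual.toWeakDual (InnerProductSpace.toDual ℝ E (z n))) (fun n => by
      rw [mem_preimage, mem_closedBall_zero_iff]
      exact (LinearIsometryEquiv.norm_map (InnerProductSpace.toDual ℝ E) (z n)).trans_le (hC n))
  have hlim' : ∀ y, Tendsto (fun n => inner ℝ (z (ns n)) y) atTop (𝓝 (a y)) := fun y =>
    ((WeakDual.eval_continuous (𝕜 := ℝ) (E := E) y).tendsto a).comp hlim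
  set w := (InnerProductSpace.toDual ℝ E).symm (WeakDual.toStrongDual a) with hw
  have hwy : ∀ y, inner ℝ w y = a y := fun y => InnerProductSpace.toDual_symm_apply
  refine ⟨ns, hns, w, ?_, fun y => by rw [hwy]; exact hlim' y⟩
  have : K.topologicalClosure = K := IsClosed.submodule_topologicalClosure_eq hK
  rw [← this, ← Submodule.orthogonal_orthogonal_eq_closure, Submodule.mem_orthogonal]
  intro y hy
  rw [real_inner_comm, hwy]
  refine tendsto_nhds_unique (hlim' y) ?_
  have : (fun n => inner ℝ (z (ns n)) y) = fun _ => (0 : ℝ) :=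
    funext fun n => (Submodule.mem_orthogonal K y).1 hy _ (hz _)
  rw [this]
  exact tendsto_const_nhds

variable {N : ℕ}

theorem IsAvg.integral_mul_mc_le {μ : Measure (Euc N)} {R : ℝ} (hμ : IsAvg μ R) {g : Euc N → ℝ}
    (hgs : ContDiff ℝ ∞ g) (hc : HasCompactSupport g) :
    ∫ x, g x * mc μ g x ≤ μ.real univ * ∫ x, (g x) ^ 2 := by
  have := hμ.fin
  have hg := hgs.continuous
  have hg2c : HasCompactSupport fun x => (g x) ^ 2 := hc.comp_left (g := fun t => t ^ 2) (by simp)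
  have hg2 : Continuous fun x => (g x) ^ 2 := hg.pow 2
  have hi2 : Integrable fun x => (g x) ^ 2 := hg2.integrable_of_hasCompactSupport hg2c
  have h1 : ∫ x, mc μ (fun x => (g x) ^ 2) x = μ.real univ * ∫ x, (g x) ^ 2 := by
    unfold mc
    rw [integral_integral_swap (f := fun x z => (g (x - z)) ^ 2) (integrable_prod_shift hi2)]
    have : ∀ z, ∫ x, (g (x - z)) ^ 2 = ∫ x, (g x) ^ 2 := fun z =>
      integral_sub_right_eq_self (fun x => (g x) ^ 2) z
    simp only [this, integral_const, smul_eq_mul]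
  have hr : Integrable fun x => 2⁻¹ * (μ.real univ * (g x) ^ 2 + mc μ (fun x => (g x) ^ 2) x) :=
    ((hi2.const_mul _).add (integrable_mc hi2)).const_mul _
  have h2 : ∫ x, 2⁻¹ * (μ.real univ * (g x) ^ 2 + mc μ (fun x => (g x) ^ 2) x)
      = μ.real univ * ∫ x, (g x) ^ 2 := by
    rw [integral_const_mul, integral_add (f := fun x => μ.real univ * (g x) ^ 2)
      (hi2.const_mul _) (integrable_mc hi2), h1, integral_const_mul]
    ring
  rw [← h2]
  refine integral_mono ((hg.mul (contDiff_mc hgs hc).continuous).integrable_of_hasCompactSupport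
    hc.mul_right) hr fun x => ?_
  have i1 : Integrable (fun z => g (x - z)) μ := integrable_shift_of_test hg hc x
  have i2 : Integrable (fun z => (g (x - z)) ^ 2) μ := integrable_shift_of_test hg2 hg2c x
  have h3 : μ.real univ * (g x) ^ 2 = ∫ _, (g x) ^ 2 ∂μ := by simp
  simp only [mc]
  rw [h3, ← integral_add (integrable_const _) i2, ← integral_const_mul, ← integral_const_mul]
  refine integral_mono (i1.const_mul _) (((integrable_const _).add i2).const_mul _) fun z => ?_
  simp only
  nlinarith [sq_nonneg (g x - g (x - z))]

theorem integral_gr_sq {Ω : Set (Euc N)} {φ : Euc N → ℝ} (h : IsTest Ω φ) :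
    ∑ i, ∫ x, (pd i φ x) ^ 2 = ‖gz (embZ h)‖ ^ 2 := by
  rw [norm_gz_embZ_sq, ← integral_finsetSum]
  · congr 1
    ext x
    rw [← norm_gr, EuclideanSpace.norm_sq_eq]
    simp [gr]
  · intro i _
    refine Continuous.integrable_of_hasCompactSupport
      ((h.smooth.pd_top i).continuous.pow 2) ?_
    exact (h.compact.pd i).comp_left (g := fun t => t ^ 2) (by simp)

theorem integral_sq_le_mc {ζ η : Euc N → ℝ} (hk : IsKer ζ η) {ε : ℝ} (hε : 0 < ε)
    {Ω : Set (Euc N)} {φ : Euc N → ℝ} (h : IsTest Ω φ) :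
    ∫ x, (φ x) ^ 2 ≤ (∫ x, φ x * mc (mol η ε) φ x) + (∫ y, ζ y) * ε ^ 2 * ‖gz (embZ h)‖ ^ 2 := by
  have ha := isAvg_kap hk (ε := ε)
  have := ha.fin
  have := (isAvg_mol hk hε).fin
  have hs := h.smooth
  have hc := h.compact
  have hmass : (kap ζ ε).real univ ≤ (∫ y, ζ y) * ε ^ 2 := by
    have := mc_kap_le_sq hk (h := fun _ => 1) measurable_const (B := 1) (by simp) hε 0
    simpa [mc] using this
  have hm1 := (contDiff_mc (μ := mol η ε) hs hc).continuous
  have hk1 := contDiff_mc (μ := kap ζ ε) hs hc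
  have hkc := ha.hasCompactSupport_mc hc
  have e1 : ∀ x, (φ x) ^ 2 = φ x * mc (mol η ε) φ x - ∑ i, φ x * pd i (pd i (mc (kap ζ ε) φ)) x := by
    intro x
    rw [← Finset.mul_sum, ← lap_eq_sum_pd, lap_mc hs hc, ← mul_sub,
      mc_mol_sub_mc_kap_lap hk hε hs hc]
    ring
  have i1 : Integrable fun x => φ x * mc (mol η ε) φ x :=
    (hs.continuous.mul hm1).integrable_of_hasCompactSupport hc.mul_right
  have i2 : ∀ i, Integrable fun x => φ x * pd i (pd i (mc (kap ζ ε) φ)) x := fun i =>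
    (hs.continuous.mul ((hk1.pd_top i).pd_top i).continuous).integrable_of_hasCompactSupport
      hc.mul_right
  have e2 : ∀ i, - ∫ x, φ x * pd i (pd i (mc (kap ζ ε) φ)) x
      ≤ (∫ y, ζ y) * ε ^ 2 * ∫ x, (pd i φ x) ^ 2 := by
    intro i
    rw [integral_mul_pd (hs.of_le (by simp)) ((hk1.pd_top i).of_le (by simp)) (hkc.pd i), neg_neg,
      pd_mc (hs.of_le (by simp)) hc]
    refine (ha.integral_mul_mc_le (hs.pd_top i) (hc.pd i)).trans ?_
    exact mul_le_mul_of_nonneg_right hmass (integral_nonneg fun x => sq_nonneg _)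
  simp_rw [e1]
  rw [integral_sub i1 (integrable_finsetSum _ fun i _ => i2 i),
    integral_finsetSum _ fun i _ => i2 i, sub_eq_add_neg, ← Finset.sum_neg_distrib,
    ← integral_gr_sq h, Finset.mul_sum]
  gcongr with i _
  exact e2 i

theorem mc_mol_eq_inner {ζ η : Euc N → ℝ} (hk : IsKer ζ η) {ε : ℝ} (hε : 0 < ε) :
    ∃ B : ℝ, ∀ x, ∃ k : Lp ℝ 2 (volume : Measure (Euc N)), ‖k‖ ≤ B ∧
      ∀ (Ω : Set (Euc N)) (φ : Euc N → ℝ) (h : IsTest Ω φ),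
        mc (mol η ε) φ x = inner ℝ (vz (embZ h)) k := by
  set c : ℝ := |((ε ^ N)⁻¹ : ℝ)| with hcdef
  have hcont : ∀ x, Continuous fun w : Euc N => c * η (ε⁻¹ • (x - w)) := fun x =>
    continuous_const.mul (hk.es.continuous.comp (by fun_prop))
  have hcs : ∀ x, HasCompactSupport fun w : Euc N => c * η (ε⁻¹ • (x - w)) := fun x => by
    refine hasCompactSupport_of_zero_off_ball (R := ε + ‖x‖) fun w hw => ?_
    rw [hk.esupp, mul_zero]
    rw [norm_smul, norm_inv, Real.norm_of_nonneg hε.le, ← div_eq_inv_mul, le_div_iff₀ hε, one_mul]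
    have := norm_sub_norm_le w x
    rw [norm_sub_rev] at this
    linarith
  have hmem : ∀ x, MemLp (fun w : Euc N => c * η (ε⁻¹ • (x - w))) 2 volume := fun x =>
    (hcont x).memLp_of_hasCompactSupport (hcs x)
  have hnorm : ∀ x, ‖(hmem x).toLp‖ ^ 2 = ∫ w, (c * η (ε⁻¹ • w)) ^ 2 := by
    intro x
    rw [← integral_sub_left_eq_self (fun w => (c * η (ε⁻¹ • w)) ^ 2) volume x,
      ← real_inner_self_eq_norm_sq, L2.inner_def]
    refine integral_congr_ae ?_
    filter_upwards [(hmem x).coeFn_toLp] with w hw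
    rw [hw, real_inner_self_eq_norm_sq, Real.norm_eq_abs, sq_abs]
  refine ⟨‖(hmem 0).toLp‖, fun x => ⟨(hmem x).toLp, ?_, fun Ω φ h => ?_⟩⟩
  · exact ((sq_eq_sq₀ (norm_nonneg _) (norm_nonneg _)).1 ((hnorm x).trans (hnorm 0).symm)).le
  · have e1 : inner ℝ (vz (embZ h)) (hmem x).toLp = ∫ w, c * (η (ε⁻¹ • (x - w)) * φ w) := by
      rw [L2.inner_def]
      refine integral_congr_ae ?_
      filter_upwards [(hmem x).coeFn_toLp, vz_embZ h] with w hw hv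
      rw [hw, hv]
      simp
      ring
    have e2 : ∫ y, η y * φ (x - ε • y)
        = ∫ y, (fun w => η (ε⁻¹ • w) * φ (x - w)) (ε • y) := by
      congr 1; ext y
      simp only [smul_smul, inv_mul_cancel₀ hε.ne', one_smul]
    have e3 : ∫ w, η (ε⁻¹ • (x - w)) * φ w = ∫ w, η (ε⁻¹ • w) * φ (x - w) := by
      rw [← integral_sub_left_eq_self (fun w => η (ε⁻¹ • w) * φ (x - w)) volume x]
      simp
    rw [e1, mc_mol hk ε h.smooth.continuous.measurable, e2, Measure.integral_comp_smul volume (fun w => η (ε⁻¹ • w) * φ (x - w)) ε,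
      integral_const_mul, e3, smul_eq_mul, finrank_euclideanSpace_fin]

theorem tendsto_vz_zero {Ω : Set (Euc N)} (hΩm : MeasurableSet Ω) (hΩ : Bornology.IsBounded Ω)
    {φ : ℕ → Euc N → ℝ} (h : ∀ n, IsTest Ω (φ n)) {C : ℝ} (hC : ∀ n, ‖embZ (h n)‖ ≤ C)
    (hw : ∀ y, Tendsto (fun n => inner ℝ (embZ (h n)) y) atTop (𝓝 0)) :
    Tendsto (fun n => vz (embZ (h n))) atTop (𝓝 0) := by
  obtain ⟨ζ, η, hk⟩ := exists_isKer N
  have hC0 : 0 ≤ C := (norm_nonneg _).trans (hC 0)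
  have hZ : 0 ≤ ∫ y, ζ y := integral_nonneg hk.z0
  have hfin : IsFiniteMeasure (volume.restrict Ω) :=
    ⟨by rw [Measure.restrict_apply_univ]; exact hΩ.measure_lt_top⟩
  have key : ∀ ε : ℝ, 0 < ε → ∀ n, ∫ x, (φ n x) ^ 2 ≤
      (∫ x in Ω, (mc (mol η ε) (φ n) x) ^ 2) + 2 * ((∫ y, ζ y) * ε ^ 2 * C ^ 2) := by
    intro ε hε n
    have := (isAvg_mol hk hε).fin
    have hs := (h n).smooth
    have hc := (h n).compact
    have h1 := integral_sq_le_mc hk hε (h n)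
    have hTc := (contDiff_mc (μ := mol η ε) hs hc).continuous
    have h2 : ‖gz (embZ (h n))‖ ^ 2 ≤ C ^ 2 :=
      pow_le_pow_left₀ (norm_nonneg _) ((norm_gz_le _).trans (hC n)) 2
    have h3 := mul_le_mul_of_nonneg_left h2 (mul_nonneg hZ (sq_nonneg ε))
    have hφ2 : HasCompactSupport fun x => (φ n x) ^ 2 :=
      hc.comp_left (g := fun t => t ^ 2) (by simp)
    have i1 : Integrable fun x => (φ n x) ^ 2 :=
      (hs.continuous.pow 2).integrable_of_hasCompactSupport hφ2
    have hTs : HasCompactSupport (mc (mol η ε) (φ n)) := (isAvg_mol hk hε).hasCompactSupport_mc hc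
    generalize mc (mol η ε) (φ n) = T at h1 hTc hTs ⊢
    have hT2 : HasCompactSupport fun x => (T x) ^ 2 := hTs.comp_left (g := fun t => t ^ 2) (by simp)
    have i2 : IntegrableOn (fun x => (T x) ^ 2) Ω :=
      ((hTc.pow 2).integrable_of_hasCompactSupport hT2).integrableOn
    have h4 : ∫ x, φ n x * T x ≤
        2⁻¹ * (∫ x, (φ n x) ^ 2) + 2⁻¹ * ∫ x in Ω, (T x) ^ 2 := by
      rw [← integral_indicator hΩm, ← integral_const_mul, ← integral_const_mul, ← integral_add
        (f := fun x => 2⁻¹ * (φ n x) ^ 2)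
        (i1.const_mul _) ((i2.integrable_indicator hΩm).const_mul _)]
      refine integral_mono ((hs.continuous.mul hTc).integrable_of_hasCompactSupport hc.mul_right)
        ((i1.const_mul _).add ((i2.integrable_indicator hΩm).const_mul _)) fun x => ?_
      by_cases hx : x ∈ Ω
      · simp only [indicator_of_mem hx]
        nlinarith [sq_nonneg (φ n x - T x)]
      · have : φ n x = 0 := image_eq_zero_of_notMem_tsupport fun h' => hx ((h n).supp h')
        simp [this, hx]
    linarith
  have hT : ∀ ε : ℝ, 0 < ε →
      Tendsto (fun n => ∫ x in Ω, (mc (mol η ε) (φ n) x) ^ 2) atTop (𝓝 0) := by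
    intro ε hε
    have := (isAvg_mol hk hε).fin
    obtain ⟨B, hB⟩ := mc_mol_eq_inner hk hε
    rw [← integral_zero (Euc N) ℝ (μ := volume.restrict Ω)]
    refine tendsto_integral_of_dominated_convergence (fun _ => (B * C) ^ 2)
      (fun n => ((contDiff_mc (h n).smooth (h n).compact).continuous.pow 2).aestronglyMeasurable)
      (integrable_const _) (fun n => Eventually.of_forall fun x => ?_)
      (Eventually.of_forall fun x => ?_)
    · obtain ⟨k, hkB, hkφ⟩ := hB x
      rw [Real.norm_of_nonneg (sq_nonneg _), ← sq_abs, hkφ Ω (φ n) (h n)]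
      refine pow_le_pow_left₀ (abs_nonneg _) ((abs_real_inner_le_norm _ _).trans ?_) 2
      rw [mul_comm]
      exact mul_le_mul hkB ((norm_vz_le _).trans (hC n)) (norm_nonneg _) ((norm_nonneg _).trans hkB)
    · obtain ⟨k, -, hkφ⟩ := hB x
      have h1 := hw (ContinuousLinearMap.adjoint vz k)
      simp only [ContinuousLinearMap.adjoint_inner_right] at h1
      have h2 := h1.pow 2
      rw [zero_pow two_ne_zero] at h2
      exact h2.congr fun n => by rw [hkφ Ω (φ n) (h n)]
  rw [tendsto_zero_iff_norm_tendsto_zero]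
  have hsq : Tendsto (fun n => ‖vz (embZ (h n))‖ ^ 2) atTop (𝓝 0) := by
    refine tendsto_order.2 ⟨fun a ha => Eventually.of_forall fun n => ha.trans_le (sq_nonneg _),
      fun a ha => ?_⟩
    obtain ⟨ε, hε, hεa⟩ : ∃ ε : ℝ, 0 < ε ∧ 2 * ((∫ y, ζ y) * ε ^ 2 * C ^ 2) < a / 2 := by
      have h1 : Tendsto (fun ε : ℝ => 2 * ((∫ y, ζ y) * ε ^ 2 * C ^ 2)) (𝓝[>] 0) (𝓝 0) := by
        have : Continuous fun ε : ℝ => 2 * ((∫ y, ζ y) * ε ^ 2 * C ^ 2) := by fun_prop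
        have := this.tendsto 0
        simp only [ne_eq, OfNat.ofNat_ne_zero, not_false_eq_true, zero_pow, mul_zero,
          zero_mul] at this
        exact this.mono_left nhdsWithin_le_nhds
      obtain ⟨ε, h2, h3⟩ := ((h1.eventually_lt_const (half_pos ha)).and self_mem_nhdsWithin).exists
      exact ⟨ε, h3, h2⟩
    filter_upwards [(hT ε hε).eventually_lt_const (half_pos ha)] with n hn
    rw [norm_vz_embZ_sq]
    linarith [key ε hε n]
  have := hsq.sqrt
  simpa using this

/-- Bounded sequences in the energy space converge along a subsequence, weakly, strongly in `L²`
and almost everywhere. -/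
theorem exists_compact_limit {Ω : Set (Euc N)} (hΩm : MeasurableSet Ω)
    (hΩ : Bornology.IsBounded Ω) {z : ℕ → Z N} (hz : ∀ n, z n ∈ H0 Ω) {C : ℝ}
    (hC : ∀ n, ‖z n‖ ≤ C) :
    ∃ ns : ℕ → ℕ, StrictMono ns ∧ ∃ w ∈ H0 Ω,
      (∀ y, Tendsto (fun n => inner ℝ (z (ns n)) y) atTop (𝓝 (inner ℝ w y))) ∧
      Tendsto (fun n => vz (z (ns n))) atTop (𝓝 (vz w)) ∧
      ∀ᵐ x, Tendsto (fun n => vz (z (ns n)) x) atTop (𝓝 (vz w x)) := by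
  have : Fact ((2 : ℝ≥0∞) ≠ ⊤) := ⟨by simp⟩
  obtain ⟨ns, hns, w, hw, hlim⟩ := exists_weak_limit (H0 Ω) (isClosed_H0 Ω) hz hC
  have happ : ∀ n : ℕ, ∃ φ, ∃ h : IsTest Ω φ, dist (z (ns n) - w) (embZ h) < 1 / ((n : ℝ) + 1) := by
    intro n
    obtain ⟨y, ⟨φ, h, rfl⟩, hy⟩ := Metric.mem_closure_iff.1
      ((H0 Ω).sub_mem (hz (ns n)) hw) (1 / ((n : ℝ) + 1)) (by positivity)
    exact ⟨φ, h, hy⟩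
  choose φ h hφ using happ
  have hd : Tendsto (fun n => embZ (h n) - (z (ns n) - w)) atTop (𝓝 0) := by
    rw [tendsto_zero_iff_norm_tendsto_zero]
    refine squeeze_zero (fun n => norm_nonneg _) (fun n => ?_)
      tendsto_one_div_add_atTop_nhds_zero_nat
    rw [← dist_eq_norm, dist_comm]
    exact (hφ n).le
  have hv : Tendsto (fun n => vz (embZ (h n))) atTop (𝓝 0) := by
    refine tendsto_vz_zero hΩm hΩ h (C := 1 + (C + ‖w‖)) (fun n => ?_) fun y => ?_
    · have h1 : ‖embZ (h n) - (z (ns n) - w)‖ ≤ 1 := by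
        rw [← dist_eq_norm, dist_comm]
        refine (hφ n).le.trans ?_
        rw [div_le_one (by positivity)]
        linarith [Nat.cast_nonneg (α := ℝ) n]
      have h2 := norm_sub_le (z (ns n)) w
      have h3 := norm_add_le (embZ (h n) - (z (ns n) - w)) (z (ns n) - w)
      rw [sub_add_cancel] at h3
      linarith [hC (ns n)]
    · have h1 : Tendsto (fun n => inner ℝ (embZ (h n) - (z (ns n) - w)) y
          + (inner ℝ (z (ns n)) y - inner ℝ w y)) atTop
          (𝓝 (inner ℝ (0 : Z N) y + (inner ℝ w y - inner ℝ w y))) :=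
        (hd.inner tendsto_const_nhds).add ((hlim y).sub_const _)
      rw [inner_zero_left, sub_self, add_zero] at h1
      refine h1.congr fun n => ?_
      rw [inner_sub_left, inner_sub_left]; ring
  have hstrong : Tendsto (fun n => vz (z (ns n))) atTop (𝓝 (vz w)) := by
    have h1 := (hv.sub ((vz.continuous.tendsto 0).comp hd)).add_const (vz w)
    rw [map_zero, sub_zero, zero_add] at h1
    refine h1.congr fun n => ?_
    simp only [Function.comp_apply, map_sub]
    abel
  obtain ⟨ms, hms, hae⟩ := exists_subseq_ae hstrong
  exact ⟨fun n => ns (ms n), hns.comp hms, w, hw, fun y => (hlim y).comp hms.tendsto_atTop,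
    hstrong.comp hms.tendsto_atTop, hae⟩

end weakCompactness

section variational

variable {N : ℕ}

/-- The data of the variational problem: a bounded domain, a nonlinearity and a Sobolev
inequality. -/
structure Vari (Ω : Set (Euc N)) (q q' : Euc N → ℝ → ℝ) (a b M r S : ℝ) : Prop where
  op : IsOpen Ω
  bdd : Bornology.IsBounded Ω
  ne : Ω.Nonempty
  nl : Nonlin Ω q q' a b M
  hbr : b < r
  S0 : 0 ≤ S
  sob : ∀ z ∈ H0 Ω, ∫⁻ x, ENNReal.ofReal (|vz z x| ^ r) ≤ ENNReal.ofReal (S * ‖z‖ ^ r)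

/-- The superquadratic part of the derivative of the energy along rays. -/
def Qf (q : Euc N → ℝ → ℝ) (z : Z N) : ℝ := ∫ x, q x (vz z x) * vz z x

/-- The energy on the Nehari set. -/
def Pf (q : Euc N → ℝ → ℝ) (z : Z N) : ℝ := ∫ x, Nonlin.dens q x (vz z x)

/-- The region beyond the Nehari manifold. -/
def Neh (Ω : Set (Euc N)) (q : Euc N → ℝ → ℝ) (lam : ℝ) : Set (Z N) :=
  {z | z ∈ H0 Ω ∧ 0 < Qf q z ∧ en lam z z ≤ Qf q z}

/-- Least energy elements. -/
def IsGround (Ω : Set (Euc N)) (q : Euc N → ℝ → ℝ) (lam : ℝ) (z : Z N) : Prop :=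
  z ∈ Neh Ω q lam ∧ ∀ w ∈ Neh Ω q lam, Pf q z ≤ Pf q w

theorem aem_vz (z : Z N) : AEMeasurable (vz z) := (Lp.aestronglyMeasurable _).aemeasurable

theorem en_smul (lam s : ℝ) (z : Z N) : en lam (s • z) (s • z) = s ^ 2 * en lam z z := by
  simp only [en, map_smul, inner_smul_left, inner_smul_right, RCLike.conj_to_real]
  ring

theorem vz_smul_ae (s : ℝ) (z : Z N) : ∀ᵐ x, vz (s • z) x = s * vz z x := by
  rw [map_smul]
  filter_upwards [Lp.coeFn_smul s (vz z)] with x hx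
  rw [hx, Pi.smul_apply, smul_eq_mul]

theorem vz_add_ae (z w : Z N) : ∀ᵐ x, vz (z + w) x = vz z x + vz w x := by
  rw [map_add]
  filter_upwards [Lp.coeFn_add (vz z) (vz w)] with x hx
  rw [hx, Pi.add_apply]

namespace Vari

variable {Ω : Set (Euc N)} {q q' : Euc N → ℝ → ℝ} {a b M r S : ℝ}

theorem b2 (H : Vari Ω q q' a b M r S) : 2 < b := H.nl.ha.trans_le H.nl.hab

theorem meas (H : Vari Ω q q' a b M r S) : MeasurableSet Ω := H.op.measurableSet

theorem fin (H : Vari Ω q q' a b M r S) : volume Ω ≠ ⊤ := H.bdd.measure_lt_top.ne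

theorem sob_ne_top (H : Vari Ω q q' a b M r S) {z : Z N} (hz : z ∈ H0 Ω) :
    ∫⁻ x, ENNReal.ofReal (|vz z x| ^ r) ≠ ⊤ :=
  ((H.sob z hz).trans_lt ENNReal.ofReal_lt_top).ne

theorem integrable_mul (H : Vari Ω q q' a b M r S) {z : Z N} (hz : z ∈ H0 Ω) :
    Integrable fun x => q x (vz z x) * vz z x :=
  H.nl.integrand_mul.integrable H.meas H.fin (by linarith [H.b2]) H.hbr.le (aem_vz z)
    (H.sob_ne_top hz)

theorem integrable_dens (H : Vari Ω q q' a b M r S) {z : Z N} (hz : z ∈ H0 Ω) :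
    Integrable fun x => Nonlin.dens q x (vz z x) :=
  H.nl.integrand_dens.integrable H.meas H.fin (by linarith [H.b2]) H.hbr.le (aem_vz z)
    (H.sob_ne_top hz)

theorem Qf_nonneg (H : Vari Ω q q' a b M r S) (z : Z N) : 0 ≤ Qf q z :=
  integral_nonneg fun _ => H.nl.nonneg _ _

theorem coef_pos (H : Vari Ω q q' a b M r S) : 0 < 1 / 2 - 1 / a := by
  have := H.nl.ha
  rw [sub_pos]
  exact one_div_lt_one_div_of_lt two_pos this

theorem Qf_le_Pf (H : Vari Ω q q' a b M r S) {z : Z N} (hz : z ∈ H0 Ω) :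
    (1 / 2 - 1 / a) * Qf q z ≤ Pf q z := by
  rw [Qf, Pf, ← integral_const_mul]
  exact integral_mono ((H.integrable_mul hz).const_mul _) (H.integrable_dens hz)
    fun x => H.nl.le_dens _ _

theorem Pf_nonneg (H : Vari Ω q q' a b M r S) {z : Z N} (hz : z ∈ H0 Ω) : 0 ≤ Pf q z :=
  (mul_nonneg H.coef_pos.le (H.Qf_nonneg z)).trans (H.Qf_le_Pf hz)

theorem Qf_smul (H : Vari Ω q q' a b M r S) {z : Z N} (hz : z ∈ H0 Ω) {s : ℝ} (hs : 1 ≤ s) :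
    s ^ a * Qf q z ≤ Qf q (s • z) := by
  rw [Qf, Qf, ← integral_const_mul]
  refine integral_mono_ae ((H.integrable_mul hz).const_mul _)
    (H.integrable_mul ((H0 Ω).smul_mem s hz)) ?_
  filter_upwards [vz_smul_ae s z] with x hx
  rw [hx]
  have := rpow_mul_le_of_deriv_ge (H.nl.der x) (H.nl.low x) (vz z x) hs
  rwa [sub_add_cancel] at this

theorem exists_Qf_le (H : Vari Ω q q' a b M r S) {δ : ℝ} (hδ : 0 < δ) :
    ∃ C, 0 ≤ C ∧ ∀ z ∈ H0 Ω, Qf q z ≤ δ * ‖z‖ ^ 2 + C * ‖z‖ ^ r := by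
  obtain ⟨C, hC, h⟩ := H.nl.exists_mul_le H.hbr hδ
  refine ⟨C * S, mul_nonneg hC H.S0, fun z hz => ?_⟩
  have i1 : Integrable fun x => (vz z x) ^ 2 := (Lp.memLp (vz z)).integrable_sq
  have i2 : Integrable fun x => |vz z x| ^ r := integrable_abs_rpow (aem_vz z) (H.sob_ne_top hz)
  have h1 : ∫ x, (vz z x) ^ 2 ≤ ‖z‖ ^ 2 := by
    have : ∫ x, (vz z x) ^ 2 = ‖vz z‖ ^ 2 := by
      rw [← real_inner_self_eq_norm_sq, L2.inner_def]
      refine integral_congr_ae (Eventually.of_forall fun x => ?_)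
      simp only
      rw [real_inner_self_eq_norm_sq, Real.norm_eq_abs, sq_abs]
    rw [this]
    exact pow_le_pow_left₀ (norm_nonneg _) (norm_vz_le z) 2
  have h2 : ∫ x, |vz z x| ^ r ≤ S * ‖z‖ ^ r := by
    rw [integral_eq_lintegral_of_nonneg_ae
      (Eventually.of_forall fun x => Real.rpow_nonneg (abs_nonneg _) _) i2.aestronglyMeasurable]
    exact ENNReal.toReal_le_of_le_ofReal (mul_nonneg H.S0 (Real.rpow_nonneg (norm_nonneg _) _))
      (H.sob z hz)
  calc Qf q z ≤ ∫ x, (δ * (vz z x) ^ 2 + C * |vz z x| ^ r) :=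
        integral_mono (H.integrable_mul hz) ((i1.const_mul _).add (i2.const_mul _)) fun x => h _ _
    _ = δ * (∫ x, (vz z x) ^ 2) + C * ∫ x, |vz z x| ^ r := by
        rw [integral_add (f := fun x => δ * (vz z x) ^ 2) (i1.const_mul _) (i2.const_mul _),
          integral_const_mul, integral_const_mul]
    _ ≤ _ := by
        rw [mul_assoc]
        gcongr

theorem exists_le_Qf (H : Vari Ω q q' a b M r S) {lam : ℝ} (hlam : -firstEig Ω < lam) :
    ∃ c δ : ℝ, 0 < c ∧ 0 < δ ∧ ∀ mu, |mu - lam| < δ → ∀ z ∈ Neh Ω q mu, c ≤ Qf q z := by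
  obtain ⟨κ, δ, hκ, hδ, hco⟩ := exists_coercive hlam
  obtain ⟨C, hC, hQ⟩ := H.exists_Qf_le (half_pos hκ)
  have hr2 : 0 < r - 2 := by linarith [H.b2, H.hbr]
  set c : ℝ := (κ / (2 * (C + 1))) ^ (r - 2)⁻¹ with hc
  have hc0 : 0 < c := Real.rpow_pos_of_pos (by positivity) _
  have hcr : c ^ (r - 2) = κ / (2 * (C + 1)) := Real.rpow_inv_rpow (by positivity) hr2.ne'
  refine ⟨κ * c ^ 2, δ, by positivity, hδ, fun mu hmu z hz => ?_⟩
  have h1 := (hco mu hmu z hz.1).trans hz.2.2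
  refine le_trans ?_ h1
  have hz0 : 0 < ‖z‖ := by
    rw [norm_pos_iff]
    rintro rfl
    have h2 := hQ 0 (H0 Ω).zero_mem
    rw [norm_zero, Real.zero_rpow (by linarith : r ≠ 0)] at h2
    have := hz.2.1
    norm_num at h2
    linarith
  suffices c ≤ ‖z‖ by gcongr
  by_contra! hlt
  have h2 := h1.trans (hQ z hz.1)
  have h3 : ‖z‖ ^ r = ‖z‖ ^ (r - 2) * ‖z‖ ^ 2 := by
    rw [← Real.rpow_natCast ‖z‖ 2, ← Real.rpow_add hz0]
    norm_num
  have h4 : ‖z‖ ^ (r - 2) ≤ κ / (2 * (C + 1)) := by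
    rw [← hcr]; exact Real.rpow_le_rpow hz0.le hlt.le hr2.le
  have h5 : C * ‖z‖ ^ (r - 2) < κ / 2 := by
    calc C * ‖z‖ ^ (r - 2) ≤ C * (κ / (2 * (C + 1))) := by gcongr
      _ < κ / 2 := by
        rw [← mul_div_assoc, div_lt_div_iff₀ (by positivity) two_pos]
        nlinarith
  rw [h3] at h2
  have h6 : 0 < ‖z‖ ^ 2 := by positivity
  nlinarith [mul_lt_mul_of_pos_right h5 h6]

theorem tendsto_Qf_Pf (H : Vari Ω q q' a b M r S) {z : ℕ → Z N} {w : Z N} (hz : ∀ n, z n ∈ H0 Ω)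
    (hw : w ∈ H0 Ω) {C : ℝ} (hC : ∀ n, ‖z n‖ ≤ C)
    (hae : ∀ᵐ x, Tendsto (fun n => vz (z n) x) atTop (𝓝 (vz w x))) :
    Tendsto (fun n => Qf q (z n)) atTop (𝓝 (Qf q w)) ∧
    Tendsto (fun n => Pf q (z n)) atTop (𝓝 (Pf q w)) := by
  have hb0 : 0 ≤ b := by linarith [H.b2]
  have hr0 : 0 ≤ r := by linarith [H.hbr]
  have hS := H.S0
  have h1 : ∀ n, ∫⁻ x, ENNReal.ofReal (|vz (z n) x| ^ r)
      ≤ ENNReal.ofReal (S * (max C ‖w‖) ^ r) := fun n =>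
    (H.sob _ (hz n)).trans (ENNReal.ofReal_le_ofReal (by
      gcongr; exact (hC n).trans (le_max_left _ _)))
  have h2 : ∫⁻ x, ENNReal.ofReal (|vz w x| ^ r) ≤ ENNReal.ofReal (S * (max C ‖w‖) ^ r) :=
    (H.sob _ hw).trans (ENNReal.ofReal_le_ofReal (by gcongr; exact le_max_right _ _))
  exact ⟨H.nl.integrand_mul.tendsto_integral H.meas H.fin hb0 H.hbr (fun n => aem_vz _) (aem_vz _)
      ENNReal.ofReal_ne_top h1 h2 hae,
    H.nl.integrand_dens.tendsto_integral H.meas H.fin hb0 H.hbr (fun n => aem_vz _) (aem_vz _)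
      ENNReal.ofReal_ne_top h1 h2 hae⟩

theorem en_le_of_tendsto {z : ℕ → Z N} {w : Z N} {mu : ℕ → ℝ} {lam : ℝ} {e : ℕ → ℝ} {L : ℝ}
    (hmu : Tendsto mu atTop (𝓝 lam))
    (hweak : ∀ y, Tendsto (fun n => inner ℝ (z n) y) atTop (𝓝 (inner ℝ w y)))
    (hstrong : Tendsto (fun n => vz (z n)) atTop (𝓝 (vz w)))
    (he : Tendsto e atTop (𝓝 L)) (hle : ∀ n, en (mu n) (z n) (z n) ≤ e n) : en lam w w ≤ L := by
  have h1 : Tendsto (fun n => (2 * inner ℝ (z n) w - inner ℝ w w)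
      + (mu n - 1) * inner ℝ (vz (z n)) (vz (z n))) atTop
      (𝓝 ((2 * inner ℝ w w - inner ℝ w w) + (lam - 1) * inner ℝ (vz w) (vz w))) :=
    (((hweak w).const_mul 2).sub_const _).add ((hmu.sub_const 1).mul (hstrong.inner hstrong))
  rw [en_eq]
  have h2 := le_of_tendsto_of_tendsto' h1 he fun n => ?_
  · linarith
  refine le_trans ?_ (hle n)
  rw [en_eq]
  have h3 := real_inner_self_nonneg (x := z n - w)
  rw [inner_sub_left, inner_sub_right, inner_sub_right, real_inner_comm (z n) w] at h3
  linarith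

/-- Compactness of sequences in the Nehari regions with bounded energy. -/
theorem exists_limit (H : Vari Ω q q' a b M r S) {lam : ℝ} (hlam : -firstEig Ω < lam)
    {mu : ℕ → ℝ} (hmu : Tendsto mu atTop (𝓝 lam)) {z : ℕ → Z N} (hz : ∀ n, z n ∈ Neh Ω q (mu n))
    {B : ℝ} (hB : ∀ᶠ n in atTop, Pf q (z n) ≤ B) :
    ∃ ns : ℕ → ℕ, StrictMono ns ∧ ∃ w ∈ Neh Ω q lam,
      Tendsto (fun n => vz (z (ns n))) atTop (𝓝 (vz w)) ∧
      Tendsto (fun n => Pf q (z (ns n))) atTop (𝓝 (Pf q w)) := by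
  obtain ⟨κ, δ, hκ, hδ, hco⟩ := exists_coercive hlam
  obtain ⟨c, δ', hc, hδ', hlow⟩ := H.exists_le_Qf hlam
  have hev : ∀ᶠ n in atTop, Pf q (z n) ≤ B ∧ |mu n - lam| < min δ δ' := by
    refine hB.and ?_
    have := Metric.tendsto_nhds.1 hmu (min δ δ') (lt_min hδ hδ')
    simpa only [Real.dist_eq] using this
  obtain ⟨n₀, hn₀⟩ := eventually_atTop.1 hev
  have hα := H.coef_pos
  set α := 1 / 2 - 1 / a
  set C : ℝ := √(B / α / κ) with hCdef
  have hC : ∀ n, ‖z (n + n₀)‖ ≤ C := by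
    intro n
    obtain ⟨h1, h2⟩ := hn₀ (n + n₀) (Nat.le_add_left _ _)
    have h3 := hco _ (h2.trans_le (min_le_left _ _)) _ (hz (n + n₀)).1
    have h4 := H.Qf_le_Pf (hz (n + n₀)).1
    refine Real.le_sqrt_of_sq_le ?_
    rw [le_div_iff₀ hκ, le_div_iff₀ hα]
    have h5 := h3.trans (hz (n + n₀)).2.2
    have h6 : α * Qf q (z (n + n₀)) ≤ B := h4.trans h1
    nlinarith
  obtain ⟨ns, hns, w, hw, hweak, hstrong, hae⟩ := exists_compact_limit H.meas H.bdd
    (z := fun n => z (n + n₀)) (fun n => (hz _).1) hC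
  obtain ⟨hQ, hP⟩ := H.tendsto_Qf_Pf (fun n => (hz (ns n + n₀)).1) hw (fun n => hC (ns n)) hae
  have hmono : StrictMono fun n => ns n + n₀ := fun i j hij => Nat.add_lt_add_right (hns hij) _
  refine ⟨fun n => ns n + n₀, hmono, w, ⟨hw, ?_, ?_⟩, hstrong, hP⟩
  · refine hc.trans_le (ge_of_tendsto' hQ fun n => ?_)
    exact hlow _ ((hn₀ _ (Nat.le_add_left _ _)).2.trans_le (min_le_right _ _)) _ (hz _)
  · exact en_le_of_tendsto (hmu.comp hmono.tendsto_atTop) hweak hstrong hQ fun n => (hz _).2.2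

theorem exists_smul_mem (H : Vari Ω q q' a b M r S) (lam : ℝ) {z : Z N} (hz : z ∈ H0 Ω)
    (hQ : 0 < Qf q z) : (Neh Ω q lam).Nonempty := by
  have ha : 0 < a - 2 := by linarith [H.nl.ha]
  have hlim := (tendsto_rpow_atTop ha).eventually_ge_atTop (en lam z z / Qf q z)
  obtain ⟨s, hs, hs1⟩ := (hlim.and (eventually_ge_atTop 1)).exists
  have hs0 : 0 < s := by linarith
  have h1 := H.Qf_smul hz hs1
  refine ⟨s • z, (H0 Ω).smul_mem s hz, lt_of_lt_of_le (by positivity) h1, le_trans ?_ h1⟩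
  rw [en_smul]
  rw [div_le_iff₀ hQ] at hs
  have h3 : s ^ a = s ^ 2 * s ^ (a - 2) := by
    rw [← Real.rpow_natCast s 2, ← Real.rpow_add hs0]
    norm_num
  rw [h3, mul_assoc]
  exact mul_le_mul_of_nonneg_left hs (sq_nonneg s)

theorem nonempty_Neh (H : Vari Ω q q' a b M r S) (lam : ℝ) : (Neh Ω q lam).Nonempty := by
  obtain ⟨x₀, hx₀⟩ := H.ne
  obtain ⟨ρ, hρ, hball⟩ := Metric.isOpen_iff.1 H.op x₀ hx₀
  let φ : ContDiffBump x₀ := ⟨ρ / 4, ρ / 2, by positivity, by linarith⟩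
  have hφ : IsTest Ω φ := ⟨φ.contDiff, φ.hasCompactSupport, by
    rw [φ.tsupport_eq]
    exact (Metric.closedBall_subset_ball (half_lt_self hρ)).trans hball⟩
  refine H.exists_smul_mem lam (embZ_mem hφ) ?_
  rw [Qf, integral_pos_iff_support_of_nonneg (fun x => H.nl.nonneg _ _)
    (H.integrable_mul (embZ_mem hφ))]
  have hpos : 0 < volume (Metric.ball x₀ (ρ / 2)) := Metric.measure_ball_pos _ _ (by positivity)
  refine hpos.trans_le (measure_mono_ae ?_)
  filter_upwards [vz_embZ hφ, H.nl.pos] with x h1 h2 hx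
  refine (h2 (hball (Metric.ball_subset_ball (half_lt_self hρ).le hx)) _ ?_).ne'
  rw [h1]
  exact (φ.pos_of_mem_ball hx).ne'

theorem exists_isLeast (H : Vari Ω q q' a b M r S) {lam : ℝ} (hlam : -firstEig Ω < lam) :
    ∃ z, IsGround Ω q lam z := by
  have hbelow : BddBelow (Pf q '' Neh Ω q lam) := ⟨0, by
    rintro _ ⟨z, hz, rfl⟩; exact H.Pf_nonneg hz.1⟩
  obtain ⟨u, -, hu, hmem⟩ := exists_seq_tendsto_sInf ((H.nonempty_Neh lam).image (Pf q)) hbelow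
  choose z hz hzu using hmem
  obtain ⟨ns, hns, w, hw, -, hP⟩ := H.exists_limit hlam (mu := fun _ => lam) tendsto_const_nhds hz
    (B := sInf (Pf q '' Neh Ω q lam) + 1) (by
      filter_upwards [hu.eventually_lt_const (lt_add_one _)] with n hn
      rw [hzu]; exact hn.le)
  refine ⟨w, hw, fun y hy => ?_⟩
  have h1 : Tendsto (fun n => Pf q (z (ns n))) atTop (𝓝 (sInf (Pf q '' Neh Ω q lam))) := by
    simp only [hzu]
    exact hu.comp hns.tendsto_atTop
  rw [tendsto_nhds_unique hP h1]
  exact csInf_le hbelow ⟨y, hy, rfl⟩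

theorem hasDerivAt_Pf (H : Vari Ω q q' a b M r S) {z y : Z N} (hz : z ∈ H0 Ω) (hy : y ∈ H0 Ω) :
    Integrable (fun x => (q' x (vz z x) * vz z x - q x (vz z x)) / 2 * vz y x) ∧
    HasDerivAt (fun s : ℝ => Pf q (z + s • y))
      (∫ x, (q' x (vz z x) * vz z x - q x (vz z x)) / 2 * vz y x) 0 := by
  obtain ⟨h1, h2⟩ := H.nl.integrand_dens.hasDerivAt_integral H.meas H.fin (by linarith [H.b2])
    H.hbr.le (aem_vz z) (aem_vz y) (H.sob_ne_top hz) (H.sob_ne_top hy)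
  refine ⟨h1, h2.congr_of_eventuallyEq (Eventually.of_forall fun s => ?_)⟩
  refine integral_congr_ae ?_
  filter_upwards [vz_add_ae z (s • y), vz_smul_ae s y] with x h3 h4
  rw [h3, h4]

theorem hasDerivAt_Qf (H : Vari Ω q q' a b M r S) {z y : Z N} (hz : z ∈ H0 Ω) (hy : y ∈ H0 Ω) :
    Integrable (fun x => (q' x (vz z x) * vz z x + q x (vz z x)) * vz y x) ∧
    HasDerivAt (fun s : ℝ => Qf q (z + s • y))
      (∫ x, (q' x (vz z x) * vz z x + q x (vz z x)) * vz y x) 0 := by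
  obtain ⟨h1, h2⟩ := H.nl.integrand_mul.hasDerivAt_integral H.meas H.fin (by linarith [H.b2])
    H.hbr.le (aem_vz z) (aem_vz y) (H.sob_ne_top hz) (H.sob_ne_top hy)
  refine ⟨h1, h2.congr_of_eventuallyEq (Eventually.of_forall fun s => ?_)⟩
  refine integral_congr_ae ?_
  filter_upwards [vz_add_ae z (s • y), vz_smul_ae s y] with x h3 h4
  rw [h3, h4]

/-- Least energy elements depend semicontinuously on the parameter. -/
theorem exists_isLeast_limit (H : Vari Ω q q' a b M r S) {lam : ℝ} (hlam : -firstEig Ω < lam)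
    {mu : ℕ → ℝ} (hmu : Tendsto mu atTop (𝓝 lam)) {z : ℕ → Z N}
    (hz : ∀ n, IsGround Ω q (mu n) (z n)) :
    ∃ ns : ℕ → ℕ, StrictMono ns ∧ ∃ w, IsGround Ω q lam w ∧
      Tendsto (fun n => vz (z (ns n))) atTop (𝓝 (vz w)) := by
  have key : ∀ y ∈ Neh Ω q lam, ∀ s : ℝ, 0 < s →
      ∀ᶠ n in atTop, Pf q (z n) ≤ Pf q (y + s • y) := by
    intro y hy s hs
    have hs1 : 1 < 1 + s := by linarith
    have e1 : y + s • y = (1 + s) • y := by rw [add_smul, one_smul]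
    have h1 := H.Qf_smul hy.1 hs1.le
    have h2 : (1 + s) ^ (2 : ℕ) < (1 + s) ^ a := by
      rw [← Real.rpow_natCast]
      exact Real.rpow_lt_rpow_of_exponent_lt hs1 (by simpa using H.nl.ha)
    have h3 : Tendsto (fun n => (1 + s) ^ (2 : ℕ) *
        (en lam y y + (mu n - lam) * inner ℝ (vz y) (vz y))) atTop
        (𝓝 ((1 + s) ^ (2 : ℕ) * (en lam y y + (lam - lam) * inner ℝ (vz y) (vz y)))) :=
      (((hmu.sub_const lam).mul_const _).const_add _).const_mul _
    rw [sub_self, zero_mul, add_zero] at h3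
    have h4 : (1 + s) ^ (2 : ℕ) * en lam y y < (1 + s) ^ a * Qf q y :=
      (mul_le_mul_of_nonneg_left hy.2.2 (by positivity)).trans_lt
        (mul_lt_mul_of_pos_right h2 hy.2.1)
    filter_upwards [h3.eventually_lt_const h4] with n hn
    refine (hz n).2 _ ?_
    rw [e1]
    refine ⟨(H0 Ω).smul_mem _ hy.1, lt_of_lt_of_le ?_ h1, ?_⟩
    · have := hy.2.1
      positivity
    · rw [en_smul]
      refine le_trans (le_of_eq ?_) (hn.le.trans h1)
      unfold en
      ring
  obtain ⟨y₀, hy₀⟩ := H.nonempty_Neh lam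
  obtain ⟨ns, hns, w, hw, hstrong, hP⟩ := H.exists_limit hlam hmu (fun n => (hz n).1)
    (key y₀ hy₀ 1 one_pos)
  refine ⟨ns, hns, w, ⟨hw, fun y hy => ?_⟩, hstrong⟩
  have h1 : ∀ s : ℝ, 0 < s → Pf q w ≤ Pf q (y + s • y) := fun s hs =>
    le_of_tendsto hP (hns.tendsto_atTop.eventually (key y hy s hs))
  have h2 : Tendsto (fun s : ℝ => Pf q (y + s • y)) (𝓝 0) (𝓝 (Pf q y)) := by
    have h3 := (H.hasDerivAt_Pf hy.1 hy.1).2.continuousAt.tendsto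
    have h4 : y + (0 : ℝ) • y = y := by rw [zero_smul, add_zero]
    rwa [h4] at h3
  exact ge_of_tendsto (h2.mono_left nhdsWithin_le_nhds)
    (by filter_upwards [self_mem_nhdsWithin] with s hs using h1 s hs : ∀ᶠ s : ℝ in 𝓝[>] 0, _)

end Vari

end variational

section eulerLagrange

variable {N : ℕ}

theorem nonneg_of_hasDerivAt {g : ℝ → ℝ} {g' : ℝ} (hg : HasDerivAt g g' 0)
    (h : ∀ᶠ s in 𝓝[>] (0 : ℝ), g 0 ≤ g s) : 0 ≤ g' := by
  have h1 := hg.tendsto_slope_zero_right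
  refine ge_of_tendsto h1 ?_
  filter_upwards [h, self_mem_nhdsWithin] with s hs hs0
  rw [zero_add, smul_eq_mul]
  exact mul_nonneg (inv_nonneg.2 (le_of_lt hs0)) (sub_nonneg.2 hs)

theorem eventually_le_of_hasDerivAt {g : ℝ → ℝ} {g' : ℝ} (hg : HasDerivAt g g' 0)
    (h0 : g 0 ≤ 0) (h : g 0 < 0 ∨ g' < 0) : ∀ᶠ s in 𝓝[>] (0 : ℝ), g s ≤ 0 := by
  rcases h with h | h
  · exact ((hg.continuousAt.tendsto.eventually_lt_const h).filter_mono nhdsWithin_le_nhds).mono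
      fun s hs => hs.le
  · filter_upwards [hg.tendsto_slope_zero_right.eventually_lt_const h, self_mem_nhdsWithin]
      with s hs hs0
    rw [zero_add, smul_eq_mul] at hs
    have h1 : g s - g 0 < 0 := by
      by_contra! h2
      exact absurd hs (not_lt.2 (mul_nonneg (inv_nonneg.2 (le_of_lt hs0)) h2))
    linarith

theorem hasDerivAt_en (lam : ℝ) (z y : Z N) :
    HasDerivAt (fun s : ℝ => en lam (z + s • y) (z + s • y)) (2 * en lam z y) 0 := by
  have h1 : (fun s : ℝ => en lam (z + s • y) (z + s • y)) =
      fun s : ℝ => en lam z z + s * (2 * en lam z y) + s ^ 2 * en lam y y := by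
    funext s
    simp only [en, map_add, map_smul, inner_add_left, inner_add_right, inner_smul_left,
      inner_smul_right, RCLike.conj_to_real]
    rw [real_inner_comm (gz z) (gz y), real_inner_comm (vz z) (vz y)]
    ring
  rw [h1]
  have h2 : HasDerivAt (fun s : ℝ => en lam z z + s * (2 * en lam z y) + s ^ 2 * en lam y y)
      (1 * (2 * en lam z y) + (((2 : ℕ) : ℝ) * (0 : ℝ) ^ (2 - 1) * 1) * en lam y y) 0 :=
    (((hasDerivAt_id (0 : ℝ)).mul_const _).const_add _).add
      (((hasDerivAt_id (0 : ℝ)).pow 2).mul_const _)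
  refine h2.congr_deriv ?_
  norm_num

theorem integral_mul_vz_add_smul {k : Euc N → ℝ} {z y : Z N} (hz : Integrable fun x => k x * vz z x)
    (hy : Integrable fun x => k x * vz y x) (s : ℝ) :
    ∫ x, k x * vz (z + s • y) x = (∫ x, k x * vz z x) + s * ∫ x, k x * vz y x := by
  rw [← integral_const_mul, ← integral_add (f := fun x => k x * vz z x) hz (hy.const_mul s)]
  refine integral_congr_ae ?_
  filter_upwards [vz_add_ae z (s • y), vz_smul_ae s y] with x h1 h2
  rw [h1, h2]
  ring

namespace Vari

variable {Ω : Set (Euc N)} {q q' : Euc N → ℝ → ℝ} {a b M r S lam : ℝ}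

theorem deriv_nonneg (H : Vari Ω q q' a b M r S) {z y : Z N} (hz : IsGround Ω q lam z)
    (hy : y ∈ H0 Ω) (h : en lam z z < Qf q z ∨
      2 * en lam z y < ∫ x, (q' x (vz z x) * vz z x + q x (vz z x)) * vz y x) :
    0 ≤ ∫ x, (q' x (vz z x) * vz z x - q x (vz z x)) / 2 * vz y x := by
  have hzH := hz.1.1
  obtain ⟨-, hP⟩ := H.hasDerivAt_Pf hzH hy
  obtain ⟨-, hQ⟩ := H.hasDerivAt_Qf hzH hy
  have e0 : z + (0 : ℝ) • y = z := by rw [zero_smul, add_zero]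
  have hD : HasDerivAt (fun s : ℝ => en lam (z + s • y) (z + s • y) - Qf q (z + s • y))
      (2 * en lam z y - ∫ x, (q' x (vz z x) * vz z x + q x (vz z x)) * vz y x) 0 :=
    (hasDerivAt_en lam z y).sub hQ
  have hle := eventually_le_of_hasDerivAt hD (by
    simp only [e0]; linarith [hz.1.2.2]) (by
    simp only [e0]
    rcases h with h | h
    · left; linarith
    · right; linarith)
  have hpos : ∀ᶠ s in 𝓝[>] (0 : ℝ), 0 < Qf q (z + s • y) := by
    refine Filter.Eventually.filter_mono nhdsWithin_le_nhds ?_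
    refine hQ.continuousAt.tendsto.eventually_const_lt ?_
    simp only [e0]
    exact hz.1.2.1
  refine nonneg_of_hasDerivAt hP ?_
  filter_upwards [hle, hpos] with s h1 h2
  rw [e0]
  exact hz.2 _ ⟨(H0 Ω).add_mem hzH ((H0 Ω).smul_mem s hy), h2, by linarith⟩

/-- The Euler-Lagrange equation of least energy elements. -/
theorem euler (H : Vari Ω q q' a b M r S) {z : Z N} (hz : IsGround Ω q lam z) {y : Z N}
    (hy : y ∈ H0 Ω) :
    Integrable (fun x => q x (vz z x) * vz y x) ∧
      en lam z y = ∫ x, q x (vz z x) * vz y x := by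
  have hzH := hz.1.1
  have iP := fun y hy => (H.hasDerivAt_Pf hzH (y := y) hy).1
  have iQ := fun y hy => (H.hasDerivAt_Qf hzH (y := y) hy).1
  obtain ⟨dP, hdP⟩ : ∃ dP : Z N → ℝ, ∀ y,
      dP y = ∫ x, (q' x (vz z x) * vz z x - q x (vz z x)) / 2 * vz y x := ⟨_, fun _ => rfl⟩
  obtain ⟨dQ, hdQ⟩ : ∃ dQ : Z N → ℝ, ∀ y,
      dQ y = ∫ x, (q' x (vz z x) * vz z x + q x (vz z x)) * vz y x := ⟨_, fun _ => rfl⟩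
  have key : ∀ y ∈ H0 Ω, en lam z z < Qf q z ∨ 2 * en lam z y < dQ y → 0 ≤ dP y :=
    fun y hy h => by
      rw [hdQ] at h
      rw [hdP]
      exact H.deriv_nonneg hz hy h
  have linP : ∀ y ∈ H0 Ω, ∀ w ∈ H0 Ω, ∀ s : ℝ, dP (y + s • w) = dP y + s * dP w :=
    fun y hy w hw s => by
      simp only [hdP]
      exact integral_mul_vz_add_smul (iP y hy) (iP w hw) s
  have linQ : ∀ y ∈ H0 Ω, ∀ w ∈ H0 Ω, ∀ s : ℝ, dQ (y + s • w) = dQ y + s * dQ w :=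
    fun y hy w hw s => by
      simp only [hdQ]
      exact integral_mul_vz_add_smul (iQ y hy) (iQ w hw) s
  have linE : ∀ y w, ∀ s : ℝ, en lam z (y + s • w) = en lam z y + s * en lam z w := by
    intro y w s
    simp only [en, map_add, map_smul, inner_add_right, inner_smul_right]
    ring
  have iq : ∀ y ∈ H0 Ω, Integrable (fun x => q x (vz z x) * vz y x) := by
    intro y hy
    refine (((iQ y hy).div_const 2).sub (iP y hy)).congr (Eventually.of_forall fun x => ?_)
    simp only [Pi.sub_apply]
    ring
  have hrel : ∀ y ∈ H0 Ω, dQ y - 2 * dP y = 2 * ∫ x, q x (vz z x) * vz y x := by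
    intro y hy
    rw [hdQ, hdP, ← integral_const_mul, ← integral_sub
      (f := fun x => (q' x (vz z x) * vz z x + q x (vz z x)) * vz y x) (iQ y hy)
      ((iP y hy).const_mul 2), ← integral_const_mul]
    refine integral_congr_ae (Eventually.of_forall fun x => ?_)
    simp only
    ring
  have hc : 0 < dP z := by
    have h1 : (a - 2) / 2 * Qf q z ≤ dP z := by
      rw [Qf, hdP, ← integral_const_mul]
      refine integral_mono ((H.integrable_mul hzH).const_mul _) (iP z hzH) fun x => ?_
      have := H.nl.low x (vz z x)
      simp only
      nlinarith
    have h2 : 0 < (a - 2) / 2 := by linarith [H.nl.ha]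
    exact (mul_pos h2 hz.1.2.1).trans_le h1
  have hzero : en lam z z = Qf q z := by
    refine le_antisymm hz.1.2.2 (not_lt.1 fun hlt => ?_)
    have h1 := key (z + (-2 : ℝ) • z) ((H0 Ω).add_mem hzH ((H0 Ω).smul_mem _ hzH)) (Or.inl hlt)
    rw [linP z hzH z hzH] at h1
    linarith
  have hself : 2 * en lam z z - dQ z = -(2 * dP z) := by
    have := hrel z hzH
    have h2 : Qf q z = ∫ x, q x (vz z x) * vz z x := rfl
    rw [hzero]
    linarith
  have hge : ∀ y ∈ H0 Ω, 0 ≤ en lam z y - ∫ x, q x (vz z x) * vz y x := by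
    intro y hy
    have h1 : ∀ s : ℝ, 2 * en lam z y - dQ y < s * (2 * dP z) → 0 ≤ dP y + s * dP z := by
      intro s hs
      rw [← linP y hy z hzH]
      refine key _ ((H0 Ω).add_mem hy ((H0 Ω).smul_mem _ hzH)) (Or.inr ?_)
      rw [linE, linQ y hy z hzH]
      have h9 : s * (2 * en lam z z - dQ z) = s * (-(2 * dP z)) := by rw [hself]
      linarith
    have h2 := hrel y hy
    by_contra! hneg
    have h3 := h1 (-(en lam z y - ∫ x, q x (vz z x) * vz y x) / (2 * dP z)
      + (2 * en lam z y - dQ y) / (2 * dP z)) (by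
        rw [add_mul, div_mul_cancel₀ _ (by positivity), div_mul_cancel₀ _ (by positivity)]
        linarith)
    have h4 : (-(en lam z y - ∫ x, q x (vz z x) * vz y x) / (2 * dP z)
      + (2 * en lam z y - dQ y) / (2 * dP z)) * dP z =
        -(en lam z y - ∫ x, q x (vz z x) * vz y x) / 2 + (2 * en lam z y - dQ y) / 2 := by
      field_simp
    rw [h4] at h3
    linarith
  refine ⟨iq y hy, le_antisymm ?_ (sub_nonneg.1 (hge y hy))⟩
  have h1 := hge (y + (-2 : ℝ) • y) ((H0 Ω).add_mem hy ((H0 Ω).smul_mem _ hy))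
  rw [linE, integral_mul_vz_add_smul (iq y hy) (iq y hy)] at h1
  linarith

end Vari

end eulerLagrange

section kato

variable {N : ℕ}

/-- A smooth approximation of the absolute value. -/
def sa (δ t : ℝ) : ℝ := √(t ^ 2 + δ ^ 2) - δ

/-- The derivative of the smooth approximation of the absolute value. -/
def sg (δ t : ℝ) : ℝ := t / √(t ^ 2 + δ ^ 2)

theorem sq_add_sq_pos {δ : ℝ} (hδ : 0 < δ) (t : ℝ) : 0 < t ^ 2 + δ ^ 2 := by positivity

theorem contDiff_sqrt_sq {δ : ℝ} (hδ : 0 < δ) : ContDiff ℝ ∞ fun t : ℝ => √(t ^ 2 + δ ^ 2) :=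
  ((contDiff_id.pow 2).add contDiff_const).sqrt fun t => (sq_add_sq_pos hδ t).ne'

theorem contDiff_sa {δ : ℝ} (hδ : 0 < δ) : ContDiff ℝ ∞ (sa δ) :=
  (contDiff_sqrt_sq hδ).sub contDiff_const

theorem contDiff_sg {δ : ℝ} (hδ : 0 < δ) : ContDiff ℝ ∞ (sg δ) :=
  contDiff_id.div (contDiff_sqrt_sq hδ) fun t => (Real.sqrt_pos.2 (sq_add_sq_pos hδ t)).ne'

theorem hasDerivAt_sqrt_sq {δ : ℝ} (hδ : 0 < δ) (t : ℝ) :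
    HasDerivAt (fun t : ℝ => √(t ^ 2 + δ ^ 2)) (sg δ t) t := by
  have h1 : HasDerivAt (fun t : ℝ => t ^ 2 + δ ^ 2) (2 * t) t := by
    simpa using (hasDerivAt_pow 2 t).add_const (δ ^ 2)
  refine (h1.sqrt (sq_add_sq_pos hδ t).ne').congr_deriv ?_
  rw [sg, mul_div_mul_left _ _ two_ne_zero]

theorem hasDerivAt_sa {δ : ℝ} (hδ : 0 < δ) (t : ℝ) : HasDerivAt (sa δ) (sg δ t) t :=
  (hasDerivAt_sqrt_sq hδ t).sub_const δ

theorem abs_sg_le {δ : ℝ} (hδ : 0 < δ) (t : ℝ) : |sg δ t| ≤ 1 := by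
  have h := Real.sqrt_pos.2 (sq_add_sq_pos hδ t)
  rw [sg, abs_div, abs_of_pos h, div_le_one h]
  refine Real.le_sqrt_of_sq_le ?_
  rw [sq_abs]
  nlinarith

theorem exists_deriv_sg {δ : ℝ} (hδ : 0 < δ) (t : ℝ) :
    ∃ c, HasDerivAt (sg δ) c t ∧ 0 ≤ c ∧ c ≤ 1 / δ := by
  have h := Real.sqrt_pos.2 (sq_add_sq_pos hδ t)
  have hs := Real.sq_sqrt (sq_add_sq_pos hδ t).le
  have hd : HasDerivAt (sg δ) _ t := (hasDerivAt_id t).div (hasDerivAt_sqrt_sq hδ t) h.ne'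
  refine ⟨_, hd, ?_, ?_⟩
  · refine div_nonneg ?_ (sq_nonneg _)
    have : t * sg δ t ≤ √(t ^ 2 + δ ^ 2) := by
      rw [sg, ← mul_div_assoc, div_le_iff₀ h, ← sq, ← sq, hs]
      nlinarith
    simp only [id]
    linarith
  · have h1 : 0 ≤ t * sg δ t := by
      rw [sg, ← mul_div_assoc, ← sq]; positivity
    have h2 : δ ≤ √(t ^ 2 + δ ^ 2) := Real.le_sqrt_of_sq_le (by nlinarith)
    simp only [id]
    rw [div_le_div_iff₀ (by positivity) hδ]
    nlinarith

theorem sa_zero {δ : ℝ} (hδ : 0 < δ) : sa δ 0 = 0 := by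
  rw [sa, zero_pow two_ne_zero, zero_add, Real.sqrt_sq hδ.le, sub_self]

theorem sg_zero (δ : ℝ) : sg δ 0 = 0 := by rw [sg, zero_div]

theorem sa_nonneg {δ : ℝ} (t : ℝ) : 0 ≤ sa δ t := by
  rw [sa, sub_nonneg]
  exact Real.le_sqrt_of_sq_le (by nlinarith)

theorem sa_le {δ : ℝ} (hδ : 0 < δ) (t : ℝ) : sa δ t ≤ |t| := by
  rw [sa, sub_le_iff_le_add]
  refine Real.sqrt_le_iff.2 ⟨by positivity, ?_⟩
  nlinarith [sq_abs t, abs_nonneg t]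

theorem le_sa {δ : ℝ} (t : ℝ) : |t| - δ ≤ sa δ t := by
  rw [sa]
  have : |t| ≤ √(t ^ 2 + δ ^ 2) := Real.le_sqrt_of_sq_le (by rw [sq_abs]; nlinarith)
  linarith

theorem lipschitzWith_sa {δ : ℝ} (hδ : 0 < δ) : LipschitzWith 1 (sa δ) := by
  refine lipschitzWith_of_nnnorm_deriv_le (fun t => (hasDerivAt_sa hδ t).differentiableAt)
    fun t => ?_
  rw [(hasDerivAt_sa hδ t).deriv, ← NNReal.coe_le_coe, coe_nnnorm]
  exact abs_sg_le hδ t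

theorem tendsto_sg {δ : ℕ → ℝ} (hδ : Tendsto δ atTop (𝓝 0)) {t : ℝ} (ht : 0 < t) :
    Tendsto (fun n => sg (δ n) t) atTop (𝓝 1) := by
  have h1 : Tendsto (fun n => t / √(t ^ 2 + (δ n) ^ 2)) atTop (𝓝 (t / √(t ^ 2 + 0 ^ 2))) := by
    refine Tendsto.div tendsto_const_nhds ?_ ?_
    · exact (Real.continuous_sqrt.tendsto _).comp ((hδ.pow 2).const_add _)
    · positivity
  have h2 : t / √(t ^ 2 + 0 ^ 2) = 1 := by
    rw [zero_pow two_ne_zero, add_zero, Real.sqrt_sq ht.le, div_self ht.ne']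
  rwa [h2] at h1

theorem tendsto_sa {δ : ℕ → ℝ} (hδ0 : ∀ n, 0 < δ n) (hδ : Tendsto δ atTop (𝓝 0)) {s : ℕ → ℝ}
    {t : ℝ} (hs : Tendsto s atTop (𝓝 t)) : Tendsto (fun n => sa (δ n) (s n)) atTop (𝓝 |t|) := by
  have h1 := hs.abs
  refine tendsto_of_tendsto_of_tendsto_of_le_of_le (g := fun n => |s n| - δ n) ?_ h1
    (fun n => le_sa _) (fun n => sa_le (hδ0 n) _)
  simpa using h1.sub hδ

theorem gr_comp {F : ℝ → ℝ} {F' : ℝ} {φ : Euc N → ℝ} {x : Euc N} (hF : HasDerivAt F F' (φ x))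
    (hφ : DifferentiableAt ℝ φ x) : gr (fun x => F (φ x)) x = F' • gr φ x := by
  ext i
  have h := hF.comp_hasFDerivAt x hφ.hasFDerivAt
  have h' : HasFDerivAt (fun x => F (φ x)) (F' • fderiv ℝ φ x) x := h
  simp only [gr, pd, PiLp.smul_apply, smul_eq_mul]
  rw [h'.fderiv]
  rfl

theorem gr_mul {φ ψ : Euc N → ℝ} {x : Euc N} (hφ : DifferentiableAt ℝ φ x)
    (hψ : DifferentiableAt ℝ ψ x) :
    gr (fun x => φ x * ψ x) x = φ x • gr ψ x + ψ x • gr φ x := by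
  ext i
  simp only [gr, pd, PiLp.smul_apply, PiLp.add_apply, smul_eq_mul]
  rw [fderiv_fun_mul hφ hψ]
  rfl

theorem IsTest.differentiable {Ω : Set (Euc N)} {φ : Euc N → ℝ} (h : IsTest Ω φ) :
    Differentiable ℝ φ := h.smooth.differentiable (by simp)

theorem IsTest.comp {Ω : Set (Euc N)} {φ : Euc N → ℝ} (h : IsTest Ω φ) {F : ℝ → ℝ}
    (hF : ContDiff ℝ ∞ F) (h0 : F 0 = 0) : IsTest Ω fun x => F (φ x) := by
  refine ⟨hF.comp h.smooth, h.compact.comp_left h0, Subset.trans (closure_mono ?_) h.supp⟩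
  exact Function.support_comp_subset h0 φ

theorem IsTest.mul {Ω : Set (Euc N)} {φ ψ : Euc N → ℝ} (h : IsTest Ω φ) (hψ : ContDiff ℝ ∞ ψ) :
    IsTest Ω fun x => ψ x * φ x :=
  ⟨hψ.mul h.smooth, h.compact.mul_left, (tsupport_mul_subset_right).trans h.supp⟩

theorem IsTest.lap {Ω : Set (Euc N)} {φ : Euc N → ℝ} (h : IsTest Ω φ) : IsTest Ω (lap φ) :=
  ⟨h.smooth.lap_top, h.compact.lap, (tsupport_lap_subset φ).trans h.supp⟩

theorem inner_gz_embZ {Ω : Set (Euc N)} {φ : Euc N → ℝ} (h : IsTest Ω φ) (z : Z N) :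
    inner ℝ (gz z) (gz (embZ h)) = ∫ x, inner ℝ (gz z x) (gr φ x) := by
  rw [L2.inner_def]
  refine integral_congr_ae ?_
  filter_upwards [gz_embZ h] with x hx
  rw [hx]

theorem inner_vz_embZ {Ω : Set (Euc N)} {φ : Euc N → ℝ} (h : IsTest Ω φ) (z : Z N) :
    inner ℝ (vz z) (vz (embZ h)) = ∫ x, vz z x * φ x := by
  rw [L2.inner_def]
  refine integral_congr_ae ?_
  filter_upwards [vz_embZ h] with x hx
  rw [hx]
  exact mul_comm _ _

theorem integrable_inner_gr {Ω Ω' : Set (Euc N)} {φ ψ : Euc N → ℝ} (h : IsTest Ω φ)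
    (h' : IsTest Ω' ψ) : Integrable fun x => inner ℝ (gr φ x) (gr ψ x) := by
  refine (L2.integrable_inner (𝕜 := ℝ) (gz (embZ h)) (gz (embZ h'))).congr ?_
  filter_upwards [gz_embZ h, gz_embZ h'] with x h1 h2
  rw [h1, h2]

theorem inner_gz_embZ_embZ {Ω Ω' : Set (Euc N)} {φ ψ : Euc N → ℝ} (h : IsTest Ω φ)
    (h' : IsTest Ω' ψ) :
    inner ℝ (gz (embZ h)) (gz (embZ h')) = ∫ x, inner ℝ (gr φ x) (gr ψ x) := by
  rw [inner_gz_embZ h']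
  refine integral_congr_ae ?_
  filter_upwards [gz_embZ h] with x hx
  rw [hx]

theorem integral_inner_gr {Ω Ω' : Set (Euc N)} {φ ψ : Euc N → ℝ} (h : IsTest Ω φ)
    (h' : IsTest Ω' ψ) :
    ∫ x, inner ℝ (gr φ x) (gr ψ x) = - ∫ x, φ x * lap ψ x := by
  have h1 : ∀ x, inner ℝ (gr φ x) (gr ψ x) = ∑ i, pd i φ x * pd i ψ x := fun x => by
    rw [inner_gr]
    rfl
  have h2 : ∀ x, φ x * lap ψ x = ∑ i, φ x * pd i (pd i ψ) x := fun x => by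
    rw [lap_eq_sum_pd, Finset.mul_sum]
  simp only [h1, h2]
  rw [integral_finsetSum, integral_finsetSum, ← Finset.sum_neg_distrib]
  · refine Finset.sum_congr rfl fun i _ => ?_
    rw [integral_mul_pd (h.smooth.of_le (by simp)) ((h'.smooth.pd_top i).of_le (by simp))
      (h'.compact.pd i), neg_neg]
  · intro i _
    exact (h.smooth.continuous.mul ((h'.smooth.pd_top i).pd_top i).continuous)
      |>.integrable_of_hasCompactSupport h.compact.mul_right
  · intro i _
    exact ((h.smooth.pd_top i).continuous.mul (h'.smooth.pd_top i).continuous)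
      |>.integrable_of_hasCompactSupport (h.compact.pd i).mul_right

theorem inner_gz_eq {Ω Ω' : Set (Euc N)} {z : Z N} (hz : z ∈ H0 Ω) {ψ : Euc N → ℝ}
    (h' : IsTest Ω' ψ) : inner ℝ (gz z) (gz (embZ h')) = - ∫ x, vz z x * lap ψ x := by
  rw [← inner_vz_embZ h'.lap]
  refine H0_induction (p := fun z => inner ℝ (gz z) (gz (embZ h'))
    = - inner ℝ (vz z) (vz (embZ h'.lap))) (isClosed_eq ?_ ?_) (fun φ h => ?_) hz
  · exact gz.continuous.inner continuous_const
  · exact (vz.continuous.inner continuous_const).neg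
  · rw [inner_gz_embZ_embZ, integral_inner_gr h h', inner_vz_embZ]
    congr 1
    refine integral_congr_ae ?_
    filter_upwards [vz_embZ h] with x hx
    rw [hx]

end kato

section positivity

variable {N : ℕ}

theorem norm_gz_embZ_le {Ω Ω' : Set (Euc N)} {φ ψ : Euc N → ℝ} (h : IsTest Ω φ) (h' : IsTest Ω' ψ)
    (hle : ∀ x, ‖gr φ x‖ ≤ ‖gr ψ x‖) : ‖gz (embZ h)‖ ≤ ‖gz (embZ h')‖ := by
  refine Lp.norm_le_norm_of_ae_le ?_
  filter_upwards [gz_embZ h, gz_embZ h'] with x h1 h2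
  rw [h1, h2]
  exact hle x

theorem norm_vz_embZ_le {Ω Ω' : Set (Euc N)} {φ ψ : Euc N → ℝ} (h : IsTest Ω φ) (h' : IsTest Ω' ψ)
    (hle : ∀ x, |φ x| ≤ |ψ x|) : ‖vz (embZ h)‖ ≤ ‖vz (embZ h')‖ := by
  refine Lp.norm_le_norm_of_ae_le ?_
  filter_upwards [vz_embZ h, vz_embZ h'] with x h1 h2
  rw [h1, h2]
  exact hle x

/-- The absolute value acts on the energy space without increasing the energy. -/
theorem exists_abs {Ω : Set (Euc N)} (hΩm : MeasurableSet Ω) (hΩ : Bornology.IsBounded Ω)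
    (lam : ℝ) {z : Z N} (hz : z ∈ H0 Ω) :
    ∃ w ∈ H0 Ω, (∀ᵐ x, vz w x = |vz z x|) ∧ en lam w w ≤ en lam z z := by
  obtain ⟨φ, h, hlim, hae⟩ := exists_seq_test hz
  set δ : ℕ → ℝ := fun n => 1 / ((n : ℝ) + 1) with hδ
  have hδ0 : ∀ n, 0 < δ n := fun n => by positivity
  have hδl : Tendsto δ atTop (𝓝 0) := tendsto_one_div_add_atTop_nhds_zero_nat
  have hψ : ∀ n, IsTest Ω fun x => sa (δ n) (φ n x) := fun n =>
    (h n).comp (contDiff_sa (hδ0 n)) (sa_zero (hδ0 n))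
  have hg : ∀ n, ‖gz (embZ (hψ n))‖ ≤ ‖gz (embZ (h n))‖ := fun n =>
    norm_gz_embZ_le _ _ fun x => by
      rw [gr_comp (hasDerivAt_sa (hδ0 n) (φ n x)) ((h n).differentiable x), norm_smul]
      exact mul_le_of_le_one_left (norm_nonneg _) (abs_sg_le (hδ0 n) _)
  have hv : ∀ n, ‖vz (embZ (hψ n))‖ ≤ ‖vz (embZ (h n))‖ := fun n =>
    norm_vz_embZ_le _ _ fun x => by
      rw [abs_of_nonneg (sa_nonneg _)]
      exact sa_le (hδ0 n) _
  have hn : ∀ n, ‖embZ (hψ n)‖ ≤ ‖embZ (h n)‖ := fun n => by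
    refine le_of_sq_le_sq ?_ (norm_nonneg _)
    rw [norm_sq_Z, norm_sq_Z]
    exact add_le_add (pow_le_pow_left₀ (norm_nonneg _) (hv n) 2)
      (pow_le_pow_left₀ (norm_nonneg _) (hg n) 2)
  obtain ⟨C, hC⟩ := hlim.norm.bddAbove_range
  obtain ⟨ns, hns, w, hw, hweak, hstrong, hwae⟩ := exists_compact_limit hΩm hΩ
    (z := fun n => embZ (hψ n)) (fun n => embZ_mem (hψ n))
    (C := C) fun n => (hn n).trans (hC ⟨n, rfl⟩)
  have hwz : ∀ᵐ x, vz w x = |vz z x| := by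
    filter_upwards [hae, hwae, ae_all_iff.2 fun n => vz_embZ (hψ n)] with x h1 h2 h3
    have h4 := (tendsto_sa hδ0 hδl h1).comp hns.tendsto_atTop
    refine tendsto_nhds_unique h2 (h4.congr fun n => ?_)
    exact (h3 (ns n)).symm
  refine ⟨w, hw, hwz, ?_⟩
  have hnorm : ‖vz w‖ = ‖vz z‖ := by
    refine le_antisymm (Lp.norm_le_norm_of_ae_le ?_) (Lp.norm_le_norm_of_ae_le ?_) <;>
    · filter_upwards [hwz] with x hx
      rw [hx, Real.norm_eq_abs, Real.norm_eq_abs, abs_abs]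
  refine Vari.en_le_of_tendsto (mu := fun _ => lam)
    (e := fun n => ‖gz (embZ (h (ns n)))‖ ^ 2 + lam * ‖vz (embZ (hψ (ns n)))‖ ^ 2)
    tendsto_const_nhds hweak hstrong ?_ fun n => ?_
  · rw [en_self, ← hnorm]
    exact (((gz.continuous.tendsto z).comp (hlim.comp hns.tendsto_atTop)).norm.pow 2).add
      ((hstrong.norm.pow 2).const_mul lam)
  · rw [en_self]
    have := pow_le_pow_left₀ (norm_nonneg _) (hg (ns n)) 2
    linarith

theorem inner_gr_ge {Ω : Set (Euc N)} {φ ψ : Euc N → ℝ} (h : IsTest Ω φ) (hψ : IsTest univ ψ)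
    (hψ0 : ∀ x, 0 ≤ ψ x) {δ : ℝ} (hδ : 0 < δ) {χ : Euc N → ℝ}
    (hχ : ∀ x, χ x = ψ x * sg δ (φ x)) (x : Euc N) :
    inner ℝ (gr (fun x => sa δ (φ x)) x) (gr ψ x) ≤ inner ℝ (gr φ x) (gr χ x) ∧
    ∀ C, (∀ x, |ψ x| ≤ C) → ‖gr χ x‖ ^ 2 ≤ 2 * ‖gr ψ x‖ ^ 2 + 2 * (C / δ) ^ 2 * ‖gr φ x‖ ^ 2 := by
  obtain ⟨c, hc, hc0, hc1⟩ := exists_deriv_sg hδ (φ x)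
  have e1 : gr χ x = ψ x • c • gr φ x + sg δ (φ x) • gr ψ x := by
    have : χ = fun x => ψ x * (fun x => sg δ (φ x)) x := funext hχ
    rw [this, gr_mul (hψ.differentiable x), gr_comp hc (h.differentiable x)]
    exact ((contDiff_sg hδ).comp h.smooth).differentiable (by simp) x
  constructor
  · rw [e1, gr_comp (hasDerivAt_sa hδ (φ x)) (h.differentiable x), inner_add_right,
      inner_smul_right, inner_smul_right, inner_smul_right, inner_smul_left, RCLike.conj_to_real]
    have := mul_nonneg (hψ0 x) (mul_nonneg hc0 (real_inner_self_nonneg (x := gr φ x)))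
    linarith
  · intro C hC
    have hCx : |ψ x * c| ≤ C / δ := by
      rw [abs_mul, abs_of_nonneg hc0, div_eq_mul_one_div]
      exact mul_le_mul (hC x) hc1 hc0 ((abs_nonneg _).trans (hC x))
    have h1 : ‖gr χ x‖ ≤ C / δ * ‖gr φ x‖ + ‖gr ψ x‖ := by
      rw [e1, smul_smul]
      refine (norm_add_le _ _).trans ?_
      rw [norm_smul, norm_smul]
      refine add_le_add (mul_le_mul_of_nonneg_right hCx (norm_nonneg _)) ?_
      exact mul_le_of_le_one_left (norm_nonneg _) (abs_sg_le hδ _)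
    have h2 := pow_le_pow_left₀ (norm_nonneg _) h1 2
    nlinarith [sq_nonneg (C / δ * ‖gr φ x‖ - ‖gr ψ x‖)]

/-- Kato's inequality for nonnegative weak solutions. -/
theorem kato {Ω : Set (Euc N)} {z : Z N} (hz : z ∈ H0 Ω) (hz0 : ∀ᵐ x, 0 ≤ vz z x)
    {h : Euc N → ℝ} (hh : Integrable h) (hh0 : ∀ᵐ x, vz z x = 0 → h x = 0)
    (hw : ∀ φ, ∀ hφ : IsTest Ω φ, inner ℝ (gz z) (gz (embZ hφ)) = ∫ x, h x * φ x)
    {ψ : Euc N → ℝ} (hψ : IsTest univ ψ) (hψ0 : ∀ x, 0 ≤ ψ x) :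
    - ∫ x, vz z x * lap ψ x ≤ ∫ x, h x * ψ x := by
  obtain ⟨φ, hφ, hlim, hae⟩ := exists_seq_test hz
  obtain ⟨C, hC0, hC⟩ := exists_bound_of_hasCompactSupport hψ.smooth.continuous hψ.compact
  have hhψ : Integrable fun x => h x * ψ x :=
    hh.mul_bdd (c := C) hψ.smooth.continuous.aestronglyMeasurable (Eventually.of_forall hC)
  have hvψ : Integrable fun x => vz z x * lap ψ x := by
    refine (L2.integrable_inner (𝕜 := ℝ) (vz z) (vz (embZ hψ.lap))).congr ?_
    filter_upwards [vz_embZ hψ.lap] with x hx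
    rw [hx]
    exact mul_comm _ _
  have step : ∀ δ : ℝ, 0 < δ →
      - ∫ x, sa δ (vz z x) * lap ψ x ≤ ∫ x, h x * (ψ x * sg δ (vz z x)) := by
    intro δ hδ
    have hχ : ∀ n, IsTest Ω fun x => ψ x * sg δ (φ n x) := fun n =>
      ((hφ n).comp (contDiff_sg hδ) (sg_zero δ)).mul hψ.smooth
    have hΓ : ∀ n, IsTest Ω fun x => sa δ (φ n x) := fun n =>
      (hφ n).comp (contDiff_sa hδ) (sa_zero hδ)
    have hge : ∀ n, - ∫ x, sa δ (φ n x) * lap ψ x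
        ≤ inner ℝ (gz (embZ (hφ n))) (gz (embZ (hχ n))) := by
      intro n
      rw [← integral_inner_gr (hΓ n) hψ, inner_gz_embZ_embZ]
      exact integral_mono (integrable_inner_gr (hΓ n) hψ) (integrable_inner_gr (hφ n) (hχ n))
        fun x => (inner_gr_ge (hφ n) hψ hψ0 hδ (fun _ => rfl) x).1
    have hbound : ∃ K, ∀ n, ‖gz (embZ (hχ n))‖ ≤ K := by
      obtain ⟨D, hD⟩ := ((gz.continuous.tendsto z).comp hlim).norm.bddAbove_range
      refine ⟨√(2 * ‖gz (embZ hψ)‖ ^ 2 + 2 * (C / δ) ^ 2 * D ^ 2), fun n =>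
        Real.le_sqrt_of_sq_le ?_⟩
      have h1 : ‖gz (embZ (hχ n))‖ ^ 2
          ≤ 2 * ‖gz (embZ hψ)‖ ^ 2 + 2 * (C / δ) ^ 2 * ‖gz (embZ (hφ n))‖ ^ 2 := by
        rw [← real_inner_self_eq_norm_sq, ← real_inner_self_eq_norm_sq,
          ← real_inner_self_eq_norm_sq, inner_gz_embZ_embZ, inner_gz_embZ_embZ,
          inner_gz_embZ_embZ, ← integral_const_mul, ← integral_const_mul,
          ← integral_add (f := fun x => 2 * inner ℝ (gr ψ x) (gr ψ x))
            ((integrable_inner_gr hψ hψ).const_mul _)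
            ((integrable_inner_gr (hφ n) (hφ n)).const_mul _)]
        refine integral_mono (integrable_inner_gr (hχ n) (hχ n))
          (((integrable_inner_gr hψ hψ).const_mul _).add
            ((integrable_inner_gr (hφ n) (hφ n)).const_mul _)) fun x => ?_
        simp only [real_inner_self_eq_norm_sq]
        exact (inner_gr_ge (hφ n) hψ hψ0 hδ (fun _ => rfl) x).2 C hC
      refine h1.trans ?_
      have h2 : ‖gz (embZ (hφ n))‖ ≤ D := hD ⟨n, rfl⟩
      gcongr
    obtain ⟨K, hK⟩ := hbound
    have herr : Tendsto (fun n => inner ℝ (gz (embZ (hφ n)) - gz z) (gz (embZ (hχ n)))) atTop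
        (𝓝 0) := by
      have h1 : Tendsto (fun n => ‖gz (embZ (hφ n)) - gz z‖ * K) atTop (𝓝 0) := by
        have := (tendsto_iff_norm_sub_tendsto_zero.1
          ((gz.continuous.tendsto z).comp hlim)).mul_const K
        simpa using this
      refine squeeze_zero_norm (fun n => ?_) h1
      exact (norm_inner_le_norm _ _).trans (mul_le_mul_of_nonneg_left (hK n) (norm_nonneg _))
    have hleft : Tendsto (fun n => - ∫ x, sa δ (φ n x) * lap ψ x) atTop
        (𝓝 (- ∫ x, sa δ (vz z x) * lap ψ x)) := by
      have hcont := (lipschitzWith_sa hδ).continuous_compLp (p := 2)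
        (μ := (volume : Measure (Euc N))) (sa_zero hδ)
      have hl := ((hcont.tendsto _).comp ((vz.continuous.tendsto z).comp hlim)).inner (𝕜 := ℝ)
        (tendsto_const_nhds (x := vz (embZ hψ.lap)))
      have e : ∀ v : Lp ℝ 2 (volume : Measure (Euc N)),
          inner ℝ ((lipschitzWith_sa hδ).compLp (sa_zero hδ) v) (vz (embZ hψ.lap))
            = ∫ x, sa δ (v x) * lap ψ x := by
        intro v
        rw [L2.inner_def]
        refine integral_congr_ae ?_
        filter_upwards [vz_embZ hψ.lap, (lipschitzWith_sa hδ).coeFn_compLp (sa_zero hδ) v]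
          with x h1 h2
        rw [h1, h2]
        exact mul_comm _ _
      have hl' : Tendsto (fun n => ∫ x, sa δ (vz (embZ (hφ n)) x) * lap ψ x) atTop
          (𝓝 (∫ x, sa δ (vz z x) * lap ψ x)) := by
        rw [← e]
        exact hl.congr fun n => e _
      refine (hl'.congr fun n => ?_).neg
      refine integral_congr_ae ?_
      filter_upwards [vz_embZ (hφ n)] with x hx
      rw [hx]
    have hright : Tendsto (fun n => ∫ x, h x * (ψ x * sg δ (φ n x))) atTop
        (𝓝 (∫ x, h x * (ψ x * sg δ (vz z x)))) := by
      refine tendsto_integral_of_dominated_convergence (fun x => |h x| * C) (fun n => ?_)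
        (hh.abs.mul_const C) (fun n => Eventually.of_forall fun x => ?_) ?_
      · exact hh.aestronglyMeasurable.mul (hχ n).smooth.continuous.aestronglyMeasurable
      · rw [Real.norm_eq_abs, abs_mul, abs_mul]
        refine mul_le_mul_of_nonneg_left ?_ (abs_nonneg _)
        exact (mul_le_of_le_one_right (abs_nonneg _) (abs_sg_le hδ _)).trans (hC x)
      · filter_upwards [hae] with x hx
        exact (((contDiff_sg hδ).continuous.tendsto _).comp hx).const_mul _ |>.const_mul _
    have hsum := hright.add herr
    rw [add_zero] at hsum
    refine le_of_tendsto_of_tendsto' hleft hsum fun n => ?_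
    rw [← hw _ (hχ n), inner_sub_left]
    linarith [hge n]
  set δ : ℕ → ℝ := fun n => 1 / ((n : ℝ) + 1) with hδ
  have hδ0 : ∀ n, 0 < δ n := fun n => by positivity
  have hδl : Tendsto δ atTop (𝓝 0) := tendsto_one_div_add_atTop_nhds_zero_nat
  have hvm := (Lp.aestronglyMeasurable (vz z))
  have hleft : Tendsto (fun n => - ∫ x, sa (δ n) (vz z x) * lap ψ x) atTop
      (𝓝 (- ∫ x, vz z x * lap ψ x)) := by
    refine Tendsto.neg ?_
    refine tendsto_integral_of_dominated_convergence (fun x => |vz z x * lap ψ x|) (fun n => ?_)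
      hvψ.abs (fun n => Eventually.of_forall fun x => ?_) ?_
    · exact ((contDiff_sa (hδ0 n)).continuous.comp_aestronglyMeasurable hvm).mul
        hψ.lap.smooth.continuous.aestronglyMeasurable
    · rw [Real.norm_eq_abs, abs_mul, abs_mul, abs_of_nonneg (sa_nonneg _)]
      exact mul_le_mul_of_nonneg_right (sa_le (hδ0 n) _) (abs_nonneg _)
    · filter_upwards [hz0] with x hx
      have := tendsto_sa hδ0 hδl (tendsto_const_nhds (x := vz z x))
      rw [abs_of_nonneg hx] at this
      exact this.mul_const _
  have hright : Tendsto (fun n => ∫ x, h x * (ψ x * sg (δ n) (vz z x))) atTop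
      (𝓝 (∫ x, h x * ψ x)) := by
    refine tendsto_integral_of_dominated_convergence (fun x => |h x| * C) (fun n => ?_)
      (hh.abs.mul_const C) (fun n => Eventually.of_forall fun x => ?_) ?_
    · exact hh.aestronglyMeasurable.mul (hψ.smooth.continuous.aestronglyMeasurable.mul
        ((contDiff_sg (hδ0 n)).continuous.comp_aestronglyMeasurable hvm))
    · rw [Real.norm_eq_abs, abs_mul, abs_mul]
      refine mul_le_mul_of_nonneg_left ?_ (abs_nonneg _)
      exact (mul_le_of_le_one_right (abs_nonneg _) (abs_sg_le (hδ0 n) _)).trans (hC x)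
    · filter_upwards [hz0, hh0] with x h1 h2
      rcases h1.eq_or_lt with h3 | h3
      · simp only [h2 h3.symm, zero_mul]
        exact tendsto_const_nhds
      · have := ((tendsto_sg hδl h3).const_mul (ψ x)).const_mul (h x)
        rwa [mul_one] at this
  exact le_of_tendsto_of_tendsto' hleft hright fun n => step (δ n) (hδ0 n)

end positivity

section regularity

variable {N : ℕ} {Ω : Set (Euc N)} {q q' : Euc N → ℝ → ℝ} {a b M r S lam : ℝ} {z : Z N}
  {v ζ η : Euc N → ℝ}

/-- Nonnegative measurable representatives, vanishing identically off `Ω`. -/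
structure IsRep (Ω : Set (Euc N)) (z : Z N) (v : Euc N → ℝ) : Prop where
  meas : Measurable v
  nonneg : ∀ x, 0 ≤ v x
  off : ∀ x, x ∉ Ω → v x = 0
  ae : ∀ᵐ x, v x = vz z x

/-- The source term of the equation, evaluated along `v`. -/
def source (q : Euc N → ℝ → ℝ) (lam : ℝ) (v : Euc N → ℝ) (x : Euc N) : ℝ :=
  q x (v x) - lam * v x

theorem exists_isRep (hΩ : MeasurableSet Ω) (hz : z ∈ H0 Ω) (hz0 : ∀ᵐ x, 0 ≤ vz z x) :
    ∃ v, IsRep Ω z v := by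
  have hm : Measurable ((aem_vz z).mk (vz z)) := (aem_vz z).measurable_mk
  refine ⟨Ω.indicator fun x => max ((aem_vz z).mk (vz z) x) 0,
    (hm.max measurable_const).indicator hΩ,
    fun x => indicator_nonneg (fun _ _ => le_max_right _ _) x,
    fun x hx => indicator_of_notMem hx _, ?_⟩
  filter_upwards [(aem_vz z).ae_eq_mk, hz0, vz_eq_zero_off hz] with x h1 h2 h3
  by_cases hx : x ∈ Ω
  · rw [indicator_of_mem hx, ← h1, max_eq_left h2]
  · rw [indicator_of_notMem hx, h3 hx]

theorem IsRep.min_const (hv : IsRep Ω z v) {A : ℝ} (hA : 0 ≤ A) (hvA : ∀ᵐ x, v x ≤ A) :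
    IsRep Ω z fun x => min (v x) A := by
  refine ⟨hv.meas.min measurable_const, fun x => le_min (hv.nonneg x) hA, fun x hx => ?_, ?_⟩
  · rw [hv.off x hx, min_eq_left hA]
  · filter_upwards [hvA, hv.ae] with x h1 h2
    rw [min_eq_left h1, h2]

namespace Vari

theorem integrable_of_abs_le (H : Vari Ω q q' a b M r S) (hz : z ∈ H0 Ω) (hv : IsRep Ω z v)
    {F : Euc N → ℝ} (hF : Measurable F) {C : ℝ} (hC : ∀ x ∈ Ω, |F x| ≤ C * (1 + v x ^ r))
    (h0 : ∀ x, x ∉ Ω → F x = 0) : Integrable F := by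
  have h1 : Integrable fun x => |vz z x| ^ r := integrable_abs_rpow (aem_vz z) (H.sob_ne_top hz)
  have h2 : Integrable (Ω.indicator fun _ : Euc N => (1 : ℝ)) :=
    (integrable_indicator_iff H.meas).2 (integrableOn_const H.fin)
  have h3 : Integrable fun x => |C| * (Ω.indicator (fun _ : Euc N => (1 : ℝ)) x + |vz z x| ^ r) :=
    (h2.add h1).const_mul _
  refine h3.mono' hF.aestronglyMeasurable ?_
  filter_upwards [hv.ae] with x hx
  rw [Real.norm_eq_abs]
  have h4 : 0 ≤ v x ^ r := Real.rpow_nonneg (hv.nonneg x) _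
  rw [← hx, abs_of_nonneg (hv.nonneg x)]
  by_cases hxΩ : x ∈ Ω
  · rw [indicator_of_mem hxΩ]
    exact (hC x hxΩ).trans (mul_le_mul_of_nonneg_right (le_abs_self C) (by linarith))
  · rw [indicator_of_notMem hxΩ, h0 x hxΩ, abs_zero]
    have := mul_nonneg (abs_nonneg C) h4
    simpa using this

theorem measurable_comp (H : Vari Ω q q' a b M r S) (hv : Measurable v) :
    Measurable fun x => q x (v x) :=
  H.nl.meas.comp (measurable_id.prodMk hv)

theorem measurable_source (H : Vari Ω q q' a b M r S) (hv : Measurable v) :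
    Measurable (source q lam v) :=
  (H.measurable_comp hv).sub (hv.const_mul _)

theorem integrable_rep (H : Vari Ω q q' a b M r S) (hz : z ∈ H0 Ω) (hv : IsRep Ω z v) :
    Integrable v := by
  refine H.integrable_of_abs_le hz hv hv.meas (C := 1) (fun x _ => ?_) hv.off
  have := rpow_le_one_add_rpow (hv.nonneg x) zero_le_one (by linarith [H.b2, H.hbr] : 1 ≤ r)
  rw [Real.rpow_one] at this
  rw [abs_of_nonneg (hv.nonneg x), one_mul]
  exact this

theorem integrable_comp (H : Vari Ω q q' a b M r S) (hz : z ∈ H0 Ω) (hv : IsRep Ω z v) :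
    Integrable fun x => q x (v x) := by
  refine H.integrable_of_abs_le hz hv (H.measurable_comp hv.meas) (C := 2 * M * 2)
    (fun x _ => ?_) fun x hx => H.nl.off x hx _
  have h1 := rpow_le_one_add_rpow (hv.nonneg x) (by linarith [H.b2] : 0 ≤ b - 1)
    (by linarith [H.hbr] : b - 1 ≤ r)
  have h2 := H.nl.abs_le x (v x)
  rw [abs_of_nonneg (hv.nonneg x)] at h2
  have h3 : 0 ≤ v x ^ r := Real.rpow_nonneg (hv.nonneg x) _
  have hM := H.nl.hM
  refine h2.trans ?_
  rw [mul_assoc (2 * M)]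
  exact mul_le_mul_of_nonneg_left (by linarith) (by linarith)

theorem integrable_source (H : Vari Ω q q' a b M r S) (hz : z ∈ H0 Ω) (hv : IsRep Ω z v) :
    Integrable (source q lam v) :=
  (H.integrable_comp hz hv).sub ((H.integrable_rep hz hv).const_mul _)

theorem source_off (H : Vari Ω q q' a b M r S) (hv : IsRep Ω z v) {x : Euc N} (hx : x ∉ Ω) :
    source q lam v x = 0 := by
  rw [source, H.nl.off x hx, hv.off x hx, mul_zero, sub_zero]

theorem inner_gz_eq_source (H : Vari Ω q q' a b M r S) (hz : IsGround Ω q lam z)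
    (hv : IsRep Ω z v) {φ : Euc N → ℝ} (hφ : IsTest Ω φ) :
    inner ℝ (gz z) (gz (embZ hφ)) = ∫ x, source q lam v x * φ x := by
  have hzH := hz.1.1
  obtain ⟨hi, he⟩ := H.euler hz (embZ_mem hφ)
  have h1 : ∀ᵐ x, q x (vz z x) * vz (embZ hφ) x = q x (v x) * φ x := by
    filter_upwards [hv.ae, vz_embZ hφ] with x h1 h2
    rw [h1, h2]
  have h2 : ∀ᵐ x, vz z x * φ x = v x * φ x := by
    filter_upwards [hv.ae] with x h1
    rw [h1]
  have i1 : Integrable fun x => q x (v x) * φ x := hi.congr h1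
  obtain ⟨C, hC⟩ := hφ.compact.exists_bound_of_continuous hφ.smooth.continuous
  have i2 : Integrable fun x => v x * φ x :=
    (H.integrable_rep hzH hv).mul_bdd hφ.smooth.continuous.aestronglyMeasurable
      (Eventually.of_forall hC)
  rw [en, inner_vz_embZ, integral_congr_ae h1, integral_congr_ae h2] at he
  have i3 : Integrable fun x => lam * (v x * φ x) := i2.const_mul _
  have e : (fun x => source q lam v x * φ x) = fun x => q x (v x) * φ x - lam * (v x * φ x) := by
    ext x; rw [source]; ring
  rw [e, integral_sub i1 i3, integral_const_mul]
  linarith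

theorem weak_eq (H : Vari Ω q q' a b M r S) (hz : IsGround Ω q lam z) (hv : IsRep Ω z v)
    {ψ : Euc N → ℝ} (h1 : ContDiff ℝ ∞ ψ) (h2 : HasCompactSupport ψ) (h3 : tsupport ψ ⊆ Ω) :
    - ∫ x, v x * lap ψ x = ∫ x, source q lam v x * ψ x := by
  have e : ∀ᵐ x, v x * lap ψ x = vz z x * lap ψ x := by
    filter_upwards [hv.ae] with x hx
    rw [hx]
  rw [integral_congr_ae e, ← inner_gz_eq hz.1.1 ⟨h1, h2, h3⟩, H.inner_gz_eq_source hz hv]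

theorem weak_sub (H : Vari Ω q q' a b M r S) (hz : IsGround Ω q lam z) (hv : IsRep Ω z v)
    {ψ : Euc N → ℝ} (h1 : ContDiff ℝ ∞ ψ) (h2 : HasCompactSupport ψ) (h3 : ∀ x, 0 ≤ ψ x) :
    - ∫ x, v x * lap ψ x ≤ ∫ x, source q lam v x * ψ x := by
  have e : ∀ᵐ x, v x * lap ψ x = vz z x * lap ψ x := by
    filter_upwards [hv.ae] with x hx
    rw [hx]
  rw [integral_congr_ae e]
  refine kato hz.1.1 ?_ (H.integrable_source hz.1.1 hv) ?_
    (fun φ hφ => H.inner_gz_eq_source hz hv hφ) ⟨h1, h2, subset_univ _⟩ h3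
  · filter_upwards [hv.ae] with x hx
    rw [← hx]; exact hv.nonneg x
  · filter_upwards [hv.ae] with x hx h0
    rw [source, hx, h0, H.nl.zero, mul_zero, sub_zero]

theorem le_mc_source (H : Vari Ω q q' a b M r S) (hk : IsKer ζ η) (hz : IsGround Ω q lam z)
    (hv : IsRep Ω z v) {ε : ℝ} (hε : 0 < ε) :
    ∀ᵐ x, v x ≤ mc (mol η ε) v x + mc (kap ζ ε) (source q lam v) x :=
  le_mc_of_weak_subsolution hk hε (H.integrable_rep hz.1.1 hv) (H.integrable_source hz.1.1 hv)
    fun _ h1 h2 h3 => H.weak_sub hz hv h1 h2 h3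

theorem source_le (H : Vari Ω q q' a b M r S) {x : Euc N} (hv0 : 0 ≤ v x) :
    source q lam v x ≤ (2 * M + |lam|) * (1 + v x ^ (b - 2)) * v x := by
  have hM := H.nl.hM
  have h1 := H.nl.growth x (v x)
  rw [abs_of_nonneg hv0] at h1
  have e : ∀ c : ℝ, 2 < c → v x ^ (c - 1) = v x ^ (c - 2) * v x := by
    intro c hc
    rcases hv0.eq_or_lt with h | h
    · rw [← h, Real.zero_rpow (by linarith : c - 1 ≠ 0), mul_zero]
    · rw [← Real.rpow_add_one h.ne']; congr 1; ring
  rw [e a H.nl.ha, e b H.b2] at h1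
  have h2 := rpow_le_one_add_rpow hv0 (by linarith [H.nl.ha] : 0 ≤ a - 2)
    (by linarith [H.nl.hab] : a - 2 ≤ b - 2)
  have h3 : 0 ≤ v x ^ (b - 2) := Real.rpow_nonneg hv0 _
  have h4 : q x (v x) ≤ 2 * M * (1 + v x ^ (b - 2)) * v x := by
    refine (le_abs_self _).trans (h1.trans ?_)
    rw [← add_mul, ← mul_assoc]
    refine mul_le_mul_of_nonneg_right ?_ hv0
    nlinarith
  have h5 : -(lam * v x) ≤ |lam| * (1 + v x ^ (b - 2)) * v x := by
    have h6 : -lam ≤ |lam| * (1 + v x ^ (b - 2)) := by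
      nlinarith [neg_le_abs lam, abs_nonneg lam]
    nlinarith
  rw [source]
  linarith

theorem exists_ae_bound (H : Vari Ω q q' a b M r S)
    (hr : (N : ℝ) < 2 * (r / (b - 2))) (hk : IsKer ζ η) (hz : IsGround Ω q lam z)
    (hv : IsRep Ω z v) : ∃ A : ℝ, ∀ᵐ x, v x ≤ A := by
  have hb2 := H.b2
  have hbr := H.hbr
  have hM := H.nl.hM
  have hzH := hz.1.1
  obtain ⟨C, hC0, hCd⟩ : ∃ C : ℝ, 0 < C ∧ C = 2 * M + |lam| :=
    ⟨_, by linarith [abs_nonneg lam], rfl⟩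
  obtain ⟨W, hW⟩ : ∃ W : Euc N → ℝ, ∀ x, W x = Ω.indicator (fun x => C * (1 + v x ^ (b - 2))) x :=
    ⟨_, fun _ => rfl⟩
  have hWm : Measurable W := by
    have : W = Ω.indicator (fun x => C * (1 + v x ^ (b - 2))) := funext hW
    rw [this]
    exact (((hv.meas.pow_const _).const_add 1).const_mul C).indicator H.meas
  have hW0 : ∀ x, 0 ≤ W x := fun x => by
    rw [hW]
    exact indicator_nonneg (fun x _ => mul_nonneg hC0.le
      (add_nonneg zero_le_one (Real.rpow_nonneg (hv.nonneg x) _))) x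
  have hWo : ∀ x, x ∉ Ω → W x = 0 := fun x hx => by rw [hW, indicator_of_notMem hx]
  have hWi : ∀ x ∈ Ω, W x = C * (1 + v x ^ (b - 2)) := fun x hx => by rw [hW, indicator_of_mem hx]
  have hρ : 1 < r / (b - 2) := by rw [one_lt_div (by linarith)]; linarith
  have hρ0 : 0 ≤ r / (b - 2) := by linarith
  have hfin : ∀ F : Euc N → ℝ, Integrable F → (∀ x, 0 ≤ F x) →
      ∫⁻ x, ENNReal.ofReal (F x) ≠ ⊤ := fun F hF h0 =>
    ((hasFiniteIntegral_iff_ofReal (Eventually.of_forall h0)).1 hF.2).ne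
  refine exists_ae_bound_of_subsolution hk hv.meas (H.integrable_rep hzH hv) hv.nonneg
    (V := fun x => ENNReal.ofReal (W x)) hWm.ennreal_ofReal hρ hr ?_ (h := source q lam v) ?_ ?_
    fun ε hε => H.le_mc_source hk hz hv hε
  · have e : ∀ x, ENNReal.ofReal (W x) ^ (r / (b - 2)) = ENNReal.ofReal (W x ^ (r / (b - 2))) :=
      fun x => ENNReal.ofReal_rpow_of_nonneg (hW0 x) hρ0
    rw [lintegral_congr e]
    refine hfin _ (H.integrable_of_abs_le hzH hv (hWm.pow_const _)
      (C := C ^ (r / (b - 2)) * 2 ^ (r / (b - 2))) (fun x hx => ?_) fun x hx => ?_)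
      fun x => Real.rpow_nonneg (hW0 x) _
    · have h1 : 0 ≤ v x ^ (b - 2) := Real.rpow_nonneg (hv.nonneg x) _
      rw [abs_of_nonneg (Real.rpow_nonneg (hW0 x) _), hWi x hx,
        Real.mul_rpow hC0.le (by linarith), mul_assoc]
      refine mul_le_mul_of_nonneg_left ?_ (Real.rpow_nonneg hC0.le _)
      have h2 := add_rpow_le_two_rpow zero_le_one h1 hρ0
      rw [Real.one_rpow, ← Real.rpow_mul (hv.nonneg x), mul_div_cancel₀ r (by linarith)] at h2
      exact h2
    · rw [hWo x hx, Real.zero_rpow (by linarith)]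
  · intro x
    rw [← ENNReal.ofReal_mul (hW0 x)]
    refine ENNReal.ofReal_le_ofReal ?_
    by_cases hx : x ∈ Ω
    · rw [hWi x hx, hCd]
      exact H.source_le (hv.nonneg x)
    · rw [H.source_off hv hx]
      exact mul_nonneg (hW0 x) (hv.nonneg x)
  · have e : ∀ x, ENNReal.ofReal (W x) * ENNReal.ofReal (v x) = ENNReal.ofReal (W x * v x) :=
      fun x => (ENNReal.ofReal_mul (hW0 x)).symm
    rw [lintegral_congr e]
    refine hfin _ (H.integrable_of_abs_le hzH hv (hWm.mul hv.meas) (C := C * 2) (fun x hx => ?_)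
      fun x hx => by rw [hWo x hx, zero_mul]) fun x => mul_nonneg (hW0 x) (hv.nonneg x)
    rw [abs_of_nonneg (mul_nonneg (hW0 x) (hv.nonneg x)), hWi x hx, mul_assoc, mul_assoc]
    refine mul_le_mul_of_nonneg_left ?_ hC0.le
    have h0 := hv.nonneg x
    have h1 := rpow_le_one_add_rpow h0 zero_le_one (by linarith : 1 ≤ r)
    rw [Real.rpow_one] at h1
    have h2 : v x ^ (b - 2) * v x = v x ^ (b - 1) := by
      rcases h0.eq_or_lt with h | h
      · rw [← h, Real.zero_rpow (by linarith : b - 1 ≠ 0), mul_zero]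
      · rw [← Real.rpow_add_one h.ne']; congr 1; ring
    have h3 := rpow_le_one_add_rpow h0 (by linarith : 0 ≤ b - 1) (by linarith : b - 1 ≤ r)
    rw [add_mul, h2]
    linarith

/-- Nonnegative ground states are bounded. -/
theorem exists_bounded_rep (H : Vari Ω q q' a b M r S)
    (hr : (N : ℝ) < 2 * (r / (b - 2))) (hk : IsKer ζ η) (hz : IsGround Ω q lam z)
    (hz0 : ∀ᵐ x, 0 ≤ vz z x) : ∃ v, IsRep Ω z v ∧ ∃ A, ∀ x, v x ≤ A := by
  obtain ⟨v, hv⟩ := exists_isRep H.meas hz.1.1 hz0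
  obtain ⟨A, hA⟩ := H.exists_ae_bound hr hk hz hv
  refine ⟨_, hv.min_const (abs_nonneg A) ?_, |A|, fun x => min_le_right _ _⟩
  filter_upwards [hA] with x hx
  exact hx.trans (le_abs_self A)

theorem exists_nonneg_ground (H : Vari Ω q q' a b M r S) (hz : IsGround Ω q lam z) :
    ∃ w, IsGround Ω q lam w ∧ (∀ᵐ x, 0 ≤ vz w x) ∧ ‖vz w‖ = ‖vz z‖ := by
  obtain ⟨⟨hzH, hQ, hle⟩, hmin⟩ := hz
  obtain ⟨w, hw, hwv, hen⟩ := exists_abs H.meas H.bdd lam hzH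
  have eQ : Qf q w = Qf q z := by
    refine integral_congr_ae ?_
    filter_upwards [hwv] with x hx
    rw [hx]
    rcases abs_choice (vz z x) with h | h
    · rw [h]
    · rw [h, H.nl.odd]; ring
  have eP : Pf q w = Pf q z := by
    refine integral_congr_ae ?_
    filter_upwards [hwv] with x hx
    rw [hx]
    rcases abs_choice (vz z x) with h | h
    · rw [h]
    · rw [h, H.nl.dens_neg]
  refine ⟨w, ⟨⟨hw, eQ ▸ hQ, eQ ▸ hen.trans hle⟩, fun y hy => eP ▸ hmin y hy⟩, ?_, ?_⟩
  · filter_upwards [hwv] with x hx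
    rw [hx]; exact abs_nonneg _
  · refine le_antisymm (Lp.norm_le_norm_of_ae_le ?_) (Lp.norm_le_norm_of_ae_le ?_)
    all_goals
      filter_upwards [hwv] with x hx
      rw [hx, Real.norm_eq_abs, Real.norm_eq_abs, abs_abs]

end Vari

end regularity

section classical

variable {N : ℕ} {Ω : Set (Euc N)} {q q' : Euc N → ℝ → ℝ} {a b M r S lam : ℝ} {z : Z N}
  {ζ η : Euc N → ℝ}

theorem lap_congr_of_eventuallyEq {u w : Euc N → ℝ} {x : Euc N} (h : u =ᶠ[𝓝 x] w) :
    lap u x = lap w x := by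
  refine Finset.sum_congr rfl fun i _ => ?_
  have h1 : (fun y => fderiv ℝ u y (EuclideanSpace.single i 1)) =ᶠ[𝓝 x]
      fun y => fderiv ℝ w y (EuclideanSpace.single i 1) := by
    filter_upwards [h.fderiv (𝕜 := ℝ)] with y hy
    rw [hy]
  rw [h1.fderiv_eq]

theorem continuousOn_closure_indicator (hΩ : IsOpen Ω) {w : Euc N → ℝ} (hw : ContinuousOn w Ω)
    (hw0 : ∀ x ∈ Ω, 0 ≤ w x) (hb : ∀ ξ ∈ frontier Ω, ∀ t : ℝ, 0 < t →
      ∃ r > 0, ∀ x ∈ Ω ∩ Metric.ball ξ r, w x ≤ t) : ContinuousOn (Ω.indicator w) (closure Ω) := by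
  intro x hx
  by_cases hxΩ : x ∈ Ω
  · refine ContinuousAt.continuousWithinAt ?_
    refine (hw.continuousAt (hΩ.mem_nhds hxΩ)).congr ?_
    filter_upwards [hΩ.mem_nhds hxΩ] with y hy
    rw [indicator_of_mem hy]
  · have hxf : x ∈ frontier Ω := by
      rw [hΩ.frontier_eq]
      exact ⟨hx, hxΩ⟩
    refine ContinuousAt.continuousWithinAt ?_
    rw [Metric.continuousAt_iff]
    intro ε hε
    obtain ⟨ρ, hρ, h⟩ := hb x hxf (ε / 2) (by linarith)
    refine ⟨ρ, hρ, fun y hy => ?_⟩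
    rw [indicator_of_notMem hxΩ, Real.dist_0_eq_abs]
    by_cases hyΩ : y ∈ Ω
    · rw [indicator_of_mem hyΩ, abs_of_nonneg (hw0 y hyΩ)]
      linarith [h y ⟨hyΩ, hy⟩]
    · rw [indicator_of_notMem hyΩ, abs_zero]
      exact hε

/-- Nonnegative ground states are positive classical solutions. -/
theorem Vari.exists_isPosSolution (H : Vari Ω q q' a b M r S)
    (hr : (N : ℝ) < 2 * (r / (b - 2))) (hk : IsKer ζ η) (hconn : IsConnected Ω)
    (hc1 : ∀ x ∈ frontier Ω, ∃ U : Set (Euc N), IsOpen U ∧ x ∈ U ∧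
      ∃ F : Euc N → ℝ, ContDiff ℝ 1 F ∧ (∀ y ∈ U, fderiv ℝ F y ≠ 0) ∧
        Ω ∩ U = {y ∈ U | F y < 0})
    {f : Euc N → ℝ → ℝ} (hf : ContDiffOn ℝ 1 (Function.uncurry f) (Ω ×ˢ (univ : Set ℝ)))
    (hqf : ∀ x ∈ Ω, ∀ t, 0 ≤ t → q x t = f x t)
    (hz : IsGround Ω q lam z) (hz0 : ∀ᵐ x, 0 ≤ vz z x) :
    ∃ U : Euc N → ℝ, IsPosSolution Ω f lam U ∧ ∫ x in Ω, U x ^ 2 = ‖vz z‖ ^ 2 := by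
  obtain ⟨v, hv, A, hvA⟩ := H.exists_bounded_rep hr hk hz hz0
  have hzH := hz.1.1
  have hvi := H.integrable_rep hzH hv
  have hsi : Integrable (source q lam v) := H.integrable_source hzH hv
  have hsm : Measurable (source q lam v) := H.measurable_source hv.meas
  have hb1 : 0 ≤ b - 1 := by linarith [H.b2]
  have hB : ∀ x, |source q lam v x| ≤ 2 * M * (1 + A ^ (b - 1)) + |lam| * A := by
    intro x
    have h1 := H.nl.abs_le x (v x)
    rw [abs_of_nonneg (hv.nonneg x)] at h1
    have h2 := Real.rpow_le_rpow (hv.nonneg x) (hvA x) hb1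
    have hM := H.nl.hM
    rw [source]
    refine (abs_sub _ _).trans (add_le_add (h1.trans ?_) ?_)
    · exact mul_le_mul_of_nonneg_left (by linarith) (by linarith)
    · rw [abs_mul, abs_of_nonneg (hv.nonneg x)]
      exact mul_le_mul_of_nonneg_left (hvA x) (abs_nonneg _)
  have hΦ : ContDiffOn ℝ 1 (Function.uncurry fun (x : Euc N) (t : ℝ) => f x t - lam * t)
      (Ω ×ˢ (univ : Set ℝ)) :=
    hf.sub (contDiff_const.mul contDiff_snd).contDiffOn
  have hwk : ∀ ψ : Euc N → ℝ, ContDiff ℝ ∞ ψ → HasCompactSupport ψ → tsupport ψ ⊆ Ω →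
      -∫ x, v x * lap ψ x = ∫ x, source q lam v x * ψ x :=
    fun ψ h1 h2 h3 => H.weak_eq hz hv h1 h2 h3
  obtain ⟨w, hw2, hvw, hweq⟩ := exists_solution_on hk H.op hvi hv.meas (C := A)
    (fun x => by rw [abs_of_nonneg (hv.nonneg x)]; exact hvA x) hsi hsm hB hΦ
    (Eventually.of_forall fun x hx => by
      rw [source, hqf x hx _ (hv.nonneg x)]) hwk
  have hwc : ContinuousOn w Ω := hw2.continuousOn
  have hw0 : ∀ x ∈ Ω, 0 ≤ w x := by
    refine le_of_ae_le_of_continuousOn H.op continuousOn_const hwc ?_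
    filter_upwards [hvw] with x hx hxΩ
    rw [← hx hxΩ]; exact hv.nonneg x
  have hpos : ∀ x ∈ Ω, 0 < w x := by
    refine pos_of_zero_set_open H.op hconn hwc hw0 (fun x₀ hx₀ h0 => ?_) ?_
    · refine eq_zero_near_of_eq_zero hk hk.eint H.op hvi hv.meas hv.nonneg hvA hsi hsm hB
        (abs_nonneg lam) (fun x => ?_) hwk hwc hvw hx₀ h0
      have h1 : 0 ≤ q x (v x) := by
        rcases (hv.nonneg x).eq_or_lt with h | h
        · rw [← h, H.nl.zero]
        · exact nonneg_of_mul_nonneg_left (H.nl.nonneg x (v x)) h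
      have h2 := mul_le_mul_of_nonneg_right (le_abs_self lam) (hv.nonneg x)
      rw [source]
      linarith
    · by_contra! hne
      refine hz.1.2.1.ne' ?_
      refine integral_eq_zero_of_ae ?_
      filter_upwards [hvw, hv.ae] with x h1 h2
      by_cases hx : x ∈ Ω
      · rw [← h2, h1 hx, hne x hx, mul_zero, Pi.zero_apply]
      · rw [H.nl.off x hx, zero_mul, Pi.zero_apply]
  have hbd : ∀ ξ ∈ frontier Ω, ∀ t : ℝ, 0 < t →
      ∃ r > 0, ∀ x ∈ Ω ∩ Metric.ball ξ r, w x ≤ t := fun ξ hξ t ht =>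
    tendsto_zero_at_boundary hk hk.eint H.op hv.meas hv.nonneg hvA hv.off hsm hB
      (fun ε hε => H.le_mc_source hk hz hv hε) hwc hvw hξ (hc1 ξ hξ) ht
  refine ⟨Ω.indicator w, ⟨hw2.congr fun x hx => indicator_of_mem hx _,
    continuousOn_closure_indicator H.op hwc hw0 hbd, fun x hx => ?_, fun x hx => ?_,
    fun x hx => ?_⟩, ?_⟩
  · rw [indicator_of_mem hx]; exact hpos x hx
  · refine indicator_of_notMem (fun h => ?_) _
    rw [H.op.frontier_eq] at hx
    exact hx.2 h
  · have e : Ω.indicator w =ᶠ[𝓝 x] w := by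
      filter_upwards [H.op.mem_nhds hx] with y hy
      rw [indicator_of_mem hy]
    rw [lap_congr_of_eventuallyEq e, hweq x hx, indicator_of_mem hx]
    ring
  · rw [← real_inner_self_eq_norm_sq, L2.inner_def, ← integral_indicator H.meas]
    refine integral_congr_ae ?_
    filter_upwards [hvw, hv.ae, vz_eq_zero_off hzH] with x h1 h2 h3
    by_cases hx : x ∈ Ω
    · rw [indicator_of_mem hx, indicator_of_mem hx, ← h1 hx, h2]
      simp [sq]
    · rw [indicator_of_notMem hx, h3 hx]
      simp

end classical

/-- the mass map `λ ↦ ∫_Ω u_λ²` is continuous on `(-λ₁(Ω), +∞)`. -/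
theorem statement7 {N : ℕ} {Ω : Set (Euc N)} {f : Euc N → ℝ → ℝ} {d : Euc N → ℝ}
    {g : Euc N → ℝ → ℝ} {p : ℝ} {u : ℝ → Euc N → ℝ} (H : Standing N Ω f d g p u) :
    ContinuousOn (fun lam : ℝ => ∫ x in Ω, (u lam x) ^ 2) (Ioi (- firstEig Ω)) := by
  obtain ⟨a, b, ha, hab, hb, har⟩ := H.f_ar
  obtain ⟨M, hM, hfM⟩ := H.f_bdd
  obtain ⟨ζ, η, hk⟩ := exists_isKer N
  obtain ⟨r, S, hbr, hr, hS, hsob⟩ := exists_sobolev H.bdd H.dim (ha.trans_le hab) hb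
  have hnl := nonlin_oddExt H.isOpen H.f_c1 H.f_zero ha hab har hM fun x hx => (hfM x hx).1
  have V : Vari Ω (oddExt Ω f) _ a b M r S := ⟨H.isOpen, H.bdd, H.conn.nonempty, hnl, hbr, hS, hsob⟩
  have key : ∀ lam, -firstEig Ω < lam → ∀ z, IsGround Ω (oddExt Ω f) lam z →
      ∫ x in Ω, (u lam x) ^ 2 = ‖vz z‖ ^ 2 := by
    intro lam hlam z hz
    obtain ⟨w, hw, hw0, hwz⟩ := V.exists_nonneg_ground hz
    obtain ⟨U, hU, hUw⟩ := V.exists_isPosSolution hr hk H.conn H.c1bdry H.f_c1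
      (fun x hx t ht => oddExt_of_nonneg hx ht) hw hw0
    rw [← hwz, ← hUw]
    refine setIntegral_congr_fun V.meas fun x hx => ?_
    simp only [(H.sol lam hlam).2 U hU (subset_closure hx)]
  intro lam hlam
  refine tendsto_of_subseq_tendsto fun mu hmu => ?_
  rw [tendsto_nhdsWithin_iff] at hmu
  obtain ⟨hmu, hmem⟩ := hmu
  obtain ⟨n₀, hn₀⟩ := eventually_atTop.1 hmem
  have hsh : ∀ n, -firstEig Ω < mu (n + n₀) := fun n => hn₀ _ (Nat.le_add_left _ _)
  choose z hz using fun n => V.exists_isLeast (hsh n)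
  obtain ⟨ns, -, w, hw, hlim⟩ := V.exists_isLeast_limit hlam
    (hmu.comp (tendsto_add_atTop_nat n₀)) hz
  refine ⟨fun n => ns n + n₀, ?_⟩
  beta_reduce
  rw [key lam hlam w hw]
  refine (hlim.norm.pow 2).congr fun n => ?_
  exact (key _ (hsh (ns n)) _ (hz (ns n))).symm
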